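/- arXiv:1703.08854 — 4 statements merged into one kernel-verified Lean document; each statement's English description precedes it below -/
import Mathlib

section
/- Let (A₁,B₁) and (A₂,B₂) be pairs of ternary quadratic forms over ℚ (symmetric 3×3 rational matrices) such that for each i = 1,2: Aᵢ and Bᵢ are linearly independent over ℚ, the pair (Aᵢ,Bᵢ) is non-singular and anisotropic over ℚ, and the binary cubic det(Aᵢ·X − Bᵢ·Y) has no repeated linear factor over an algebraic closure of ℚ; assume q_ℚ(A₁,B₁) = q_ℚ(A₂,B₂). Let p be a prime number such that det(A₁·X − B₁·Y) splits completely into linear factors over the field ℚ_p of p-adic numbers. Then for every π ∈ ℚ_p, the value sets satisfy {xᵀ(A₁·π − B₁)x : 0 ≠ x ∈ ℚ_p³} = {xᵀ(A₂·π − B₂)x : 0 ≠ x ∈ ℚ_p³}; in particular, (A₁,B₁) is isotropic over ℚ_p if and only if (A₂,B₂) is isotropic over ℚ_p. -/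
open Matrix

/-- Simultaneous rational representations of a pair of ternary quadratic forms. -/
def simRepQ (A B : Matrix (Fin 3) (Fin 3) ℚ) : Set (ℚ × ℚ) :=
  {p : ℚ × ℚ | ∃ x : Fin 3 → ℚ, x ≠ 0 ∧ x ⬝ᵥ (A *ᵥ x) = p.1 ∧ x ⬝ᵥ (B *ᵥ x) = p.2}

/-- The pair `(A,B)` factors, over the field `K`, as a product of three linear forms
`l i` (i.e. `det (A·x − B·y) = ∏ i, ((l i).1 x − (l i).2 y)`), with pairwise
non-proportional factors: `det (A·X − B·Y)` has no repeated linear factor over `K`. -/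
def SplitsDistinctly {K : Type*} [Field K] (A B : Matrix (Fin 3) (Fin 3) K) : Prop :=
  ∃ l : Fin 3 → K × K,
    (∀ x y : K, (x • A - y • B).det = ∏ i, ((l i).1 * x - (l i).2 * y)) ∧
    ∀ i j, i ≠ j → (l i).1 * (l j).2 ≠ (l i).2 * (l j).1

/-- The pair `(A,B)` splits completely into linear factors over `K`. -/
def SplitsCompletely {K : Type*} [Field K] (A B : Matrix (Fin 3) (Fin 3) K) : Prop :=
  ∃ l : Fin 3 → K × K,
    ∀ x y : K, (x • A - y • B).det = ∏ i, ((l i).1 * x - (l i).2 * y)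

section Conics

variable {F : Type*} [Field F]

/-- The value of the ternary quadratic form with matrix `C` at `x`. -/
def qv (C : Matrix (Fin 3) (Fin 3) F) (x : Fin 3 → F) : F := x ⬝ᵥ (C *ᵥ x)

theorem qv_eq {C : Matrix (Fin 3) (Fin 3) F} (hC : C.IsSymm) (x : Fin 3 → F) :
    qv C x = C 0 0 * x 0 ^ 2 + C 1 1 * x 1 ^ 2 + C 2 2 * x 2 ^ 2 + 2 * C 0 1 * x 0 * x 1
      + 2 * C 0 2 * x 0 * x 2 + 2 * C 1 2 * x 1 * x 2 := by
  have h1 := hC.apply 0 1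
  have h2 := hC.apply 0 2
  have h3 := hC.apply 1 2
  simp only [qv, dotProduct, mulVec, Fin.sum_univ_three, h1, h2, h3]
  ring

theorem qv_smul_vec (C : Matrix (Fin 3) (Fin 3) F) (s : F) (x : Fin 3 → F) :
    qv C (s • x) = s ^ 2 * qv C x := by
  simp only [qv, mulVec_smul, smul_dotProduct, dotProduct_smul, smul_eq_mul]; ring

theorem qv_smul (C : Matrix (Fin 3) (Fin 3) F) (s : F) (x : Fin 3 → F) :
    qv (s • C) x = s * qv C x := by
  simp only [qv, smul_mulVec, dotProduct_smul, smul_eq_mul]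

theorem qv_sub (A B : Matrix (Fin 3) (Fin 3) F) (x : Fin 3 → F) :
    qv (A - B) x = qv A x - qv B x := by
  simp only [qv, sub_mulVec, dotProduct_sub]

theorem qv_add (A B : Matrix (Fin 3) (Fin 3) F) (x : Fin 3 → F) :
    qv (A + B) x = qv A x + qv B x := by
  simp only [qv, add_mulVec, dotProduct_add]

theorem qv_zero_vec (C : Matrix (Fin 3) (Fin 3) F) : qv C 0 = 0 := by
  simp [qv]

theorem qv_add_vec {C : Matrix (Fin 3) (Fin 3) F} (hC : C.IsSymm) (x y : Fin 3 → F) :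
    qv C (x + y) = qv C x + 2 * (y ⬝ᵥ (C *ᵥ x)) + qv C y := by
  have h : x ⬝ᵥ (C *ᵥ y) = y ⬝ᵥ (C *ᵥ x) := by
    rw [dotProduct_mulVec, ← mulVec_transpose, hC.eq, dotProduct_comm]
  simp only [qv, mulVec_add, add_dotProduct, dotProduct_add, h]
  ring

/-- A form with a nonsingular zero is universal. -/
theorem universal_of_zero [CharZero F] {C : Matrix (Fin 3) (Fin 3) F} (hC : C.IsSymm)
    {x₀ : Fin 3 → F} (h0 : qv C x₀ = 0) (h1 : C *ᵥ x₀ ≠ 0) (e : F) : ∃ x, qv C x = e := by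
  obtain ⟨i, hi⟩ := Function.ne_iff.1 h1
  have hi' : (C *ᵥ x₀) i ≠ 0 := hi
  set r : Fin 3 → F := Pi.single i (1 / (2 * (C *ᵥ x₀) i)) with hr
  have hrc : r ⬝ᵥ (C *ᵥ x₀) = 1 / 2 := by
    rw [hr, single_dotProduct]; field_simp
  refine ⟨(e - qv C r) • x₀ + r, ?_⟩
  rw [qv_add_vec hC, qv_smul_vec, h0, mulVec_smul, dotProduct_smul, hrc, smul_eq_mul]
  field_simp
  ring

theorem exists_orthogonal (n : Fin 3 → F) : ∃ k : Fin 3 → F, k ≠ 0 ∧ n ⬝ᵥ k = 0 := by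
  by_cases h : n 0 = 0
  · exact ⟨![1, 0, 0], fun h' => by simpa using congrFun h' 0, by
      simp [dotProduct, Fin.sum_univ_three, h]⟩
  · refine ⟨![-n 1, n 0, 0], fun h' => h (by simpa using congrFun h' 1), by
      simp [dotProduct, Fin.sum_univ_three]; ring⟩

/-- A nondegenerate ternary form representing minus its determinant is isotropic. -/
theorem isotropic_of_represents_neg_det [CharZero F] {C : Matrix (Fin 3) (Fin 3) F}
    (hC : C.IsSymm) (hd : C.det ≠ 0) {x : Fin 3 → F} (hx : qv C x = -C.det) :
    ∃ y, y ≠ 0 ∧ qv C y = 0 := by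
  obtain ⟨k, hk0, hk⟩ := exists_orthogonal (C *ᵥ x)
  set n := C *ᵥ x with hn
  set m := C *ᵥ k with hm
  set T : Fin 3 → F := ![n 1 * m 2 - n 2 * m 1, n 2 * m 0 - n 0 * m 2, n 0 * m 1 - n 1 * m 0]
    with hT
  have h1 := hC.apply 0 1
  have h2 := hC.apply 0 2
  have h3 := hC.apply 1 2
  have hqT : qv C T = C.det * (qv C x * qv C k - (n ⬝ᵥ k) ^ 2) := by
    rw [qv_eq hC, qv_eq hC x, qv_eq hC k, det_fin_three]
    simp only [hT, hn, hm, dotProduct, mulVec, Fin.sum_univ_three, h1, h2, h3, cons_val_zero,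
      cons_val_one, cons_val]
    ring
  have hTm : T ⬝ᵥ m = 0 := by
    simp only [hT, dotProduct, Fin.sum_univ_three, cons_val_zero, cons_val_one, cons_val]
    ring
  have key : ∀ s : F, s ^ 2 = C.det ^ 2 → qv C (s • k + T) = 0 := by
    intro s hs
    rw [qv_add_vec hC, qv_smul_vec, mulVec_smul, dotProduct_smul, ← hm, hTm, hqT, hk, hx, hs]
    simp only [smul_eq_mul]
    ring
  by_cases hne : C.det • k + T = 0
  · refine ⟨(-C.det) • k + T, fun h => hk0 ?_, key _ (by ring)⟩
    have : (2 * C.det) • k = 0 := by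
      have h' : (C.det • k + T) - ((-C.det) • k + T) = 0 := by rw [hne, h, sub_zero]
      rw [← h']; module
    exact (smul_eq_zero.1 this).resolve_left (mul_ne_zero two_ne_zero hd)
  · exact ⟨_, hne, key _ rfl⟩

theorem mul_eq_mul_of_adjugate_eq_zero {M : Matrix (Fin 3) (Fin 3) F} (hM : M.adjugate = 0)
    (i j k l : Fin 3) : M i j * M k l = M i l * M k j := by
  have h : ∀ a b, M.adjugate a b = 0 := by simp [hM]
  have key : ∀ a b : Fin 3, M (a + 1) (b + 1) * M (a + 2) (b + 2)
      = M (a + 1) (b + 2) * M (a + 2) (b + 1) := by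
    intro a b
    have hab := h b a
    rw [adjugate_fin_three] at hab
    fin_cases a <;> fin_cases b <;> simp at hab ⊢ <;> grind
  have cases : ∀ a b : Fin 3, a = b ∨ ∃ c : Fin 3, (a = c + 1 ∧ b = c + 2) ∨
      (a = c + 2 ∧ b = c + 1) := by decide
  rcases cases i k with rfl | ⟨c, ⟨rfl, rfl⟩ | ⟨rfl, rfl⟩⟩ <;>
  rcases cases j l with rfl | ⟨d, ⟨rfl, rfl⟩ | ⟨rfl, rfl⟩⟩
  all_goals first
    | ring1
    | linear_combination key c d
    | linear_combination -key c d

theorem adjugate_mul_adjugate {C : Matrix (Fin 3) (Fin 3) F} (hd : C.det = 0)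
    (i j k l : Fin 3) :
    C.adjugate i j * C.adjugate k l = C.adjugate i l * C.adjugate k j := by
  refine mul_eq_mul_of_adjugate_eq_zero ?_ i j k l
  have h := adjugate_adjugate C (by simp)
  rw [h, hd]; simp

theorem exists_rank_one_of_sq {C : Matrix (Fin 3) (Fin 3) F} (hC : C.IsSymm) (hd : C.det = 0)
    {i : Fin 3} (hi : C.adjugate i i ≠ 0) (hs : IsSquare (-C.adjugate i i)) :
    ∃ w : Fin 3 → F, ∀ j k, -C.adjugate j k = w j * w k := by
  obtain ⟨s, hs⟩ := hs
  have hs0 : s ≠ 0 := by rintro rfl; apply hi; simpa using hs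
  have hsym : C.adjugate.IsSymm := hC.adjugate
  refine ⟨fun j => C.adjugate i j / s, fun j k => ?_⟩
  have h1 := adjugate_mul_adjugate hd i i j k
  rw [hsym.apply i j] at h1
  field_simp
  have : C.adjugate i i = - s ^ 2 := by linear_combination -hs
  rw [this] at h1
  linear_combination h1

theorem qv_submatrix (C : Matrix (Fin 3) (Fin 3) F) (σ : Equiv.Perm (Fin 3)) (x : Fin 3 → F) :
    qv (C.submatrix σ σ) (x ∘ σ) = qv C x := by
  simp only [qv, submatrix_mulVec_equiv]
  rw [Function.comp_assoc]; simp

/-- The values of a degenerate form whose `i`-th principal minor is nonzero are those of a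
scaled norm form. -/
theorem exists_norm_form [CharZero F] {C : Matrix (Fin 3) (Fin 3) F} (hC : C.IsSymm)
    (hd : C.det = 0)
    {i : Fin 3} (hi : C.adjugate i i ≠ 0) :
    ∃ a : F, a ≠ 0 ∧ ∀ e, (∃ x, qv C x = e) ↔
      ∃ Y Z, a * e = Y ^ 2 - (-C.adjugate i i) * Z ^ 2 := by
  wlog h : i = 0 generalizing C i
  · set σ := Equiv.swap 0 i
    have e1 : (C.submatrix σ σ).adjugate = C.adjugate.submatrix σ σ :=
      adjugate_submatrix_equiv_self σ C
    have e2 : (C.submatrix σ σ).adjugate 0 0 = C.adjugate i i := by simp [e1, σ]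
    obtain ⟨a, ha, H⟩ := this (hC.submatrix σ) (by rw [det_submatrix_equiv_self, hd])
      (i := 0) (by rwa [e2]) rfl
    refine ⟨a, ha, fun e => ?_⟩
    rw [← e2, ← H]
    constructor
    · rintro ⟨x, hx⟩; exact ⟨x ∘ σ, by rw [qv_submatrix, hx]⟩
    · rintro ⟨x, hx⟩
      refine ⟨x ∘ σ.symm, ?_⟩
      rw [← hx, ← qv_submatrix C σ, Function.comp_assoc]; simp
  subst h
  have h1 := hC.apply 0 1
  have h2 := hC.apply 0 2
  have h3 := hC.apply 1 2
  have hadj : C.adjugate 0 0 = C 1 1 * C 2 2 - C 1 2 ^ 2 := by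
    rw [adjugate_fin_three]; simp [h3]; ring
  rw [det_fin_three, h1, h2, h3] at hd
  rw [hadj] at hi ⊢
  -- the values only depend on two coordinates
  have red : ∀ e, (∃ x, qv C x = e) ↔ ∃ y z, C 1 1 * y ^ 2 + 2 * C 1 2 * y * z
      + C 2 2 * z ^ 2 = e := by
    intro e
    constructor
    · rintro ⟨x, rfl⟩
      refine ⟨x 1 + x 0 * (C 0 1 * C 2 2 - C 0 2 * C 1 2) / (C 1 1 * C 2 2 - C 1 2 ^ 2),
        x 2 + x 0 * (C 1 1 * C 0 2 - C 1 2 * C 0 1) / (C 1 1 * C 2 2 - C 1 2 ^ 2), ?_⟩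
      rw [qv_eq hC]
      field_simp
      linear_combination (-(x 0 ^ 2 * (C 1 1 * C 2 2 - C 1 2 ^ 2))) * hd
    · rintro ⟨y, z, rfl⟩
      refine ⟨![0, y, z], ?_⟩
      rw [qv_eq hC]
      simp
      ring
  by_cases ha : C 1 1 = 0
  · by_cases hb : C 2 2 = 0
    · have hc : C 1 2 ≠ 0 := by
        intro h; apply hi; rw [ha, h]; ring
      refine ⟨1, one_ne_zero, fun e => ?_⟩
      rw [red, ha, hb]
      refine ⟨fun _ => ⟨(e + 1) / 2, (e - 1) / (2 * C 1 2), ?_⟩,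
        fun _ => ⟨1, e / (2 * C 1 2), ?_⟩⟩
      · field_simp; ring
      · field_simp; ring
    · refine ⟨C 2 2, hb, fun e => ?_⟩
      rw [red]
      constructor
      · rintro ⟨y, z, rfl⟩
        exact ⟨C 2 2 * z + C 1 2 * y, y, by ring⟩
      · rintro ⟨Y, Z, h⟩
        refine ⟨Z, (Y - C 1 2 * Z) / C 2 2, ?_⟩
        apply mul_left_cancel₀ hb
        rw [h]; field_simp; ring
  · refine ⟨C 1 1, ha, fun e => ?_⟩
    rw [red]
    constructor
    · rintro ⟨y, z, rfl⟩
      exact ⟨C 1 1 * y + C 1 2 * z, z, by ring⟩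
    · rintro ⟨Y, Z, h⟩
      refine ⟨(Y - C 1 2 * Z) / C 1 1, Z, ?_⟩
      apply mul_left_cancel₀ ha
      rw [h]; field_simp; ring

end Conics

section Pencils

open Polynomial

variable {F : Type*} [Field F]

/-- The cubic polynomial `det (X·A − B)`. -/
noncomputable def detPoly (A B : Matrix (Fin 3) (Fin 3) F) : F[X] :=
  ((X : F[X]) • A.map C - B.map C).det

theorem detPoly_eval (A B : Matrix (Fin 3) (Fin 3) F) (t : F) :
    (detPoly A B).eval t = (t • A - B).det := by
  simp only [detPoly, det_fin_three, Matrix.sub_apply, Matrix.smul_apply, map_apply,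
    smul_eq_mul, eval_sub,
    eval_add, eval_mul, eval_X, eval_C]

theorem detPoly_map {E : Type*} [Field E] (f : F →+* E) (A B : Matrix (Fin 3) (Fin 3) F) :
    (detPoly A B).map f = detPoly (A.map f) (B.map f) := by
  simp [detPoly, det_fin_three]

theorem detPoly_eq (A B : Matrix (Fin 3) (Fin 3) F) :
    detPoly A B = C A.det * X ^ 3 + C (-(A.adjugate * B).trace) * X ^ 2
      + C (B.adjugate * A).trace * X + C (-B.det) := by
  simp only [detPoly, det_fin_three, adjugate_fin_three, trace_fin_three, mul_apply,
    Fin.sum_univ_three, Matrix.sub_apply, Matrix.smul_apply, map_apply,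
    smul_eq_mul, of_apply, cons_val_zero,
    cons_val_one, cons_val, C_add, C_sub, C_mul, C_neg, cons_val']
  ring

theorem natDegree_detPoly {A : Matrix (Fin 3) (Fin 3) F} (hA : A.det ≠ 0)
    (B : Matrix (Fin 3) (Fin 3) F) : (detPoly A B).natDegree = 3 := by
  rw [detPoly_eq]; exact natDegree_cubic hA

theorem leadingCoeff_detPoly {A : Matrix (Fin 3) (Fin 3) F} (hA : A.det ≠ 0)
    (B : Matrix (Fin 3) (Fin 3) F) : (detPoly A B).leadingCoeff = A.det := by
  rw [detPoly_eq]; exact leadingCoeff_cubic hA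

theorem derivative_detPoly_eval (A B : Matrix (Fin 3) (Fin 3) F) (t : F) :
    (derivative (detPoly A B)).eval t = ((t • A - B).adjugate * A).trace := by
  rw [detPoly_eq]
  simp only [derivative_add, derivative_mul, derivative_C, derivative_X_pow, eval_add, eval_mul,
    derivative_X, eval_C, eval_X, eval_pow, eval_zero, eval_one, zero_mul, zero_add, mul_one,
    add_zero, Nat.cast_ofNat, map_ofNat, eval_ofNat,
    det_fin_three, adjugate_fin_three, trace_fin_three, mul_apply,
    Fin.sum_univ_three, Matrix.sub_apply, Matrix.smul_apply, smul_eq_mul, of_apply, cons_val_zero,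
    cons_val_one, cons_val, cons_val']
  ring

theorem trace_ne_zero_of_separable {A B : Matrix (Fin 3) (Fin 3) F}
    (hs : (detPoly A B).Separable) {t : F} (ht : (t • A - B).det = 0) :
    ((t • A - B).adjugate * A).trace ≠ 0 := by
  rw [← derivative_detPoly_eval]
  rw [← detPoly_eval] at ht
  obtain ⟨a, b, h⟩ := hs
  intro h0
  have := congrArg (eval t) h
  simp [ht, h0] at this

theorem adjugate_ne_zero_of_separable {A B : Matrix (Fin 3) (Fin 3) F}
    (hs : (detPoly A B).Separable) (t : F) :
    (t • A - B).adjugate ≠ 0 := by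
  intro h
  by_cases ht : (t • A - B).det = 0
  · apply trace_ne_zero_of_separable hs ht; simp [h]
  · have := det_adjugate (t • A - B)
    rw [h] at this
    simp at this
    exact ht (by simpa using this.symm)

theorem exists_adjugate_diag_ne_zero {M : Matrix (Fin 3) (Fin 3) F} (hM : M.IsSymm)
    (hd : M.det = 0) (h : M.adjugate ≠ 0) : ∃ i, M.adjugate i i ≠ 0 := by
  by_contra! h0
  apply h
  ext j k
  have h1 := adjugate_mul_adjugate hd j j k k
  rw [h0, zero_mul, hM.adjugate.apply j k] at h1
  simpa using h1.symm

theorem adjugate_mul_of_mulVec_eq_zero {M : Matrix (Fin 3) (Fin 3) F} {x : Fin 3 → F}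
    (hx : M *ᵥ x = 0) (j k l : Fin 3) : M.adjugate j k * x l = M.adjugate l k * x j := by
  have h : ∀ i, M i 0 * x 0 + M i 1 * x 1 + M i 2 * x 2 = 0 := by
    intro i
    have := congrFun hx i
    simpa [mulVec, dotProduct, Fin.sum_univ_three] using this
  have h0 := h 0
  have h1 := h 1
  have h2 := h 2
  have key : ∀ a : Fin 3, M.adjugate (a + 1) k * x (a + 2) = M.adjugate (a + 2) k * x (a + 1) := by
    intro a
    rw [adjugate_fin_three]
    fin_cases a <;> fin_cases k <;> simp <;> grind
  have cases : ∀ a b : Fin 3, a = b ∨ ∃ c : Fin 3, (a = c + 1 ∧ b = c + 2) ∨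
      (a = c + 2 ∧ b = c + 1) := by decide
  rcases cases j l with rfl | ⟨c, ⟨rfl, rfl⟩ | ⟨rfl, rfl⟩⟩
  · rfl
  · exact key c
  · exact (key c).symm

theorem qv_ne_zero_of_kernel {A B : Matrix (Fin 3) (Fin 3) F} (hA : A.IsSymm) (hB : B.IsSymm)
    (hs : (detPoly A B).Separable) {t : F} {x : Fin 3 → F} (hx0 : x ≠ 0)
    (hx : (t • A - B) *ᵥ x = 0) : qv A x ≠ 0 := by
  intro hq
  set M := t • A - B with hM
  have hMs : M.IsSymm := (hA.smul t).sub hB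
  have hd : M.det = 0 := exists_mulVec_eq_zero_iff.1 ⟨x, hx0, hx⟩
  apply trace_ne_zero_of_separable hs hd
  rw [← hM]
  obtain ⟨l, hl⟩ := Function.ne_iff.1 hx0
  have hl : x l ≠ 0 := hl
  have key : ∀ j k, M.adjugate j k * x l ^ 2 = M.adjugate l l * (x j * x k) := by
    intro j k
    have h1 := adjugate_mul_of_mulVec_eq_zero hx j k l
    have h2 := adjugate_mul_of_mulVec_eq_zero hx k l l
    rw [hMs.adjugate.apply l k] at h2
    linear_combination x l * h1 + x j * h2
  have : (M.adjugate * A).trace * x l ^ 2 = M.adjugate l l * qv A x := by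
    have a1 := hA.apply 0 1
    have a2 := hA.apply 0 2
    have a3 := hA.apply 1 2
    rw [qv_eq hA]
    simp only [trace_fin_three, mul_apply, Fin.sum_univ_three, a1, a2, a3, add_mul]
    simp only [mul_right_comm _ _ (x l ^ 2), key]
    ring
  rw [hq, mul_zero] at this
  exact (mul_eq_zero.1 this).resolve_right (pow_ne_zero _ hl)

/-- If the pencil has a common zero, each of its members is universal. -/
theorem member_universal [CharZero F] {A B : Matrix (Fin 3) (Fin 3) F} (hA : A.IsSymm)
    (hB : B.IsSymm)
    (hs : (detPoly A B).Separable) {x₀ : Fin 3 → F} (hx0 : x₀ ≠ 0)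
    (hxA : qv A x₀ = 0) (hxB : qv B x₀ = 0) (t e : F) : ∃ x, qv (t • A - B) x = e := by
  refine universal_of_zero (x₀ := x₀) ((hA.smul t).sub hB) ?_ ?_ e
  · rw [qv_sub, qv_smul, hxA, hxB]; simp
  · intro h
    exact qv_ne_zero_of_kernel hA hB hs hx0 h hxA

end Pencils

section LocalForms

variable {p : ℕ} [Fact p.Prime]

theorem PadicInt.exists_sq_mul_add_eq_zero {u y t : ℤ_[p]} (hu : IsUnit u) (hy : IsUnit y)
    (h : ‖u * y ^ 2 + t‖ < ‖(2 : ℤ_[p])‖ ^ 2) : ∃ z, IsUnit z ∧ u * z ^ 2 + t = 0 := by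
  open Polynomial in
  have hun := PadicInt.isUnit_iff.1 hu
  have hyn := PadicInt.isUnit_iff.1 hy
  have e1 : ∀ a : ℤ_[p], aeval a (C u * X ^ 2 + C t : ℤ_[p][X]) = u * a ^ 2 + t := by
    intro a; simp
  have e2 : ∀ a : ℤ_[p], aeval a (derivative (C u * X ^ 2 + C t : ℤ_[p][X])) = 2 * u * a := by
    intro a; simp; ring
  have hlt : ‖aeval y (C u * X ^ 2 + C t : ℤ_[p][X])‖ <
      ‖aeval y (derivative (C u * X ^ 2 + C t : ℤ_[p][X]))‖ ^ 2 := by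
    rw [e1, e2, norm_mul, norm_mul, hun, hyn]; simpa using h
  obtain ⟨z, h1, -, h3, -⟩ := hensels_lemma hlt
  rw [e1] at h1
  rw [e2, e2, norm_mul, norm_mul, norm_mul, norm_mul, hun, hyn] at h3
  refine ⟨z, PadicInt.isUnit_iff.2 ?_, h1⟩
  have h2 : ‖(2 : ℤ_[p])‖ ≠ 0 := norm_ne_zero_iff.2 two_ne_zero
  simpa [h2] using h3

theorem PadicInt.toZMod_eq_zero_iff (x : ℤ_[p]) : PadicInt.toZMod x = 0 ↔ ‖x‖ < 1 := by
  rw [← RingHom.mem_ker, PadicInt.ker_toZMod, IsLocalRing.mem_maximalIdeal, PadicInt.mem_nonunits]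

theorem PadicInt.toZMod_ne_zero_iff (x : ℤ_[p]) : PadicInt.toZMod x ≠ 0 ↔ IsUnit x := by
  rw [Ne, PadicInt.toZMod_eq_zero_iff, PadicInt.isUnit_iff, not_lt]
  exact ⟨fun h => le_antisymm (PadicInt.norm_le_one x) h, fun h => h.ge⟩

theorem PadicInt.norm_two_of_ne (hp : p ≠ 2) : ‖(2 : ℤ_[p])‖ = 1 := by
  rw [← PadicInt.isUnit_iff, ← PadicInt.toZMod_ne_zero_iff, map_ofNat]
  intro h
  have h' : ((2 : ℕ) : ZMod p) = 0 := by exact_mod_cast h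
  rw [ZMod.natCast_eq_zero_iff] at h'
  exact hp ((Nat.prime_dvd_prime_iff_eq Fact.out Nat.prime_two).1 h')

theorem Padic.exists_eq_sq_mul {a : ℚ_[p]} (ha : a ≠ 0) :
    ∃ (c : ℚ_[p]) (u : ℤ_[p]) (s : Bool), c ≠ 0 ∧ IsUnit u ∧
      a = c ^ 2 * ((if s then (p : ℚ_[p]) else 1) * u) := by
  have hp0 : (p : ℚ_[p]) ≠ 0 := by exact_mod_cast (Fact.out : p.Prime).ne_zero
  set n := a.valuation with hn
  have hnorm : ‖a * (p : ℚ_[p]) ^ (-n)‖ = 1 := by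
    rw [norm_mul, Padic.norm_eq_zpow_neg_valuation ha, norm_zpow, Padic.norm_p, ← hn,
      _root_.inv_zpow, ← _root_.zpow_neg, neg_neg, ← zpow_add₀]
    · simp
    · exact_mod_cast (Fact.out : p.Prime).ne_zero
  obtain ⟨u, hu⟩ : ∃ u : ℤ_[p], (u : ℚ_[p]) = a * (p : ℚ_[p]) ^ (-n) := ⟨⟨_, hnorm.le⟩, rfl⟩
  have huu : IsUnit u := by
    rw [PadicInt.isUnit_iff, PadicInt.norm_def, hu, hnorm]
  rcases Int.even_or_odd' n with ⟨k, hk | hk⟩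
  · refine ⟨(p : ℚ_[p]) ^ k, u, false, zpow_ne_zero _ hp0, huu, ?_⟩
    simp only [Bool.false_eq_true, if_false, hu, hk, one_mul, _root_.zpow_neg, _root_.zpow_mul]
    rw [← zpow_natCast, ← _root_.zpow_mul, Nat.cast_ofNat, mul_comm k 2, _root_.zpow_mul]
    field_simp
  · refine ⟨(p : ℚ_[p]) ^ k, u, true, zpow_ne_zero _ hp0, huu, ?_⟩
    simp only [if_true, hu, hk, _root_.zpow_neg, zpow_add₀ hp0, zpow_one]
    rw [← zpow_natCast, ← _root_.zpow_mul, Nat.cast_ofNat, mul_comm k 2]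
    field_simp

theorem PadicInt.exists_zero_of_ne_two (hp : p ≠ 2) {u₀ u₁ u₂ : ℤ_[p]} (h₀ : IsUnit u₀)
    (h₁ : IsUnit u₁) (h₂ : IsUnit u₂) :
    ∃ x y z : ℤ_[p], z ≠ 0 ∧ u₀ * x ^ 2 + u₁ * y ^ 2 + u₂ * z ^ 2 = 0 := by
  open Polynomial in
  have hn := PadicInt.norm_two_of_ne hp
  set f : (ZMod p)[X] := C (toZMod u₀) * X ^ 2 + C 0 * X + C 0
  set g : (ZMod p)[X] := C (toZMod u₁) * X ^ 2 + C 0 * X + C (toZMod u₂)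
  have hodd : Fintype.card (ZMod p) % 2 = 1 := by
    rw [ZMod.card]; exact Nat.odd_iff.1 ((Fact.out : p.Prime).odd_of_ne_two hp)
  obtain ⟨a, b, hab⟩ := FiniteField.exists_root_sum_quadratic (f := f) (g := g)
    (degree_quadratic ((toZMod_ne_zero_iff _).2 h₀))
    (degree_quadratic ((toZMod_ne_zero_iff _).2 h₁)) hodd
  obtain ⟨x, rfl⟩ := ZMod.ringHom_surjective toZMod a
  obtain ⟨y, rfl⟩ := ZMod.ringHom_surjective toZMod b
  have hab' : toZMod (u₀ * x ^ 2 + u₁ * y ^ 2 + u₂) = 0 := by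
    simp only [f, g, eval_add, eval_mul, eval_C, eval_pow, eval_X] at hab
    simp only [map_add, map_mul, map_pow]
    linear_combination hab
  have key := (toZMod_eq_zero_iff _).1 hab'
  by_cases hx : IsUnit x
  · obtain ⟨z, hz, h⟩ := exists_sq_mul_add_eq_zero (u := u₀) (y := x) (t := u₁ * y ^ 2 + u₂) h₀ hx
      (by rw [hn, one_pow, ← add_assoc]; exact key)
    exact ⟨z, y, 1, one_ne_zero, by linear_combination h⟩
  · by_cases hy : IsUnit y
    · obtain ⟨z, hz, h⟩ := exists_sq_mul_add_eq_zero (u := u₁) (y := y) (t := u₀ * x ^ 2 + u₂) h₁ hy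
        (by rw [hn, one_pow]; convert key using 2; ring)
      exact ⟨x, z, 1, one_ne_zero, by linear_combination h⟩
    · exfalso
      rw [← toZMod_ne_zero_iff, not_not] at hx hy
      rw [← toZMod_ne_zero_iff] at h₂
      simp [hx, hy] at hab'
      exact h₂ hab'

theorem exists_zero_mod_eight : ∀ b₀ : ZMod 8, b₀ * b₀ = 1 → ∀ b₁ : ZMod 8, b₁ * b₁ = 1 →
    ∀ b₂ : ZMod 8, b₂ * b₂ = 1 → ∀ b₃ : ZMod 8, b₃ ≠ 0 ∧ b₃ ≠ 4 → ∀ b₄ : ZMod 8,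
    b₄ ≠ 0 ∧ b₄ ≠ 4 → ∃ y₁ y₂ y₃ y₄ : Fin 3, 
    b₀ + b₁ * (y₁.1 * y₁.1) + b₂ * (y₂.1 * y₂.1) + b₃ * (y₃.1 * y₃.1) +
      b₄ * (y₄.1 * y₄.1) = 0 := by
  decide +kernel

theorem norm_form_mod_eight : ∀ d : ZMod 8, d ≠ 0 → d ≠ 1 → d ≠ 4 →
    ∃ h : Fin 8, h ≠ 0 ∧ ∀ x y z : ZMod 8, (h.1 : ZMod 8) * x ^ 2 = y ^ 2 - d * z ^ 2 →
      x ^ 2 ≠ 1 ∧ y ^ 2 ≠ 1 ∧ z ^ 2 ≠ 1 := by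
  decide +kernel

theorem PadicInt.isUnit_iff_mod_eight (u : ℤ_[2]) :
    IsUnit u ↔ (PadicInt.toZModPow 3 u : ZMod 8) ^ 2 = 1 := by
  have key : ∀ a : ZMod 8, a ^ 2 = 1 ∨ a ^ 3 = 0 := by decide
  have key2 : ∀ a : ZMod 8, IsUnit a → a ^ 2 = 1 := by decide
  refine ⟨fun h => key2 _ (h.map (PadicInt.toZModPow 3)), fun h => ?_⟩
  by_contra hu
  have h1 : ‖u‖ < 1 := PadicInt.mem_nonunits.1 hu
  obtain ⟨v, rfl⟩ := (PadicInt.norm_lt_one_iff_dvd u).1 h1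
  rw [map_mul] at h
  have key3 : ∀ a : ZMod 8, (2 * a) ^ 2 ≠ 1 := by decide
  apply key3 (PadicInt.toZModPow 3 v)
  rw [← h]
  have : (PadicInt.toZModPow 3 ((2 : ℕ) : ℤ_[2]) : ZMod (2 ^ 3)) = (2 : ℕ) := map_natCast _ _
  rw [this]; rfl

theorem PadicInt.norm_lt_of_mod_eight {x : ℤ_[2]}
    (h : (PadicInt.toZModPow 3 x : ZMod (2 ^ 3)) = 0) : ‖x‖ < ‖(2 : ℤ_[2])‖ ^ 2 := by
  rw [← RingHom.mem_ker, PadicInt.ker_toZModPow, ← PadicInt.norm_le_pow_iff_mem_span_pow] at h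
  have h2 : ‖(2 : ℤ_[2])‖ = 2⁻¹ := by
    have := PadicInt.norm_p (p := 2)
    simpa using this
  rw [h2]
  refine h.trans_lt ?_
  norm_num

theorem PadicInt.exists_zero_of_eq_two (u : Fin 5 → ℤ_[2]) (hu : ∀ i, IsUnit (u i))
    (s : Fin 5 → Bool) (h0 : s 0 = false) (h1 : s 1 = false) (h2 : s 2 = false) :
    ∃ y : Fin 5 → ℤ_[2], y ≠ 0 ∧
      ∑ i, (if s i then ((2 : ℕ) : ℤ_[2]) else 1) * u i * y i ^ 2 = 0 := by
  set φ : ℤ_[2] →+* ZMod 8 := PadicInt.toZModPow 3 with hφ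
  have hun : ∀ i, φ (u i) * φ (u i) = 1 := fun i => by
    rw [← pow_two]; exact (isUnit_iff_mod_eight _).1 (hu i)
  have hb : ∀ i, φ ((if s i then ((2 : ℕ) : ℤ_[2]) else 1) * u i) ≠ 0 ∧
      φ ((if s i then ((2 : ℕ) : ℤ_[2]) else 1) * u i) ≠ 4 := by
    intro i
    have aux : ∀ a : ZMod 8, a * a = 1 → (a ≠ 0 ∧ a ≠ 4) ∧ (2 * a ≠ 0 ∧ 2 * a ≠ 4) := by decide
    have := aux _ (hun i)
    cases hs : s i
    · simpa using this.1
    · have h2 : φ 2 = 2 := map_ofNat φ 2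
      simpa [map_mul, h2] using this.2
  obtain ⟨y₁, y₂, y₃, y₄, hy⟩ :=
    exists_zero_mod_eight _ (hun 0) _ (hun 1) _ (hun 2) _ (hb 3) _ (hb 4)
  obtain ⟨z, hz, h⟩ := exists_sq_mul_add_eq_zero (u := u 0) (y := 1)
    (t := u 1 * (y₁.1 : ℤ_[2]) ^ 2 + u 2 * (y₂.1 : ℤ_[2]) ^ 2
      + (if s 3 then ((2 : ℕ) : ℤ_[2]) else 1) * u 3 * (y₃.1 : ℤ_[2]) ^ 2
      + (if s 4 then ((2 : ℕ) : ℤ_[2]) else 1) * u 4 * (y₄.1 : ℤ_[2]) ^ 2) (hu 0) isUnit_one (by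
        apply norm_lt_of_mod_eight
        change φ _ = 0
        rw [← hy]
        simp only [map_add, map_mul, map_pow, map_natCast, map_one]
        ring)
  refine ⟨![z, y₁.1, y₂.1, y₃.1, y₄.1], fun h' => ?_, ?_⟩
  · have := congrFun h' 0
    simp at this
    exact hz.ne_zero this
  · simp only [Fin.sum_univ_five, h0, h1, h2]
    simp
    simp at h
    linear_combination h

theorem exists_perm_const : ∀ t : Fin 5 → Bool, ∃ (σ : Equiv.Perm (Fin 5)) (s : Bool),
    t (σ 0) = s ∧ t (σ 1) = s ∧ t (σ 2) = s := by
  decide +kernel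

theorem PadicInt.exists_zero_five (u : Fin 5 → ℤ_[p]) (hu : ∀ i, IsUnit (u i))
    (s : Fin 5 → Bool) (h0 : s 0 = false) (h1 : s 1 = false) (h2 : s 2 = false) :
    ∃ y : Fin 5 → ℤ_[p], y ≠ 0 ∧
      ∑ i, (if s i then (p : ℤ_[p]) else 1) * u i * y i ^ 2 = 0 := by
  by_cases hp : p = 2
  · subst hp
    exact exists_zero_of_eq_two u hu s h0 h1 h2
  · obtain ⟨x, y, z, hz, h⟩ := exists_zero_of_ne_two hp (hu 0) (hu 1) (hu 2)
    refine ⟨![x, y, z, 0, 0], fun h' => hz (by simpa using congrFun h' 2), ?_⟩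
    simp only [Fin.sum_univ_five, h0, h1, h2]
    simpa using h

/-- Diagonal quadratic forms in five variables over `ℚ_p` are isotropic. -/
theorem Padic.exists_zero_five (a : Fin 5 → ℚ_[p]) :
    ∃ x : Fin 5 → ℚ_[p], x ≠ 0 ∧ ∑ i, a i * x i ^ 2 = 0 := by
  by_cases ha : ∃ i, a i = 0
  · obtain ⟨i, hi⟩ := ha
    refine ⟨Pi.single i 1, fun h => by simpa using congrFun h i, ?_⟩
    refine Finset.sum_eq_zero fun j _ => ?_
    by_cases hj : j = i
    · subst hj; simp [hi]
    · simp [hj]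
  push Not at ha
  have hp0 : (p : ℚ_[p]) ≠ 0 := by exact_mod_cast (Fact.out : p.Prime).ne_zero
  choose c u s hc hu hcu using fun i => Padic.exists_eq_sq_mul (ha i)
  obtain ⟨σ, b, h0, h1, h2⟩ := exists_perm_const s
  -- after dividing by `p` if necessary, three coefficients become units
  obtain ⟨y, hy0, hy⟩ := PadicInt.exists_zero_five (fun i => u (σ i)) (fun i => hu _)
    (fun i => xor b (s (σ i))) (by simp [h0]) (by simp [h1]) (by simp [h2])
  have hy' : ∑ i, (if xor b (s (σ i)) then (p : ℚ_[p]) else 1) * u (σ i) * (y i : ℚ_[p]) ^ 2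
      = 0 := by
    have := congrArg (fun z : ℤ_[p] => (z : ℚ_[p])) hy
    simp only [PadicInt.coe_sum, PadicInt.coe_mul, PadicInt.coe_pow, PadicInt.coe_zero] at this
    rw [← this]
    refine Finset.sum_congr rfl fun i _ => ?_
    split_ifs <;> simp
  -- the scaling of each variable
  set e : Fin 5 → ℚ_[p] := fun i =>
    (if b && s i then 1 else if b then (p : ℚ_[p]) else 1) / (p * c i) with he
  have he0 : ∀ i, e i ≠ 0 := by
    intro i
    simp only [he]
    apply div_ne_zero _ (mul_ne_zero hp0 (hc i))
    split_ifs <;> simp [hp0]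
  refine ⟨fun i => e i * y (σ.symm i), fun h => hy0 ?_, ?_⟩
  · funext i
    have := congrFun h (σ i)
    simpa [he0] using this
  · rw [← Equiv.sum_comp σ]
    simp only [Equiv.symm_apply_apply]
    cases b
    · rw [← mul_zero ((p : ℚ_[p])⁻¹ ^ 2), ← hy', Finset.mul_sum]
      refine Finset.sum_congr rfl fun i _ => ?_
      rw [hcu (σ i)]
      have := hc (σ i)
      cases hs : s (σ i) <;> simp [he, hs] <;> field_simp
    · rw [← mul_zero ((p : ℚ_[p])⁻¹), ← hy', Finset.mul_sum]
      refine Finset.sum_congr rfl fun i _ => ?_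
      rw [hcu (σ i)]
      have := hc (σ i)
      cases hs : s (σ i) <;> simp [he, hs] <;> field_simp

theorem PadicInt.isSquare_of_toZMod (hp : p ≠ 2) {u : ℤ_[p]} (hu : IsUnit u)
    (h : IsSquare (PadicInt.toZMod u)) : IsSquare u := by
  obtain ⟨a, ha⟩ := h
  obtain ⟨y, rfl⟩ := ZMod.ringHom_surjective PadicInt.toZMod a
  have hy : IsUnit y := by
    rw [← toZMod_ne_zero_iff] at hu ⊢
    intro h0; apply hu; rw [ha, h0, mul_zero]
  obtain ⟨z, -, hz⟩ := exists_sq_mul_add_eq_zero (u := 1) (t := -u) isUnit_one hy (by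
    rw [norm_two_of_ne hp, one_pow, ← toZMod_eq_zero_iff]
    simp [ha]; ring)
  exact ⟨z, by linear_combination -hz⟩

theorem PadicInt.isSquare_of_mod_eight {u : ℤ_[2]}
    (h : (PadicInt.toZModPow 3 u : ZMod (2 ^ 3)) = 1) : IsSquare u := by
  obtain ⟨z, -, hz⟩ := exists_sq_mul_add_eq_zero (u := 1) (y := 1) (t := -u) isUnit_one isUnit_one
    (norm_lt_of_mod_eight (by simp [h]))
  exact ⟨z, by linear_combination -hz⟩

/-- Rescale a nontrivial solution of a homogeneous equation to a primitive integral one. -/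
theorem Padic.exists_primitive {h d x y z : ℚ_[p]} (h1 : h * x ^ 2 = y ^ 2 - d * z ^ 2)
    (hx : x ≠ 0) : ∃ X Y Z : ℤ_[p], (IsUnit X ∨ IsUnit Y ∨ IsUnit Z) ∧
      h * (X : ℚ_[p]) ^ 2 = (Y : ℚ_[p]) ^ 2 - d * (Z : ℚ_[p]) ^ 2 := by
  set v : Fin 3 → ℚ_[p] := ![x, y, z] with hv
  obtain ⟨i, hi⟩ := Finite.exists_max (fun i => ‖v i‖)
  have hi0 : v i ≠ 0 := by
    intro h0
    have := hi 0
    rw [h0, norm_zero] at this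
    exact hx (norm_le_zero_iff.1 this)
  have hle : ∀ j, ‖v j / v i‖ ≤ 1 := by
    intro j
    rw [norm_div]
    exact div_le_one_of_le₀ (hi j) (norm_nonneg _)
  have hex : ∀ j, ∃ w : ℤ_[p], (w : ℚ_[p]) = v j / v i := fun j => ⟨⟨_, hle j⟩, rfl⟩
  choose w hw using hex
  have hwi : IsUnit (w i) := by
    rw [PadicInt.isUnit_iff, PadicInt.norm_def, hw, div_self hi0, norm_one]
  refine ⟨w 0, w 1, w 2, ?_, ?_⟩
  · have cases : i = 0 ∨ i = 1 ∨ i = 2 := by clear * -; revert i; decide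
    rcases cases with h | h | h <;> rw [h] at hwi <;> simp [hwi]
  · simp only [hw, div_pow]
    have e0 : v 0 = x := rfl
    have e1 : v 1 = y := rfl
    have e2 : v 2 = z := rfl
    rw [e0, e1, e2]
    field_simp
    exact h1

theorem PadicInt.exists_not_norm (u : ℤ_[p]) (hu : IsUnit u) (s : Bool)
    (hs : ¬IsSquare ((if s then (p : ℤ_[p]) else 1) * u)) :
    ∃ h : ℤ_[p], h ≠ 0 ∧ ∀ x y z : ℤ_[p], (IsUnit x ∨ IsUnit y ∨ IsUnit z) →
      h * x ^ 2 ≠ y ^ 2 - (if s then (p : ℤ_[p]) else 1) * u * z ^ 2 := by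
  have hpp : Prime (p : ℤ_[p]) := PadicInt.prime_p
  have hnu : ∀ x : ℤ_[p], IsUnit x ↔ ¬ (p : ℤ_[p]) ∣ x := fun x => by
    rw [← PadicInt.norm_lt_one_iff_dvd, ← PadicInt.mem_nonunits, mem_nonunits_iff, not_not]
  have hdv : ∀ x : ℤ_[p], (p : ℤ_[p]) ∣ x ↔ toZMod x = 0 := fun x => by
    rw [← PadicInt.norm_lt_one_iff_dvd, toZMod_eq_zero_iff]
  by_cases hp : p = 2
  · subst hp
    set φ : ℤ_[2] →+* ZMod 8 := PadicInt.toZModPow 3 with hφ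
    set d : ℤ_[2] := (if s then ((2 : ℕ) : ℤ_[2]) else 1) * u with hd
    have hu8 : φ u ^ 2 = 1 := (isUnit_iff_mod_eight _).1 hu
    have aux : ∀ a : ZMod 8, a ^ 2 = 1 → (a ≠ 0 ∧ a ≠ 4) ∧ (2 * a ≠ 0 ∧ 2 * a ≠ 4 ∧ 2 * a ≠ 1) := by
      decide
    have h2 : φ 2 = 2 := map_ofNat φ 2
    have hd1 : φ d ≠ 0 ∧ φ d ≠ 4 ∧ φ d ≠ 1 := by
      have := aux _ hu8
      cases hs' : s
      · refine ⟨by simpa [hd, hs'] using this.1.1, by simpa [hd, hs'] using this.1.2, fun h => ?_⟩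
        rw [hd, hs'] at h hs
        exact hs (isSquare_of_mod_eight h)
      · simpa [hd, hs', h2] using this.2
    obtain ⟨h, hh0, hh⟩ := norm_form_mod_eight (φ d) hd1.1 hd1.2.2 hd1.2.1
    refine ⟨(h.1 : ℤ_[2]), ?_, fun x y z hxyz heq => ?_⟩
    · rw [Ne, Nat.cast_eq_zero]; intro h'; exact hh0 (Fin.ext h')
    · have := congrArg φ heq
      simp only [map_mul, map_pow, map_sub, map_natCast] at this
      obtain ⟨q1, q2, q3⟩ := hh _ _ _ (by simpa only [hφ, map_mul] using this)
      rw [isUnit_iff_mod_eight, isUnit_iff_mod_eight, isUnit_iff_mod_eight] at hxyz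
      rcases hxyz with h | h | h
      · exact q1 h
      · exact q2 h
      · exact q3 h
  · cases s
    · simp only [Bool.false_eq_true, if_false, one_mul] at hs ⊢
      refine ⟨p, hpp.ne_zero, fun x y z hxyz heq => ?_⟩
      have h1 : toZMod y ^ 2 = toZMod u * toZMod z ^ 2 := by
        have := congrArg toZMod heq
        simp only [map_mul, map_pow, map_sub, map_natCast, CharP.cast_eq_zero, zero_mul] at this
        linear_combination -this
      have hz : toZMod z = 0 := by
        by_contra hz
        exact hs (isSquare_of_toZMod hp hu ⟨toZMod y / toZMod z, by field_simp; exact h1.symm⟩)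
      have hy : toZMod y = 0 := by
        rw [hz] at h1; simpa using h1
      have hx : (p : ℤ_[p]) ∣ x := by
        obtain ⟨y', rfl⟩ := (hdv _).2 hy
        obtain ⟨z', rfl⟩ := (hdv _).2 hz
        refine hpp.dvd_of_dvd_pow (n := 2) ⟨y' ^ 2 - u * z' ^ 2, mul_left_cancel₀ hpp.ne_zero ?_⟩
        linear_combination heq
      rw [hnu, hnu, hnu, hdv y, hdv z] at hxyz
      tauto
    · simp only [if_true] at hs ⊢
      have hrc : ringChar (ZMod p) ≠ 2 := by rwa [ZMod.ringChar_zmod_n]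
      obtain ⟨a, ha⟩ := FiniteField.exists_nonsquare (F := ZMod p) hrc
      obtain ⟨h, rfl⟩ := ZMod.ringHom_surjective toZMod a
      refine ⟨h, fun h0 => ha (by simp [h0]), fun x y z hxyz heq => ?_⟩
      have h1 : toZMod h * toZMod x ^ 2 = toZMod y ^ 2 := by
        have := congrArg toZMod heq
        simp only [map_mul, map_pow, map_sub, map_natCast, CharP.cast_eq_zero, zero_mul] at this
        linear_combination this
      have hx : toZMod x = 0 := by
        by_contra hx
        exact ha ⟨toZMod y / toZMod x, by field_simp; exact h1⟩
      have hy : toZMod y = 0 := by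
        rw [hx] at h1; simpa using h1.symm
      have hz : (p : ℤ_[p]) ∣ z := by
        obtain ⟨x', rfl⟩ := (hdv _).2 hx
        obtain ⟨y', rfl⟩ := (hdv _).2 hy
        have : (p : ℤ_[p]) ∣ u * z ^ 2 :=
          ⟨y' ^ 2 - h * x' ^ 2, mul_left_cancel₀ hpp.ne_zero (by linear_combination heq)⟩
        rcases hpp.dvd_or_dvd this with h' | h'
        · exact absurd h' ((hnu u).1 hu)
        · exact hpp.dvd_of_dvd_pow h'
      rw [hnu, hnu, hnu, hdv x, hdv y] at hxyz
      tauto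

/-- The norm form of a quadratic extension of `ℚ_p` is not universal. -/
theorem Padic.exists_not_norm {d : ℚ_[p]} (hd0 : d ≠ 0) (hd : ¬IsSquare d) :
    ∃ h : ℚ_[p], h ≠ 0 ∧ ∀ y z, h ≠ y ^ 2 - d * z ^ 2 := by
  obtain ⟨c, u, s, hc, hu, hcu⟩ := Padic.exists_eq_sq_mul hd0
  have hcast : (((if s then (p : ℤ_[p]) else 1) * u : ℤ_[p]) : ℚ_[p])
      = (if s then (p : ℚ_[p]) else 1) * u := by
    split_ifs <;> simp
  obtain ⟨h, hh0, hh⟩ := PadicInt.exists_not_norm u hu s (by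
    rintro ⟨r, hr⟩
    refine hd ⟨c * r, ?_⟩
    rw [hcu, ← hcast, hr, PadicInt.coe_mul]; ring)
  refine ⟨h, fun h0 => hh0 (Subtype.ext h0), fun y z hyz => ?_⟩
  obtain ⟨X, Y, Z, hu', he⟩ := Padic.exists_primitive (h := (h : ℚ_[p]))
    (d := (if s then (p : ℚ_[p]) else 1) * u) (x := 1) (y := y) (z := c * z)
    (by rw [hyz, hcu]; ring) one_ne_zero
  apply hh X Y Z hu'
  rw [← hcast] at he
  apply Subtype.ext
  simp only [PadicInt.coe_mul, PadicInt.coe_sub, PadicInt.coe_pow] at he ⊢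
  exact he

theorem Padic.eventually_isSquare : ∀ᶠ u : ℚ_[p] in nhds 1, ∃ r, r ≠ 0 ∧ u = r ^ 2 := by
  have h2 : 0 < ‖(2 : ℚ_[p])‖ ^ 2 := by
    have : ‖(2 : ℚ_[p])‖ ≠ 0 := norm_ne_zero_iff.2 two_ne_zero
    positivity
  have h2' : ‖(2 : ℚ_[p])‖ ≤ 1 := by exact_mod_cast PadicInt.norm_le_one (2 : ℤ_[p])
  filter_upwards [Metric.ball_mem_nhds (1 : ℚ_[p]) h2] with u hu
  rw [Metric.mem_ball, dist_eq_norm] at hu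
  have hu1 : ‖u - 1‖ < 1 := hu.trans_le (pow_le_one₀ (norm_nonneg _) h2')
  have hun : ‖u‖ ≤ 1 := by
    have : u = (u - 1) + 1 := by ring
    rw [this]
    refine (Padic.nonarchimedean _ _).trans ?_
    simp [hu1.le]
  obtain ⟨v, rfl⟩ : ∃ v : ℤ_[p], (v : ℚ_[p]) = u := ⟨⟨u, hun⟩, rfl⟩
  obtain ⟨z, hz, h⟩ := PadicInt.exists_sq_mul_add_eq_zero (p := p) (u := 1) (y := 1) (t := -v)
    isUnit_one isUnit_one (by
      have : (1 * 1 ^ 2 + -v : ℤ_[p]) = -(v - 1) := by ring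
      rw [this, norm_neg]
      exact_mod_cast hu)
  refine ⟨z, fun h0 => hz.ne_zero (Subtype.ext h0), ?_⟩
  have : v = z ^ 2 := by linear_combination -h
  rw [this, PadicInt.coe_pow]

end LocalForms

section Members

variable {p : ℕ} [Fact p.Prime]

theorem continuous_qv (C : Matrix (Fin 3) (Fin 3) ℚ_[p]) : Continuous (qv C) := by
  unfold qv dotProduct mulVec dotProduct
  fun_prop

theorem qv_map {E F : Type*} [Field E] [Field F] (f : E →+* F) (C : Matrix (Fin 3) (Fin 3) E)
    (x : Fin 3 → E) : qv (C.map f) (fun i => f (x i)) = f (qv C x) := by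
  simp [qv, dotProduct, mulVec, Fin.sum_univ_three]

/-- Equality of rational representations passes to the nonzero values of each `p`-adic member. -/
theorem exists_value_of_rational {A₁ B₁ A₂ B₂ : Matrix (Fin 3) (Fin 3) ℚ}
    (h : ∀ x, x ≠ 0 → ∃ y, qv A₁ x = qv A₂ y ∧ qv B₁ x = qv B₂ y) (a b : ℚ_[p]) {e : ℚ_[p]}
    (he : e ≠ 0)
    (hx : ∃ x, qv (a • A₁.map (algebraMap ℚ ℚ_[p]) - b • B₁.map (algebraMap ℚ ℚ_[p])) x = e) :
    ∃ x, qv (a • A₂.map (algebraMap ℚ ℚ_[p]) - b • B₂.map (algebraMap ℚ ℚ_[p])) x = e := by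
  obtain ⟨x, hx⟩ := hx
  set C := a • A₁.map (algebraMap ℚ ℚ_[p]) - b • B₁.map (algebraMap ℚ ℚ_[p]) with hC
  have hcont : Filter.Tendsto (fun x => qv C x / e) (nhds x) (nhds 1) := by
    have : Continuous fun x => qv C x / e := (continuous_qv C).div_const e
    convert this.tendsto x using 2
    rw [hx, div_self he]
  have hdense : DenseRange (Pi.map (fun (_ : Fin 3) (q : ℚ) => (q : ℚ_[p]))) :=
    DenseRange.piMap fun _ => Padic.denseRange_ratCast p
  obtain ⟨_, ⟨x', rfl⟩, r, hr0, hr⟩ :=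
    (hdense.inter_nhds_nonempty (hcont Padic.eventually_isSquare))
  have hx'0 : x' ≠ 0 := by
    rintro rfl
    have : (Pi.map (fun (_ : Fin 3) (q : ℚ) => (q : ℚ_[p])) 0) = 0 := by ext i; simp
    simp only [this, qv_zero_vec, zero_div] at hr
    exact hr0 (by simpa using hr.symm)
  obtain ⟨y, hyA, hyB⟩ := h x' hx'0
  refine ⟨r⁻¹ • fun i => (algebraMap ℚ ℚ_[p]) (y i), ?_⟩
  have hval : qv C (fun i => (algebraMap ℚ ℚ_[p]) (x' i)) = r ^ 2 * e := by
    rw [← hr]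
    exact (div_mul_cancel₀ _ he).symm
  rw [hC] at hval
  rw [qv_sub, qv_smul, qv_smul, qv_map, qv_map, hyA, hyB] at hval
  rw [qv_smul_vec, qv_sub, qv_smul, qv_smul, qv_map, qv_map, hval]
  field_simp

theorem exists_diagonalization {F : Type*} [Field F] [CharZero F]
    (C : Matrix (Fin 3) (Fin 3) F) :
    ∃ (w : Fin 3 → F) (P : (Fin 3 → F) ≃ₗ[F] (Fin 3 → F)), ∀ x,
      qv C (P x) = ∑ i, w i * x i ^ 2 := by
  have : Invertible (2 : F) := invertibleOfNonzero two_ne_zero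
  obtain ⟨w, ⟨e⟩⟩ := QuadraticForm.equivalent_weightedSumSquares (C.toQuadraticForm')
  have hfin : Module.finrank F (Fin 3 → F) = 3 := by simp
  revert w
  rw [hfin]
  intro w e
  refine ⟨w, e.symm.toLinearEquiv, fun x => ?_⟩
  have h1 := e.symm.map_app x
  rw [QuadraticMap.weightedSumSquares_apply] at h1
  have h2 : C.toQuadraticForm' (e.symm x) = qv C (e.symm x) := by
    simp [Matrix.toQuadraticForm', qv, Matrix.toLinearMap₂'_apply']
  rw [h2] at h1
  simpa [pow_two] using h1

/-- A nondegenerate-enough member forces isotropy of any form with the same nonzero values. -/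
theorem isotropic_of_same_values {C₁ C₂ : Matrix (Fin 3) (Fin 3) ℚ_[p]}
    (h₁ : C₁.IsSymm) (h₂ : C₂.IsSymm) (hadj : C₁.adjugate ≠ 0)
    (hv : ∀ e, e ≠ 0 → ((∃ x, qv C₁ x = e) ↔ ∃ x, qv C₂ x = e))
    (hiso : ∃ x, x ≠ 0 ∧ qv C₁ x = 0) : ∃ x, x ≠ 0 ∧ qv C₂ x = 0 := by
  by_cases hd₂ : C₂.det = 0
  · obtain ⟨x, hx0, hx⟩ := exists_mulVec_eq_zero_iff.2 hd₂
    exact ⟨x, hx0, by simp [qv, hx]⟩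
  have huniv : (∀ e, e ≠ 0 → ∃ x, qv C₁ x = e) → ∃ x, x ≠ 0 ∧ qv C₂ x = 0 := by
    intro hu
    obtain ⟨x, hx⟩ := (hv (-C₂.det) (neg_ne_zero.2 hd₂)).1 (hu _ (neg_ne_zero.2 hd₂))
    exact isotropic_of_represents_neg_det h₂ hd₂ hx
  by_cases hd₁ : C₁.det = 0
  · obtain ⟨i, hi⟩ := exists_adjugate_diag_ne_zero h₁ hd₁ hadj
    obtain ⟨a, ha, hae⟩ := exists_norm_form h₁ hd₁ hi
    set d := -C₁.adjugate i i with hd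
    have hd0 : d ≠ 0 := neg_ne_zero.2 hi
    by_cases hsq : IsSquare d
    · obtain ⟨s, hs⟩ := hsq
      have hs0 : s ≠ 0 := by rintro rfl; exact hd0 (by simpa using hs)
      refine huniv fun e _ => (hae e).2 ⟨(a * e + 1) / 2, (a * e - 1) / (2 * s), ?_⟩
      rw [hs]; field_simp; ring
    · obtain ⟨h, hh0, hh⟩ := Padic.exists_not_norm hd0 hsq
      obtain ⟨w, P, hP⟩ := exists_diagonalization C₂
      obtain ⟨x, hx0, hx⟩ := Padic.exists_zero_five
        ![1, -d, -(h * a * w 0), -(h * a * w 1), -(h * a * w 2)]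
      set y : Fin 3 → ℚ_[p] := ![x 2, x 3, x 4] with hy
      have hPy := hP y
      have hrel : x 0 ^ 2 - d * x 1 ^ 2 = h * (a * qv C₂ (P y)) := by
        rw [hPy]
        simp [Fin.sum_univ_five] at hx
        simp [Fin.sum_univ_three, hy]
        linear_combination hx
      by_cases hy0 : y = 0
      · exfalso
        rw [hy0, map_zero, qv_zero_vec, mul_zero, mul_zero] at hrel
        have hx1 : x 1 = 0 := by
          by_contra hx1
          exact hsq ⟨x 0 / x 1, by field_simp; linear_combination -hrel⟩
        have hx0' : x 0 = 0 := by
          rw [hx1] at hrel; simpa using hrel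
        apply hx0
        have e2 : x 2 = 0 := congrFun hy0 0
        have e3 : x 3 = 0 := congrFun hy0 1
        have e4 : x 4 = 0 := congrFun hy0 2
        ext i; fin_cases i <;> assumption
      · have hPy0 : P y ≠ 0 := by simpa using hy0
        by_cases hq : qv C₂ (P y) = 0
        · exact ⟨_, hPy0, hq⟩
        · exfalso
          obtain ⟨Y, Z, hYZ⟩ := (hae _).1 ((hv _ hq).2 ⟨_, rfl⟩)
          rw [hYZ] at hrel
          have hne : Y ^ 2 - d * Z ^ 2 ≠ 0 := by
            rw [← hYZ]; exact mul_ne_zero ha hq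
          refine hh ((x 0 * Y + d * x 1 * Z) / (Y ^ 2 - d * Z ^ 2))
            ((x 0 * Z + x 1 * Y) / (Y ^ 2 - d * Z ^ 2)) ?_
          field_simp
          linear_combination -(Y ^ 2 - d * Z ^ 2) * hrel
  · obtain ⟨x, hx0, hx⟩ := hiso
    refine huniv fun e _ => universal_of_zero h₁ hx (fun h0 => hd₁ ?_) e
    exact exists_mulVec_eq_zero_iff.1 ⟨x, hx0, h0⟩

theorem isSquare_of_universal {C : Matrix (Fin 3) (Fin 3) ℚ_[p]} (hC : C.IsSymm)
    (hd : C.det = 0) {i : Fin 3} (hi : C.adjugate i i ≠ 0)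
    (hu : ∀ e, e ≠ 0 → ∃ x, qv C x = e) : IsSquare (-C.adjugate i i) := by
  by_contra hsq
  obtain ⟨h, hh0, hh⟩ := Padic.exists_not_norm (neg_ne_zero.2 hi) hsq
  obtain ⟨a, ha, hae⟩ := exists_norm_form hC hd hi
  obtain ⟨Y, Z, hYZ⟩ := (hae (h / a)).1 (hu _ (div_ne_zero hh0 ha))
  rw [mul_div_cancel₀ _ ha] at hYZ
  exact hh _ _ hYZ

end Members

section CommonZero

open Polynomial

variable {F : Type*} [Field F]

theorem trace_at_root {A B : Matrix (Fin 3) (Fin 3) F} {a : F} {r : Fin 3 → F}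
    (hD : detPoly A B = Polynomial.C a * ((X - C (r 0)) * (X - C (r 1)) * (X - C (r 2)))) :
    ((r 0 • A - B).adjugate * A).trace = a * ((r 0 - r 1) * (r 0 - r 2)) ∧
    ((r 1 • A - B).adjugate * A).trace = a * ((r 1 - r 0) * (r 1 - r 2)) ∧
    ((r 2 • A - B).adjugate * A).trace = a * ((r 2 - r 0) * (r 2 - r 1)) := by
  simp only [← derivative_detPoly_eval, hD]
  refine ⟨?_, ?_, ?_⟩ <;> simp

theorem mulVec_eq_zero_of_rank_one {M : Matrix (Fin 3) (Fin 3) F} (hd : M.det = 0)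
    (hM : M.adjugate ≠ 0) {w : Fin 3 → F}
    (hw : ∀ j k, -M.adjugate j k = w j * w k) : M *ᵥ w = 0 := by
  obtain ⟨k, hk⟩ : ∃ k, w k ≠ 0 := by
    by_contra! h
    apply hM
    ext i j
    have := hw i j
    rw [h, zero_mul, neg_eq_zero] at this
    exact this
  ext m
  have h1 := congrFun (congrFun (mul_adjugate M) m) k
  rw [hd, zero_smul, mul_apply] at h1
  apply mul_right_cancel₀ hk
  rw [mulVec, dotProduct, Finset.sum_mul]
  simp only [mul_assoc, ← hw]
  simp only [mul_neg, Finset.sum_neg_distrib, h1]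
  simp

theorem dotProduct_of_rank_one {M A : Matrix (Fin 3) (Fin 3) F} {w : Fin 3 → F}
    (hw : ∀ j k, -M.adjugate j k = w j * w k) : w ⬝ᵥ (A *ᵥ w) = -(M.adjugate * A).trace := by
  have hw' : ∀ j k, M.adjugate j k = -(w j * w k) := fun j k => by rw [← hw]; ring
  simp only [dotProduct, mulVec, trace_fin_three, mul_apply, Fin.sum_univ_three, hw']
  ring

/-- If the pencil has three distinct degenerate members, each with minus its adjugate of the
form `w wᵀ`, then it has a common zero. -/
theorem common_zero_of_rank_one [CharZero F] {A B : Matrix (Fin 3) (Fin 3) F} (hA : A.IsSymm)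
    (hB : B.IsSymm) {a : F} {r : Fin 3 → F} (ha : a ≠ 0) (hr : Function.Injective r)
    (hD : detPoly A B = Polynomial.C a * ((X - C (r 0)) * (X - C (r 1)) * (X - C (r 2))))
    {w : Fin 3 → Fin 3 → F} (hw : ∀ i j k, -(r i • A - B).adjugate j k = w i j * w i k)
    {x : Fin 3 → F} (hx : x = ∑ i, (1 / ((r i • A - B).adjugate * A).trace) • w i) :
    x ≠ 0 ∧ qv A x = 0 ∧ qv B x = 0 := by
  obtain ⟨t0, t1, t2⟩ := trace_at_root hD
  have h01 : r 0 - r 1 ≠ 0 := sub_ne_zero.2 (hr.ne (by decide))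
  have h02 : r 0 - r 2 ≠ 0 := sub_ne_zero.2 (hr.ne (by decide))
  have h12 : r 1 - r 2 ≠ 0 := sub_ne_zero.2 (hr.ne (by decide))
  have h10 : r 1 - r 0 ≠ 0 := sub_ne_zero.2 (hr.ne (by decide))
  have h20 : r 2 - r 0 ≠ 0 := sub_ne_zero.2 (hr.ne (by decide))
  have h21 : r 2 - r 1 ≠ 0 := sub_ne_zero.2 (hr.ne (by decide))
  have ht : ∀ i, ((r i • A - B).adjugate * A).trace ≠ 0 := by
    intro i
    fin_cases i
    · exact t0 ▸ mul_ne_zero ha (mul_ne_zero h01 h02)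
    · exact t1 ▸ mul_ne_zero ha (mul_ne_zero h10 h12)
    · exact t2 ▸ mul_ne_zero ha (mul_ne_zero h20 h21)
  have hdet : ∀ i, (r i • A - B).det = 0 := by
    intro i
    rw [← detPoly_eval, hD]
    fin_cases i <;> simp
  have hker : ∀ i, (r i • A - B) *ᵥ w i = 0 := fun i =>
    mulVec_eq_zero_of_rank_one (hdet i) (fun h => ht i (by simp [h])) (hw i)
  have hBw : ∀ i, B *ᵥ w i = r i • (A *ᵥ w i) := fun i => by
    have := hker i
    rw [sub_mulVec, smul_mulVec, sub_eq_zero] at this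
    exact this.symm
  have hsymm : ∀ {S : Matrix (Fin 3) (Fin 3) F}, S.IsSymm → ∀ u v : Fin 3 → F,
      u ⬝ᵥ (S *ᵥ v) = v ⬝ᵥ (S *ᵥ u) := fun hS u v => by
    rw [dotProduct_mulVec, ← mulVec_transpose, hS.eq, dotProduct_comm]
  have horth : ∀ i j, i ≠ j → w i ⬝ᵥ (A *ᵥ w j) = 0 := by
    intro i j hij
    have h1 := hsymm hB (w i) (w j)
    rw [hBw, hBw, dotProduct_smul, dotProduct_smul, hsymm hA (w j) (w i), smul_eq_mul,
      smul_eq_mul] at h1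
    have h2 : (r j - r i) * (w i ⬝ᵥ (A *ᵥ w j)) = 0 := by linear_combination h1
    exact (mul_eq_zero.1 h2).resolve_left (sub_ne_zero.2 (hr.ne hij.symm))
  have hdiag : ∀ i, w i ⬝ᵥ (A *ᵥ w i) = -((r i • A - B).adjugate * A).trace := fun i =>
    dotProduct_of_rank_one (hw i)
  have hAx : ∀ i, w i ⬝ᵥ (A *ᵥ x) = -1 := by
    intro i
    rw [hx, mulVec_sum, dotProduct_sum, Finset.sum_eq_single i]
    · rw [mulVec_smul, dotProduct_smul, hdiag, smul_eq_mul]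
      have := ht i
      field_simp
    · intro j _ hj
      rw [mulVec_smul, dotProduct_smul, horth i j hj.symm, smul_zero]
    · simp
  have hBx : ∀ i, w i ⬝ᵥ (B *ᵥ x) = -r i := by
    intro i
    rw [hsymm hB, hBw, dotProduct_smul, hsymm hA, hAx, smul_eq_mul, mul_neg_one]
  refine ⟨fun h0 => ?_, ?_, ?_⟩
  · have := hAx 0
    rw [h0] at this
    simp at this
  · have : qv A x = ∑ i, (1 / ((r i • A - B).adjugate * A).trace) * (w i ⬝ᵥ (A *ᵥ x)) := by
      rw [qv]
      conv_lhs => rw [hx]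
      rw [sum_dotProduct]
      simp only [smul_dotProduct, smul_eq_mul, ← hx]
    rw [this, Fin.sum_univ_three, t0, t1, t2, hAx, hAx, hAx]
    field_simp
    ring
  · have : qv B x = ∑ i, (1 / ((r i • A - B).adjugate * A).trace) * (w i ⬝ᵥ (B *ᵥ x)) := by
      rw [qv]
      conv_lhs => rw [hx]
      rw [sum_dotProduct]
      simp only [smul_dotProduct, smul_eq_mul, ← hx]
    rw [this, Fin.sum_univ_three, t0, t1, t2, hBx, hBx, hBx]
    field_simp
    ring

end CommonZero

section Zeta

open NumberField Filter Topology

variable (K : Type*) [Field K] [NumberField K]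

theorem dedekindZeta_ofReal {s : ℝ} (hs : 1 < s) (hz : dedekindZeta K s ≠ 0) :
    ∃ z : ℝ, dedekindZeta K s = z ∧
      HasSum (fun n : ℕ => (Nat.card {I : Ideal (𝓞 K) // Ideal.absNorm I = n} : ℝ) *
        (n : ℝ) ^ (-s)) z := by
  have hs0 : -s ≠ 0 := by linarith
  have hsum : LSeriesSummable
      (fun n ↦ (Nat.card {I : Ideal (𝓞 K) // Ideal.absNorm I = n} : ℂ)) s := by
    by_contra h
    exact hz (LSeries.eq_zero_of_not_LSeriesSummable _ _ h)
  have hterm : ∀ n : ℕ, LSeries.term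
      (fun n ↦ (Nat.card {I : Ideal (𝓞 K) // Ideal.absNorm I = n} : ℂ)) s n
      = ((Nat.card {I : Ideal (𝓞 K) // Ideal.absNorm I = n} * (n : ℝ) ^ (-s) : ℝ) : ℂ) := by
    intro n
    rcases eq_or_ne n 0 with rfl | hn
    · simp [Real.zero_rpow hs0]
    · rw [LSeries.term_of_ne_zero hn, Real.rpow_neg (Nat.cast_nonneg n)]
      push_cast
      rw [Complex.ofReal_cpow (Nat.cast_nonneg n), div_eq_mul_inv]
      simp
  have h2 := hsum.hasSum
  simp only [hterm] at h2
  have hre : dedekindZeta K s = ((dedekindZeta K s).re : ℂ) := by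
    have : dedekindZeta K s = ∑' n : ℕ,
      ((Nat.card {I : Ideal (𝓞 K) // Ideal.absNorm I = n} * (n : ℝ) ^ (-s) : ℝ) : ℂ) := by
      rw [dedekindZeta, LSeries]; exact tsum_congr hterm
    rw [this, ← Complex.ofReal_tsum, Complex.ofReal_re]
  refine ⟨(dedekindZeta K s).re, hre, ?_⟩
  rw [← Complex.hasSum_ofReal, ← hre, dedekindZeta, LSeries]
  convert h2 using 1
  · exact funext fun n => (hterm n).symm
  · exact tsum_congr hterm

theorem eventually_sum_absNorm_bounds :
    ∃ c C : ℝ, 0 < c ∧ 0 < C ∧ ∀ᶠ s : ℝ in 𝓝[>] 1,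
      (∀ F : Finset (Ideal (𝓞 K)), ∑ I ∈ F, (Ideal.absNorm I : ℝ) ^ (-s) ≤ C / (s - 1)) ∧
      ∃ F : Finset (Ideal (𝓞 K)), (∀ I ∈ F, I ≠ ⊥) ∧
        c / (s - 1) ≤ ∑ I ∈ F, (Ideal.absNorm I : ℝ) ^ (-s) := by
  classical
  set ρ := dedekindZeta_residue K with hρ
  have hpos : 0 < ρ := dedekindZeta_residue_pos K
  have hlim := (tendsto_sub_one_mul_dedekindZeta_nhdsGT K).norm
  have hnorm : ‖(ρ : ℂ)‖ = ρ := by rw [Complex.norm_real, Real.norm_of_nonneg hpos.le]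
  rw [← hρ, hnorm] at hlim
  refine ⟨ρ / 2, 2 * ρ, by positivity, by positivity, ?_⟩
  filter_upwards [hlim.eventually_const_lt (show ρ / 2 < ρ by linarith),
    hlim.eventually_lt_const (show ρ < 2 * ρ by linarith), self_mem_nhdsWithin] with s h1 h2 hs
  have hs : 1 < s := hs
  have hs1 : 0 < s - 1 := by linarith
  have hs0 : -s ≠ 0 := by linarith
  obtain ⟨z, hz, hsum⟩ := dedekindZeta_ofReal K hs (by
    intro h0
    rw [h0, mul_zero, norm_zero] at h1
    linarith)
  have hz0 : 0 ≤ z := hsum.nonneg fun n => by positivity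
  have hval : ‖((s : ℂ) - 1) * dedekindZeta K s‖ = (s - 1) * z := by
    rw [hz, ← Complex.ofReal_one, ← Complex.ofReal_sub, ← Complex.ofReal_mul, Complex.norm_real,
      Real.norm_of_nonneg (by positivity)]
  rw [hval] at h1 h2
  have hfib : ∀ n : ℕ, ∑ I ∈ (Ideal.finite_setOfPred_absNorm_eq (S := 𝓞 K) n).toFinset,
      (Ideal.absNorm I : ℝ) ^ (-s) =
      (Nat.card {I : Ideal (𝓞 K) // Ideal.absNorm I = n} : ℝ) * (n : ℝ) ^ (-s) := by
    intro n
    rw [Finset.sum_congr rfl (g := fun _ => (n : ℝ) ^ (-s)) fun I hI => by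
      rw [(Ideal.finite_setOfPred_absNorm_eq n).mem_toFinset] at hI
      rw [show Ideal.absNorm I = n from hI], Finset.sum_const, nsmul_eq_mul]
    congr 2
    exact (Nat.card_eq_card_finite_toFinset _).symm
  constructor
  · intro F
    calc ∑ I ∈ F, (Ideal.absNorm I : ℝ) ^ (-s)
        = ∑ n ∈ F.image Ideal.absNorm, ∑ I ∈ F with Ideal.absNorm I = n,
            (Ideal.absNorm I : ℝ) ^ (-s) :=
          (Finset.sum_fiberwise_of_maps_to (fun I hI => Finset.mem_image_of_mem _ hI) _).symm
      _ ≤ ∑ n ∈ F.image Ideal.absNorm,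
            (Nat.card {I : Ideal (𝓞 K) // Ideal.absNorm I = n} : ℝ) * (n : ℝ) ^ (-s) := by
          refine Finset.sum_le_sum fun n _ => ?_
          rw [← hfib]
          refine Finset.sum_le_sum_of_subset_of_nonneg (fun I hI => ?_) fun I _ _ => by positivity
          rw [(Ideal.finite_setOfPred_absNorm_eq n).mem_toFinset]
          exact (Finset.mem_filter.1 hI).2
      _ ≤ z := sum_le_hasSum _ (fun n _ => by positivity) hsum
      _ ≤ 2 * ρ / (s - 1) := by rw [le_div_iff₀ hs1]; linarith
  · have hlt : ρ / 2 / (s - 1) < z := by rw [div_lt_iff₀ hs1]; linarith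
    obtain ⟨T, hT⟩ := (Filter.Tendsto.eventually_const_lt hlt hsum).exists
    refine ⟨(T.biUnion fun n => (Ideal.finite_setOfPred_absNorm_eq (S := 𝓞 K) n).toFinset).filter
      (· ≠ ⊥), fun I hI => (Finset.mem_filter.1 hI).2, ?_⟩
    rw [Finset.sum_filter_of_ne, Finset.sum_biUnion]
    · simp only [hfib]
      exact hT.le
    · intro m _ n _ hmn
      refine Finset.disjoint_left.2 fun I hI hI' => hmn ?_
      rw [Set.Finite.mem_toFinset] at hI hI'
      exact hI.symm.trans hI'
    · rintro I - hI rfl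
      apply hI
      simp [Real.zero_rpow hs0]

end Zeta

section EulerProduct

open NumberField IsDedekindDomain

theorem Real.exp_sub_sq_le_one_add {x : ℝ} (hx : 0 ≤ x) : Real.exp (x - x ^ 2) ≤ 1 + x := by
  rw [← Real.le_log_iff_exp_le (by linarith)]
  refine le_trans ?_ (Real.le_log_one_add_of_nonneg hx)
  rw [le_div_iff₀ (by linarith)]
  nlinarith [pow_nonneg hx 3, sq_nonneg x]

theorem geom_sum_le_exp {x : ℝ} (hx : 0 ≤ x) (hx2 : x ≤ 1 / 2) (N : ℕ) :
    ∑ j ∈ Finset.range N, x ^ j ≤ Real.exp (x + 2 * x ^ 2) := by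
  refine le_trans ?_ (Real.add_one_le_exp _)
  have h1 : (∑ j ∈ Finset.range N, x ^ j) * (1 - x) = 1 - x ^ N := geom_sum_mul_neg x N
  have h2 : 0 ≤ x ^ N := pow_nonneg hx N
  refine le_of_mul_le_mul_right ?_ (show 0 < 1 - x by linarith)
  rw [h1]
  nlinarith [mul_nonneg (sq_nonneg x) (show 0 ≤ 1 - 2 * x by linarith)]

variable {K : Type*} [Field K] [NumberField K]

theorem two_le_absNorm_heightOneSpectrum (P : HeightOneSpectrum (𝓞 K)) :
    2 ≤ Ideal.absNorm P.asIdeal := by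
  have h0 : Ideal.absNorm P.asIdeal ≠ 0 := fun h => P.ne_bot (Ideal.absNorm_eq_zero_iff.1 h)
  have h1 : Ideal.absNorm P.asIdeal ≠ 1 := fun h => P.isPrime.ne_top (Ideal.absNorm_eq_one_iff.1 h)
  omega

theorem absNorm_rpow_nonneg (I : Ideal (𝓞 K)) (s : ℝ) : 0 ≤ (Ideal.absNorm I : ℝ) ^ s :=
  Real.rpow_nonneg (Nat.cast_nonneg _) _

theorem absNorm_rpow_le_half (P : HeightOneSpectrum (𝓞 K)) {s : ℝ} (hs : 1 ≤ s) :
    (Ideal.absNorm P.asIdeal : ℝ) ^ (-s) ≤ 1 / 2 := by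
  have h2 : (2 : ℝ) ≤ Ideal.absNorm P.asIdeal := by
    exact_mod_cast two_le_absNorm_heightOneSpectrum P
  calc (Ideal.absNorm P.asIdeal : ℝ) ^ (-s) ≤ (Ideal.absNorm P.asIdeal : ℝ) ^ (-1 : ℝ) :=
        Real.rpow_le_rpow_of_exponent_le (by linarith) (by linarith)
    _ ≤ 1 / 2 := by
        rw [Real.rpow_neg_one, inv_eq_one_div]
        exact one_div_le_one_div_of_le (by norm_num) h2

theorem absNorm_prod_rpow {ι : Type*} (t : Finset ι) (I : ι → Ideal (𝓞 K)) (s : ℝ) :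
    (Ideal.absNorm (∏ i ∈ t, I i) : ℝ) ^ s = ∏ i ∈ t, (Ideal.absNorm (I i) : ℝ) ^ s := by
  rw [map_prod, Nat.cast_prod, Real.finsetProd_rpow _ _ fun i _ => Nat.cast_nonneg _]

theorem exp_sum_le_of_sum_le {s Z : ℝ}
    (hZ : ∀ F : Finset (Ideal (𝓞 K)), ∑ I ∈ F, (Ideal.absNorm I : ℝ) ^ (-s) ≤ Z)
    (T : Finset (HeightOneSpectrum (𝓞 K))) :
    Real.exp (∑ P ∈ T, ((Ideal.absNorm P.asIdeal : ℝ) ^ (-s)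
      - ((Ideal.absNorm P.asIdeal : ℝ) ^ (-s)) ^ 2)) ≤ Z := by
  classical
  have hinj : Function.Injective fun t : Finset (HeightOneSpectrum (𝓞 K)) =>
      ∏ P ∈ t, P.asIdeal := by
    have hmem : ∀ (t : Finset (HeightOneSpectrum (𝓞 K))) P, P ∈ t ↔
        P.asIdeal ∣ ∏ Q ∈ t, Q.asIdeal := by
      intro t P
      refine ⟨fun h => Finset.dvd_prod_of_mem _ h, fun h => ?_⟩
      obtain ⟨Q, hQ, hPQ⟩ := (P.prime.dvd_finsetProd_iff _).1 h
      have : P = Q := HeightOneSpectrum.ext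
        (associated_iff_eq.1 (P.prime.associated_of_dvd Q.prime hPQ))
      rwa [this]
    intro t t' h
    ext P
    rw [hmem, hmem]
    exact iff_of_eq (congrArg _ h)
  rw [Real.exp_sum]
  calc ∏ P ∈ T, Real.exp ((Ideal.absNorm P.asIdeal : ℝ) ^ (-s)
        - ((Ideal.absNorm P.asIdeal : ℝ) ^ (-s)) ^ 2)
      ≤ ∏ P ∈ T, (1 + (Ideal.absNorm P.asIdeal : ℝ) ^ (-s)) :=
        Finset.prod_le_prod (fun _ _ => (Real.exp_pos _).le) fun P _ =>
          Real.exp_sub_sq_le_one_add (absNorm_rpow_nonneg _ _)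
    _ = ∑ I ∈ T.powerset.image fun t => ∏ P ∈ t, P.asIdeal, (Ideal.absNorm I : ℝ) ^ (-s) := by
        rw [Finset.prod_one_add, Finset.sum_image hinj.injOn]
        exact Finset.sum_congr rfl fun t _ => (absNorm_prod_rpow _ _ _).symm
    _ ≤ Z := hZ _

theorem exists_sum_le_exp_sum {s : ℝ} (hs : 1 ≤ s) (F : Finset (Ideal (𝓞 K)))
    (hF : ∀ I ∈ F, I ≠ ⊥) :
    ∃ S : Finset (HeightOneSpectrum (𝓞 K)), ∑ I ∈ F, (Ideal.absNorm I : ℝ) ^ (-s) ≤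
      Real.exp (∑ P ∈ S, ((Ideal.absNorm P.asIdeal : ℝ) ^ (-s)
        + 2 * ((Ideal.absNorm P.asIdeal : ℝ) ^ (-s)) ^ 2)) := by
  classical
  set e : HeightOneSpectrum (𝓞 K) → Ideal (𝓞 K) → ℕ := fun P I =>
    (Associates.mk P.asIdeal).count (Associates.mk I).factors with he
  have hfin : (⋃ I ∈ F, Function.mulSupport fun P : HeightOneSpectrum (𝓞 K) =>
      P.maxPowDividing I).Finite :=
    F.finite_toSet.biUnion fun I hI => Ideal.hasFiniteMulSupport (hF I hI)
  set S := hfin.toFinset with hS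
  have hfact : ∀ I ∈ F, ∏ P : S, P.1.asIdeal ^ e P.1 I = I := by
    intro I hI
    conv_rhs => rw [← Ideal.finprod_heightOneSpectrum_factorization (hF I hI)]
    rw [finprod_eq_prod_of_mulSupport_subset (s := S) _ (fun P hP => by
      rw [hS, Set.Finite.coe_toFinset]
      exact Set.mem_biUnion hI hP)]
    exact Finset.prod_coe_sort S fun P => P.asIdeal ^ e P I
  obtain ⟨N, hN⟩ : ∃ N, ∀ I ∈ F, ∀ P : S, e P.1 I < N := by
    refine ⟨(F.sup fun I => Finset.univ.sup fun P : S => e P.1 I) + 1, fun I hI P => ?_⟩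
    refine Nat.lt_succ_of_le ?_
    exact le_trans (Finset.le_sup (f := fun P : S => e P.1 I) (Finset.mem_univ P))
      (Finset.le_sup (f := fun I => Finset.univ.sup fun P : S => e P.1 I) hI)
  have hinj : Set.InjOn (fun I (P : S) => e P.1 I) F := by
    intro I hI J hJ h
    rw [← hfact I hI, ← hfact J hJ]
    exact Finset.prod_congr rfl fun P _ => by rw [show e P.1 I = e P.1 J from congrFun h P]
  refine ⟨S, ?_⟩
  rw [Real.exp_sum]
  calc ∑ I ∈ F, (Ideal.absNorm I : ℝ) ^ (-s)
      = ∑ I ∈ F, ∏ P : S, ((Ideal.absNorm P.1.asIdeal : ℝ) ^ (-s)) ^ e P.1 I := by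
        refine Finset.sum_congr rfl fun I hI => ?_
        conv_lhs => rw [← hfact I hI]
        rw [absNorm_prod_rpow]
        refine Finset.prod_congr rfl fun P _ => ?_
        rw [map_pow, Nat.cast_pow, ← Real.rpow_natCast, ← Real.rpow_natCast,
          ← Real.rpow_mul (Nat.cast_nonneg _), ← Real.rpow_mul (Nat.cast_nonneg _), mul_comm]
    _ = ∑ f ∈ F.image fun I (P : S) => e P.1 I,
          ∏ P : S, ((Ideal.absNorm P.1.asIdeal : ℝ) ^ (-s)) ^ f P := by
        rw [Finset.sum_image hinj]
    _ ≤ ∑ f ∈ Fintype.piFinset fun _ : S => Finset.range N,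
          ∏ P : S, ((Ideal.absNorm P.1.asIdeal : ℝ) ^ (-s)) ^ f P := by
        refine Finset.sum_le_sum_of_subset_of_nonneg ?_ fun f _ _ =>
          Finset.prod_nonneg fun P _ => pow_nonneg (absNorm_rpow_nonneg _ _) _
        intro f hf
        obtain ⟨I, hI, rfl⟩ := Finset.mem_image.1 hf
        exact Fintype.mem_piFinset.2 fun P => Finset.mem_range.2 (hN I hI P)
    _ = ∏ P : S, ∑ j ∈ Finset.range N, ((Ideal.absNorm P.1.asIdeal : ℝ) ^ (-s)) ^ j :=
        (Finset.prod_univ_sum _ _).symm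
    _ ≤ ∏ P : S, Real.exp ((Ideal.absNorm P.1.asIdeal : ℝ) ^ (-s)
          + 2 * ((Ideal.absNorm P.1.asIdeal : ℝ) ^ (-s)) ^ 2) :=
        Finset.prod_le_prod
          (fun P _ => Finset.sum_nonneg fun j _ => pow_nonneg (absNorm_rpow_nonneg _ _) _)
          fun P _ => geom_sum_le_exp (absNorm_rpow_nonneg _ _) (absNorm_rpow_le_half _ hs) N
    _ = _ := Finset.prod_coe_sort S fun P : HeightOneSpectrum (𝓞 K) =>
        Real.exp ((Ideal.absNorm P.asIdeal : ℝ) ^ (-s)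
          + 2 * ((Ideal.absNorm P.asIdeal : ℝ) ^ (-s)) ^ 2)

end EulerProduct

section PrimeSums

open NumberField IsDedekindDomain Filter Topology

variable {K : Type*} [Field K] [NumberField K]

variable (K) in
theorem exists_bound_sum_absNorm_sq :
    ∃ D : ℝ, ∀ S : Finset (HeightOneSpectrum (𝓞 K)), ∀ s : ℝ, 1 ≤ s →
      ∑ P ∈ S, ((Ideal.absNorm P.asIdeal : ℝ) ^ (-s)) ^ 2 ≤ D := by
  classical
  obtain ⟨c, C, -, -, h⟩ := eventually_sum_absNorm_bounds K
  have h2 : ∀ᶠ s : ℝ in 𝓝[>] 1, s < 2 :=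
    eventually_nhdsWithin_of_eventually_nhds (eventually_lt_nhds (by norm_num))
  obtain ⟨s₀, ⟨hs, -⟩, hs2⟩ := (h.and h2).exists
  refine ⟨C / (s₀ - 1), fun S s hs1 => le_trans ?_ (hs (S.image fun P => P.asIdeal))⟩
  rw [Finset.sum_image fun P _ Q _ h => HeightOneSpectrum.ext h]
  refine Finset.sum_le_sum fun P _ => ?_
  have h1 : (1 : ℝ) ≤ Ideal.absNorm P.asIdeal := by
    exact_mod_cast le_trans one_le_two (two_le_absNorm_heightOneSpectrum P)
  rw [← Real.rpow_natCast, ← Real.rpow_mul (Nat.cast_nonneg _)]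
  refine Real.rpow_le_rpow_of_exponent_le h1 ?_
  push_cast
  linarith

theorem HeightOneSpectrum.exists_absNorm_eq_prime_pow (P : HeightOneSpectrum (𝓞 K)) :
    ∃ q : ℕ, q.Prime ∧ (q : 𝓞 K) ∈ P.asIdeal ∧ ∃ f, Ideal.absNorm P.asIdeal = q ^ f := by
  have := P.isPrime
  have : Finite (𝓞 K ⧸ P.asIdeal) := Ideal.finiteQuotientOfFreeOfNeBot _ P.ne_bot
  obtain ⟨q, hq⟩ := CharP.exists (𝓞 K ⧸ P.asIdeal)
  have hqp : q.Prime := CharP.char_is_prime (𝓞 K ⧸ P.asIdeal) q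
  have hmem : (q : 𝓞 K) ∈ P.asIdeal := by
    rw [← Ideal.Quotient.eq_zero_iff_mem, map_natCast]
    exact CharP.cast_eq_zero _ q
  refine ⟨q, hqp, hmem, ?_⟩
  have hdvd := Ideal.absNorm_dvd_absNorm_of_le ((Ideal.span_singleton_le_iff_mem _).2 hmem)
  rw [Ideal.absNorm_span_singleton, ← map_natCast (algebraMap ℤ (𝓞 K)),
    Algebra.norm_algebraMap, Int.natAbs_pow, Int.natAbs_natCast] at hdvd
  obtain ⟨f, -, hf⟩ := (Nat.dvd_prime_pow hqp).1 hdvd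
  exact ⟨f, hf⟩

theorem card_le_finrank_of_mem {q : ℕ} (hq : q.Prime) (T : Finset (HeightOneSpectrum (𝓞 K)))
    (hT : ∀ P ∈ T, (q : 𝓞 K) ∈ P.asIdeal ∧ q ≤ Ideal.absNorm P.asIdeal) :
    T.card ≤ Module.finrank ℤ (𝓞 K) := by
  have hdvd : ∏ P ∈ T, P.asIdeal ∣ Ideal.span {(q : 𝓞 K)} := by
    classical
    rw [← Finset.prod_image (f := fun I : Ideal (𝓞 K) => I) (g := fun P => P.asIdeal)
      fun P _ Q _ h => HeightOneSpectrum.ext h]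
    refine Finset.prod_primes_dvd _ (fun I hI => ?_) fun I hI => ?_
    · obtain ⟨P, -, rfl⟩ := Finset.mem_image.1 hI
      exact P.prime
    · obtain ⟨P, hP, rfl⟩ := Finset.mem_image.1 hI
      exact Ideal.dvd_span_singleton.2 (hT P hP).1
  have h := Nat.le_of_dvd ?_ (map_dvd Ideal.absNorm hdvd)
  · rw [Ideal.absNorm_span_singleton, ← map_natCast (algebraMap ℤ (𝓞 K)),
      Algebra.norm_algebraMap, Int.natAbs_pow, Int.natAbs_natCast, map_prod] at h
    have h2 := (Finset.prod_le_prod' fun P hP => (hT P hP).2).trans h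
    rw [Finset.prod_const] at h2
    exact (Nat.pow_le_pow_iff_right hq.one_lt).1 h2
  · rw [Ideal.absNorm_span_singleton, ← map_natCast (algebraMap ℤ (𝓞 K)),
      Algebra.norm_algebraMap, Int.natAbs_pow, Int.natAbs_natCast]
    exact pow_pos hq.pos _

variable (K) in
theorem exists_bound_sum_absNorm_not_prime :
    ∃ D : ℝ, ∀ S : Finset (HeightOneSpectrum (𝓞 K)),
      (∀ P ∈ S, ¬(Ideal.absNorm P.asIdeal).Prime) → ∀ s : ℝ, 1 ≤ s →
      ∑ P ∈ S, (Ideal.absNorm P.asIdeal : ℝ) ^ (-s) ≤ D := by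
  classical
  choose q hq hmem f hf using HeightOneSpectrum.exists_absNorm_eq_prime_pow (K := K)
  have hsum : Summable fun n : ℕ => ((n : ℝ) ^ 2)⁻¹ := Real.summable_nat_pow_inv.2 one_lt_two
  refine ⟨Module.finrank ℤ (𝓞 K) * ∑' n : ℕ, ((n : ℝ) ^ 2)⁻¹, fun S hS s hs => ?_⟩
  have hsq : ∀ P ∈ S, q P ^ 2 ≤ Ideal.absNorm P.asIdeal := by
    intro P hP
    rw [hf]
    refine Nat.pow_le_pow_right (hq P).pos ?_
    have h1 : f P ≠ 1 := fun h => hS P hP (by rw [hf, h, pow_one]; exact hq P)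
    have h0 : f P ≠ 0 := fun h => by
      have := two_le_absNorm_heightOneSpectrum P
      rw [hf, h] at this
      norm_num at this
    omega
  have hle : ∀ P ∈ S, (Ideal.absNorm P.asIdeal : ℝ) ^ (-s) ≤ ((q P : ℝ) ^ 2)⁻¹ := by
    intro P hP
    have h1 : (1 : ℝ) ≤ Ideal.absNorm P.asIdeal := by
      exact_mod_cast le_trans one_le_two (two_le_absNorm_heightOneSpectrum P)
    calc (Ideal.absNorm P.asIdeal : ℝ) ^ (-s) ≤ (Ideal.absNorm P.asIdeal : ℝ) ^ (-1 : ℝ) :=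
          Real.rpow_le_rpow_of_exponent_le h1 (by linarith)
      _ ≤ ((q P : ℝ) ^ 2)⁻¹ := by
          rw [Real.rpow_neg_one]
          refine inv_anti₀ (pow_pos (by exact_mod_cast (hq P).pos) 2) ?_
          exact_mod_cast hsq P hP
  calc ∑ P ∈ S, (Ideal.absNorm P.asIdeal : ℝ) ^ (-s)
      ≤ ∑ P ∈ S, ((q P : ℝ) ^ 2)⁻¹ := Finset.sum_le_sum hle
    _ = ∑ n ∈ S.image q, ∑ P ∈ S with q P = n, ((q P : ℝ) ^ 2)⁻¹ :=
        (Finset.sum_fiberwise_of_maps_to (fun I hI => Finset.mem_image_of_mem _ hI) _).symm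
    _ ≤ ∑ n ∈ S.image q, (Module.finrank ℤ (𝓞 K) : ℝ) * ((n : ℝ) ^ 2)⁻¹ := by
        refine Finset.sum_le_sum fun n hn => ?_
        obtain ⟨P₀, -, rfl⟩ := Finset.mem_image.1 hn
        rw [Finset.sum_congr rfl (g := fun _ => ((q P₀ : ℝ) ^ 2)⁻¹) fun P hP => by
          rw [(Finset.mem_filter.1 hP).2], Finset.sum_const, nsmul_eq_mul]
        refine mul_le_mul_of_nonneg_right ?_ (by positivity)
        have := card_le_finrank_of_mem (hq P₀) (S.filter fun P => q P = q P₀) fun P hP => by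
          obtain ⟨hPS, hPq⟩ := Finset.mem_filter.1 hP
          rw [← hPq]
          exact ⟨hmem P, (Nat.le_self_pow two_ne_zero _).trans (hsq P hPS)⟩
        exact_mod_cast this
    _ = Module.finrank ℤ (𝓞 K) * ∑ n ∈ S.image q, ((n : ℝ) ^ 2)⁻¹ := by rw [Finset.mul_sum]
    _ ≤ Module.finrank ℤ (𝓞 K) * ∑' n : ℕ, ((n : ℝ) ^ 2)⁻¹ :=
        mul_le_mul_of_nonneg_left (hsum.sum_le_tsum _ fun n _ => by positivity) (Nat.cast_nonneg _)

end PrimeSums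

section DegreeOne

open NumberField IsDedekindDomain Polynomial

theorem map_aeval_int {R S : Type*} [CommRing R] [Algebra ℤ R] [CommRing S] [Algebra ℤ S]
    (φ : R →+* S) (x : R) (g : ℤ[X]) : φ (aeval x g) = aeval (φ x) g := by
  rw [aeval_def, aeval_def, hom_eval₂]
  congr 1
  exact RingHom.ext_int _ _

/-- A `p`-adic embedding of a number field restricts to a map from the ring of integers to
the `p`-adic integers. -/
theorem exists_padicInt_hom {M : Type*} [Field M] {q : ℕ} [Fact q.Prime] (τ : M →+* ℚ_[q]) :
    ∃ ψ : 𝓞 M →+* ℤ_[q], ∀ x, (ψ x : ℚ_[q]) = τ x := by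
  have hint : ∀ x : 𝓞 M, ‖τ x‖ ≤ 1 := by
    intro x
    have h1 : IsIntegral ℤ (τ x) := map_isIntegral_int τ x.isIntegral_coe
    have h2 : IsIntegral ℤ_[q] (τ x) := h1.tower_top
    obtain ⟨y, hy⟩ := IsIntegrallyClosed.isIntegral_iff.1 h2
    rw [← hy]
    exact y.2
  exact ⟨{ toFun := fun x => ⟨τ x, hint x⟩
           map_one' := by apply PadicInt.ext; simp
           map_zero' := by apply PadicInt.ext; simp
           map_mul' := fun x y => Subtype.ext (map_mul τ (x : M) y)
           map_add' := fun x y => Subtype.ext (map_add τ (x : M) y) }, fun x => rfl⟩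

theorem exists_integral_powerBasis (K : Type*) [Field K] [NumberField K] :
    ∃ (θ : 𝓞 K) (B : PowerBasis ℚ K), B.gen = θ := by
  obtain ⟨α, hα⟩ := Field.exists_primitive_element ℚ K
  obtain ⟨m, hm, hint⟩ := ((IsFractionRing.isAlgebraic_iff ℤ ℚ K).2
    (Algebra.IsAlgebraic.isAlgebraic α)).exists_integral_multiple
  have hαtop : Algebra.adjoin ℚ {α} = ⊤ := by
    rw [← IntermediateField.adjoin_simple_toSubalgebra_of_isAlgebraic
      (Algebra.IsAlgebraic.isAlgebraic α), hα, IntermediateField.top_toSubalgebra]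
  have htop : Algebra.adjoin ℚ {m • α} = ⊤ := by
    rw [eq_top_iff, ← hαtop]
    refine Algebra.adjoin_le ?_
    intro x hx
    rw [Set.mem_singleton_iff.1 hx]
    have h := Subalgebra.smul_mem _ (Algebra.self_mem_adjoin_singleton ℚ (m • α)) (m : ℚ)⁻¹
    have hm' : (m : ℚ) ≠ 0 := by exact_mod_cast hm
    rw [← Int.cast_smul_eq_zsmul ℚ, smul_smul, inv_mul_cancel₀ hm', one_smul,
      Int.cast_smul_eq_zsmul] at h
    exact h
  refine ⟨⟨m • α, hint⟩, PowerBasis.ofAdjoinEqTop (Algebra.IsIntegral.isIntegral _) htop, ?_⟩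
  rw [PowerBasis.ofAdjoinEqTop_gen]
  rfl

/-- All but finitely many primes of degree one are induced by a `q`-adic embedding. -/
theorem exists_padic_embedding_of_prime_absNorm (K : Type*) [Field K] [NumberField K] :
    ∃ c : 𝓞 K, c ≠ 0 ∧ ∀ P : HeightOneSpectrum (𝓞 K), c ∉ P.asIdeal → ∀ (q : ℕ) [Fact q.Prime],
      Ideal.absNorm P.asIdeal = q → ∃ (σ : K →+* ℚ_[q]) (ψ : 𝓞 K →+* ℤ_[q]),
        (∀ x, (ψ x : ℚ_[q]) = σ x) ∧ ∀ x ∈ P.asIdeal, PadicInt.toZMod (ψ x) = 0 := by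
  obtain ⟨θ, B, hB⟩ := exists_integral_powerBasis K
  have hθ : IsIntegral ℤ (θ : K) := θ.isIntegral_coe
  set f := minpoly ℤ (θ : K) with hf
  have hfθ : aeval θ f = 0 := by
    apply RingOfIntegers.coe_injective
    rw [map_zero, map_aeval_int (algebraMap (𝓞 K) K)]
    exact minpoly.aeval _ _
  have hfQ : minpoly ℚ (θ : K) = f.map (algebraMap ℤ ℚ) :=
    minpoly.isIntegrallyClosed_eq_field_fractions' ℚ hθ
  have hf' : aeval θ (derivative f) ≠ 0 := by
    intro h
    have h1 := (minpoly.irreducible (Algebra.IsIntegral.isIntegral (R := ℚ) (θ : K))).separable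
    apply h1.aeval_derivative_ne_zero (minpoly.aeval ℚ (θ : K))
    rw [hfQ, derivative_map, aeval_map_algebraMap]
    have := congrArg (algebraMap (𝓞 K) K) h
    rwa [map_zero, map_aeval_int (algebraMap (𝓞 K) K)] at this
  set D := Algebra.discr ℚ B.basis with hD
  have hD0 : D ≠ 0 := Algebra.discr_not_zero_of_basis ℚ B.basis
  set m : ℤ := D.num with hm
  have hm0 : m ≠ 0 := Rat.num_ne_zero.2 hD0
  have hadj : ∀ x : 𝓞 K, ∃ g : ℤ[X], (m : 𝓞 K) * x = aeval θ g := by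
    intro x
    have h1 := Algebra.discr_mul_isIntegral_mem_adjoin ℚ (B := B) (R := ℤ) (by rw [hB]; exact hθ)
      x.isIntegral_coe
    rw [hB, Algebra.adjoin_singleton_eq_range_aeval] at h1
    obtain ⟨g, hg⟩ := h1
    refine ⟨(D.den : ℤ[X]) * g, ?_⟩
    apply RingOfIntegers.coe_injective
    rw [map_aeval_int (algebraMap (𝓞 K) K), map_mul, map_mul, map_natCast, map_intCast]
    change _ = _ * aeval (θ : K) g
    have hg' : aeval (θ : K) g = D • (x : K) := hg
    rw [hg', Algebra.smul_def, ← mul_assoc]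
    congr 1
    rw [← map_natCast (algebraMap ℚ K), ← map_intCast (algebraMap ℚ K), ← map_mul]
    congr 1
    rw [mul_comm, Rat.mul_den_eq_num]
  refine ⟨aeval θ (derivative f) * m, mul_ne_zero hf' (by exact_mod_cast hm0), ?_⟩
  intro P hP q hq hPq
  have := P.isPrime
  have hP1 : aeval θ (derivative f) ∉ P.asIdeal := fun h => hP (P.asIdeal.mul_mem_right _ h)
  have hP2 : (m : 𝓞 K) ∉ P.asIdeal := fun h => hP (P.asIdeal.mul_mem_left _ h)
  have : Finite (𝓞 K ⧸ P.asIdeal) := Ideal.finiteQuotientOfFreeOfNeBot _ P.ne_bot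
  have := Fintype.ofFinite (𝓞 K ⧸ P.asIdeal)
  have hcard : Fintype.card (𝓞 K ⧸ P.asIdeal) = q := by
    rw [← hPq, Fintype.card_eq_nat_card]; rfl
  set ρ : 𝓞 K →+* ZMod q := ((ZMod.ringEquivOfPrime _ hq.out hcard).symm : _ →+* ZMod q).comp
    (Ideal.Quotient.mk P.asIdeal) with hρ
  have hρ0 : ∀ x, ρ x = 0 ↔ x ∈ P.asIdeal := fun x => by
    rw [← Ideal.Quotient.eq_zero_iff_mem, hρ]; simp
  obtain ⟨a, ha⟩ := ZMod.ringHom_surjective (PadicInt.toZMod (p := q)) (ρ θ)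
  have hred : ∀ g : ℤ[X], PadicInt.toZMod (aeval a g) = ρ (aeval θ g) := fun g => by
    rw [map_aeval_int, map_aeval_int, ha]
  have hd1 : ‖aeval a (derivative f)‖ = 1 := by
    rw [← PadicInt.isUnit_iff, ← PadicInt.toZMod_ne_zero_iff, hred]
    exact fun h => hP1 ((hρ0 _).1 h)
  obtain ⟨z, hz, hza, -⟩ := hensels_lemma (F := f) (a := a) (by
    rw [hd1, one_pow, ← PadicInt.toZMod_eq_zero_iff, hred, hfθ, map_zero])
  rw [hd1, ← PadicInt.toZMod_eq_zero_iff, map_sub, sub_eq_zero, ha] at hza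
  have hzmin : aeval (z : ℚ_[q]) (minpoly ℚ B.gen) = 0 := by
    rw [hB, hfQ, aeval_map_algebraMap]
    have := congrArg (algebraMap ℤ_[q] ℚ_[q]) hz
    rwa [map_zero, map_aeval_int] at this
  set σ := (B.lift (z : ℚ_[q]) hzmin : K →+* ℚ_[q]) with hσ
  have hσθ : σ θ = z := by
    rw [← hB]; exact B.lift_gen (z : ℚ_[q]) hzmin
  obtain ⟨ψ, hψ⟩ := exists_padicInt_hom σ
  have hψθ : ψ θ = z := by
    apply PadicInt.ext; rw [hψ, hσθ]
  refine ⟨σ, ψ, hψ, fun x hx => ?_⟩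
  obtain ⟨g, hg⟩ := hadj x
  have h1 : PadicInt.toZMod (ψ ((m : 𝓞 K) * x)) = ρ ((m : 𝓞 K) * x) := by
    rw [hg, map_aeval_int, map_aeval_int, map_aeval_int, hψθ, hza]
  rw [map_mul, map_mul, map_mul, map_intCast, map_intCast, map_intCast, (hρ0 x).2 hx, mul_zero]
    at h1
  refine (mul_eq_zero.1 h1).resolve_left fun h0 => hP2 ((hρ0 _).1 ?_)
  rwa [map_intCast]

end DegreeOne

section SplitPrimes

open NumberField IsDedekindDomain Polynomial Filter Topology

/-- It is impossible that all but finitely many primes of degree one of a number field have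
two primes of the same norm above them in another number field. -/
theorem not_forall_two_primes_above {K M : Type*} [Field K] [NumberField K] [Field M]
    [NumberField M] (f : 𝓞 K →+* 𝓞 M) (E : Finset (HeightOneSpectrum (𝓞 K))) :
    ¬∀ P ∉ E, (Ideal.absNorm P.asIdeal).Prime → ∃ t : Finset (HeightOneSpectrum (𝓞 M)),
      t.card = 2 ∧ ∀ R ∈ t, R.asIdeal.comap f = P.asIdeal ∧
        Ideal.absNorm R.asIdeal = Ideal.absNorm P.asIdeal := by
  classical
  intro h
  choose! t ht2 ht using h
  obtain ⟨c, _, hc, _, hK⟩ := eventually_sum_absNorm_bounds K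
  obtain ⟨_, C, _, hC, hM⟩ := eventually_sum_absNorm_bounds M
  obtain ⟨D₁, hD₁⟩ := exists_bound_sum_absNorm_sq K
  obtain ⟨D₂, hD₂⟩ := exists_bound_sum_absNorm_not_prime K
  obtain ⟨D₃, hD₃⟩ := exists_bound_sum_absNorm_sq M
  set A := Real.exp (2 * (D₂ + E.card + 2 * D₁) + D₃) * C with hA
  have hApos : 0 < A := mul_pos (Real.exp_pos _) hC
  have key : ∀ᶠ s : ℝ in 𝓝[>] 1, c ^ 2 / A ≤ s - 1 := by
    filter_upwards [hK, hM, self_mem_nhdsWithin] with s hsK hsM hs1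
    have hs1 : 1 < s := hs1
    obtain ⟨-, F, hF, hcF⟩ := hsK
    obtain ⟨hCs, -⟩ := hsM
    obtain ⟨S, hS⟩ := exists_sum_le_exp_sum hs1.le F hF
    set x : HeightOneSpectrum (𝓞 K) → ℝ := fun P => (Ideal.absNorm P.asIdeal : ℝ) ^ (-s) with hx
    set y : HeightOneSpectrum (𝓞 M) → ℝ := fun P => (Ideal.absNorm P.asIdeal : ℝ) ^ (-s) with hy
    set S₁ := (S.filter fun P => (Ideal.absNorm P.asIdeal).Prime) with hS₁
    set G := S₁.filter fun P => P ∉ E with hG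
    have hGmem : ∀ P ∈ G, P ∉ E ∧ (Ideal.absNorm P.asIdeal).Prime := fun P hP =>
      ⟨(Finset.mem_filter.1 hP).2, (Finset.mem_filter.1 (Finset.mem_filter.1 hP).1).2⟩
    set T := G.biUnion t with hT
    have hsumT : ∑ Q ∈ T, y Q = 2 * ∑ P ∈ G, x P := by
      rw [hT, Finset.sum_biUnion, Finset.mul_sum]
      · refine Finset.sum_congr rfl fun P hP => ?_
        have hP' := hGmem P hP
        rw [Finset.sum_congr rfl (g := fun _ => x P) fun Q hQ => by
          rw [hy, hx]; simp only [(ht P hP'.1 hP'.2 Q hQ).2], Finset.sum_const,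
          ht2 P hP'.1 hP'.2, nsmul_eq_mul, Nat.cast_ofNat]
      · intro P hP P' hP' hne
        rw [Function.onFun, Finset.disjoint_left]
        intro Q hQ hQ'
        have h1 := hGmem P hP
        have h2 := hGmem P' hP'
        exact hne (HeightOneSpectrum.ext
          ((ht P h1.1 h1.2 Q hQ).1.symm.trans (ht P' h2.1 h2.2 Q hQ').1))
    have hx1 : ∀ P, x P ≤ 1 := fun P =>
      (absNorm_rpow_le_half P hs1.le).trans (by norm_num)
    have hx0 : ∀ P, 0 ≤ x P := fun P => absNorm_rpow_nonneg _ _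
    have hE : ∑ P ∈ S₁.filter (fun P => ¬P ∉ E), x P ≤ E.card := by
      calc ∑ P ∈ S₁.filter (fun P => ¬P ∉ E), x P ≤ ∑ P ∈ E, x P :=
            Finset.sum_le_sum_of_subset_of_nonneg
              (fun P hP => not_not.1 (Finset.mem_filter.1 hP).2) fun P _ _ => hx0 P
        _ ≤ ∑ P ∈ E, 1 := Finset.sum_le_sum fun P _ => hx1 P
        _ = E.card := by simp
    have hN : ∑ P ∈ S.filter (fun P => ¬(Ideal.absNorm P.asIdeal).Prime), x P ≤ D₂ :=
      hD₂ _ (fun P hP => (Finset.mem_filter.1 hP).2) s hs1.le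
    have hsum : ∑ P ∈ S, x P ≤ ∑ P ∈ G, x P + E.card + D₂ := by
      rw [← Finset.sum_filter_add_sum_filter_not S fun P => (Ideal.absNorm P.asIdeal).Prime,
        ← Finset.sum_filter_add_sum_filter_not S₁ fun P => P ∉ E]
      linarith
    have hsq : ∑ P ∈ S, x P ^ 2 ≤ D₁ := hD₁ S s hs1.le
    have hup : c / (s - 1) ≤ Real.exp (∑ P ∈ G, x P + E.card + D₂ + 2 * D₁) := by
      refine (hcF.trans hS).trans (Real.exp_le_exp.2 ?_)
      rw [Finset.sum_add_distrib, ← Finset.mul_sum]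
      linarith
    have hT1 := exp_sum_le_of_sum_le hCs T
    have hT2 : Real.exp (∑ Q ∈ T, y Q) ≤ Real.exp D₃ * (C / (s - 1)) := by
      refine le_trans ?_ (mul_le_mul_of_nonneg_left hT1 (Real.exp_pos _).le)
      rw [← Real.exp_add, Finset.sum_sub_distrib]
      refine Real.exp_le_exp.2 ?_
      have := hD₃ T s hs1.le
      linarith
    have hpos : 0 < s - 1 := by linarith
    have hsquare : (c / (s - 1)) ^ 2 ≤ A / (s - 1) := by
      calc (c / (s - 1)) ^ 2 ≤ (Real.exp (∑ P ∈ G, x P + E.card + D₂ + 2 * D₁)) ^ 2 :=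
            pow_le_pow_left₀ (div_nonneg hc.le hpos.le) hup 2
        _ = Real.exp (2 * (D₂ + E.card + 2 * D₁)) * Real.exp (∑ Q ∈ T, y Q) := by
            rw [hsumT, ← Real.exp_add, ← Real.exp_nat_mul]; congr 1; push_cast; ring
        _ ≤ Real.exp (2 * (D₂ + E.card + 2 * D₁)) * (Real.exp D₃ * (C / (s - 1))) :=
            mul_le_mul_of_nonneg_left hT2 (Real.exp_pos _).le
        _ = A / (s - 1) := by rw [hA, Real.exp_add]; ring
    rw [div_pow, div_le_div_iff₀ (pow_pos hpos 2) hpos] at hsquare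
    rw [div_le_iff₀ hApos]
    nlinarith
  have hsmall : ∀ᶠ s : ℝ in 𝓝[>] 1, s < 1 + c ^ 2 / A :=
    eventually_nhdsWithin_of_eventually_nhds (eventually_lt_nhds (by
      have : 0 < c ^ 2 / A := div_pos (pow_pos hc 2) hApos
      linarith))
  obtain ⟨s, h1, h2⟩ := (key.and hsmall).exists
  linarith

/-- The kernel of the reduction of a `q`-adic embedding is a prime of norm `q`. -/
theorem exists_heightOneSpectrum_of_padicInt_hom {M : Type*} [Field M] [NumberField M] {q : ℕ}
    [Fact q.Prime] (ψ : 𝓞 M →+* ℤ_[q]) :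
    ∃ Q : HeightOneSpectrum (𝓞 M), Ideal.absNorm Q.asIdeal = q ∧
      ∀ x, x ∈ Q.asIdeal ↔ PadicInt.toZMod (ψ x) = 0 := by
  set φ : 𝓞 M →+* ZMod q := PadicInt.toZMod.comp ψ with hφ
  have hsurj : Function.Surjective φ := ZMod.ringHom_surjective φ
  have hnorm : Ideal.absNorm (RingHom.ker φ) = q := by
    rw [Ideal.absNorm_apply, Submodule.cardQuot_apply]
    exact (Nat.card_congr (RingHom.quotientKerEquivOfSurjective hsurj).toEquiv).trans
      (Nat.card_zmod q)
  have hne : RingHom.ker φ ≠ ⊥ := by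
    intro h
    rw [h, Ideal.absNorm_bot] at hnorm
    exact (Fact.out : q.Prime).ne_zero hnorm.symm
  exact ⟨⟨RingHom.ker φ, RingHom.ker_isPrime φ, hne⟩, hnorm, fun x => RingHom.mem_ker⟩

theorem exists_padic_embedding_not_isSquare_of_integer (K : Type*) [Field K] [NumberField K]
    {d : 𝓞 K} (hd : ¬IsSquare (d : K)) :
    ∃ (q : ℕ) (_ : Fact q.Prime) (σ : K →+* ℚ_[q]), ¬IsSquare (σ d) := by
  classical
  by_contra! hall
  have hirr : Irreducible (X ^ 2 - C (d : K)) := by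
    refine X_pow_sub_C_irreducible_of_prime Nat.prime_two fun b hb => hd ⟨b, ?_⟩
    rw [← hb, sq]
  have : Fact (Irreducible (X ^ 2 - C (d : K))) := ⟨hirr⟩
  let M := AdjoinRoot (X ^ 2 - C (d : K))
  have : FiniteDimensional K M :=
    (AdjoinRoot.powerBasis hirr.ne_zero).finite
  have : CharZero M := charZero_of_injective_algebraMap (algebraMap K M).injective
  have : FiniteDimensional ℚ M := FiniteDimensional.trans ℚ K M
  have : NumberField M := ⟨⟩
  set δ₀ : M := AdjoinRoot.root (X ^ 2 - C (d : K)) with hδ₀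
  have hδsq : δ₀ ^ 2 = algebraMap K M d := by
    have := AdjoinRoot.eval₂_root (X ^ 2 - C (d : K))
    rw [eval₂_sub, eval₂_X_pow, eval₂_C, sub_eq_zero] at this
    exact this
  have hδint : IsIntegral ℤ δ₀ := by
    refine IsIntegral.of_pow (n := 2) two_pos ?_
    rw [hδsq]
    exact map_isIntegral_int (algebraMap K M) d.isIntegral_coe
  set δ : 𝓞 M := ⟨δ₀, hδint⟩ with hδ
  have hd0 : d ≠ 0 := by
    rintro rfl
    exact hd ⟨0, by simp⟩
  obtain ⟨c, hc0, hc⟩ := exists_padic_embedding_of_prime_absNorm K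
  set e : 𝓞 K := c * (4 * d) with he
  have he0 : e ≠ 0 := mul_ne_zero hc0 (mul_ne_zero (by norm_num) hd0)
  have hfin := Ideal.finite_factors (I := Ideal.span {e}) (by
    rwa [Ne, Ideal.zero_eq_bot, Ideal.span_singleton_eq_bot])
  refine not_forall_two_primes_above (algebraMap (𝓞 K) (𝓞 M)) hfin.toFinset fun P hPE hPq => ?_
  have heP : e ∉ P.asIdeal := fun h => hPE (by
    rw [Set.Finite.mem_toFinset]
    exact Ideal.dvd_iff_le.2 ((Ideal.span_singleton_le_iff_mem _).2 h))
  have hcP : c ∉ P.asIdeal := fun h => heP (P.asIdeal.mul_mem_right _ h)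
  have h4P : 4 * d ∉ P.asIdeal := fun h => heP (P.asIdeal.mul_mem_left _ h)
  set q := Ideal.absNorm P.asIdeal with hq
  have : Fact q.Prime := ⟨hPq⟩
  obtain ⟨σ, ψ, hψ, hψP⟩ := hc P hcP q rfl
  obtain ⟨r, hr⟩ := hall q ‹_› σ
  have hker : ∀ x, PadicInt.toZMod (ψ x) = 0 ↔ x ∈ P.asIdeal := by
    have hmax : P.asIdeal.IsMaximal := P.isPrime.isMaximal P.ne_bot
    have heq := hmax.eq_of_le (RingHom.ker_ne_top (PadicInt.toZMod.comp ψ))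
      fun x hx => RingHom.mem_ker.2 (hψP x hx)
    intro x
    rw [heq, RingHom.mem_ker, RingHom.comp_apply]
  have hlift : ∀ u : ℚ_[q], u ^ 2 = σ d → ∃ (R : HeightOneSpectrum (𝓞 M))
      (χ : 𝓞 M →+* ℤ_[q]), (χ δ : ℚ_[q]) = u ∧ Ideal.absNorm R.asIdeal = q ∧
      R.asIdeal.comap (algebraMap (𝓞 K) (𝓞 M)) = P.asIdeal ∧
      ∀ x, x ∈ R.asIdeal ↔ PadicInt.toZMod (χ x) = 0 := by
    intro u hu
    set τ : M →+* ℚ_[q] := AdjoinRoot.lift σ u (by simp [hu]) with hτ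
    obtain ⟨χ, hχ⟩ := exists_padicInt_hom τ
    obtain ⟨R, hRq, hR⟩ := exists_heightOneSpectrum_of_padicInt_hom χ
    refine ⟨R, χ, ?_, hRq, ?_, hR⟩
    · rw [hχ]
      exact AdjoinRoot.lift_root _
    · ext x
      rw [Ideal.mem_comap, hR, ← hker]
      have : χ (algebraMap (𝓞 K) (𝓞 M) x) = ψ x := by
        apply PadicInt.ext
        rw [hχ, hψ]
        exact AdjoinRoot.lift_of _
      rw [this]
  obtain ⟨R, χ, hχδ, hRq, hRP, hR⟩ := hlift r (by rw [hr, sq])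
  obtain ⟨R', χ', hχδ', hRq', hRP', hR'⟩ := hlift (-r) (by rw [hr, sq, neg_mul_neg])
  have hne : R ≠ R' := by
    rintro rfl
    have hneg : χ' δ = -χ δ := by
      apply PadicInt.ext
      rw [hχδ', PadicInt.coe_neg, hχδ]
    obtain ⟨a, ha⟩ := ZMod.intCast_surjective (PadicInt.toZMod (χ δ))
    have h1 : δ - a ∈ R.asIdeal := by
      rw [hR, map_sub, map_sub, map_intCast, map_intCast, ha, sub_self]
    rw [hR', map_sub, map_sub, map_intCast, map_intCast, ha, hneg, map_neg] at h1
    have h2 : PadicInt.toZMod (ψ (4 * d)) = 0 := by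
      have h3 : ψ d = χ δ ^ 2 := by
        apply PadicInt.ext
        rw [hψ, PadicInt.coe_pow, hχδ, sq, hr]
      rw [map_mul, map_mul, h3, map_pow, map_ofNat, map_ofNat]
      linear_combination (-(2 : ZMod q) * PadicInt.toZMod (χ δ)) * h1
    exact h4P ((hker _).1 h2)
  refine ⟨{R, R'}, Finset.card_pair hne, fun Q hQ => ?_⟩
  rcases Finset.mem_insert.1 hQ with rfl | hQ
  · exact ⟨hRP, hRq⟩
  · rw [Finset.mem_singleton.1 hQ]
    exact ⟨hRP', hRq'⟩

/-- A nonsquare of a number field stays a nonsquare under some `q`-adic embedding. -/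
theorem exists_padic_embedding_not_isSquare (K : Type) [Field K] [NumberField K] {d : K}
    (hd : ¬IsSquare d) :
    ∃ (q : ℕ) (_ : Fact q.Prime) (σ : K →+* ℚ_[q]), ¬IsSquare (σ d) := by
  obtain ⟨a, b, hb, rfl⟩ := IsFractionRing.div_surjective (A := 𝓞 K) d
  have hb0 : algebraMap (𝓞 K) K b ≠ 0 :=
    IsFractionRing.to_map_ne_zero_of_mem_nonZeroDivisors hb
  have hsq : ¬IsSquare (algebraMap (𝓞 K) K (a * b)) := by
    rintro ⟨u, hu⟩
    refine hd ⟨u / algebraMap (𝓞 K) K b, ?_⟩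
    rw [map_mul] at hu
    field_simp
    rw [hu, sq]
  obtain ⟨q, hq, σ, hσ⟩ := exists_padic_embedding_not_isSquare_of_integer K hsq
  refine ⟨q, hq, σ, fun h => hσ ?_⟩
  obtain ⟨u, hu⟩ := h
  refine ⟨u * σ (algebraMap (𝓞 K) K b), ?_⟩
  have hσb : σ (algebraMap (𝓞 K) K b) ≠ 0 := (map_ne_zero σ).2 hb0
  change σ (algebraMap (𝓞 K) K (a * b)) = _
  rw [map_mul, map_mul, mul_mul_mul_comm, ← hu, map_div₀]
  field_simp

end SplitPrimes

section Global

open Polynomial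

theorem map_adjugate_apply {E F : Type*} [Field E] [Field F] (σ : E →+* F)
    (M : Matrix (Fin 3) (Fin 3) E) (i j : Fin 3) :
    (M.map σ).adjugate i j = σ (M.adjugate i j) := by
  have := RingHom.map_adjugate σ M
  rw [RingHom.mapMatrix_apply, RingHom.mapMatrix_apply] at this
  rw [← this]; rfl

theorem map_member {E F : Type*} [Field E] [CharZero E] [Field F] [CharZero F] (σ : E →+* F)
    (A B : Matrix (Fin 3) (Fin 3) ℚ) (t : E) :
    (t • A.map (algebraMap ℚ E) - B.map (algebraMap ℚ E)).map σ
      = σ t • A.map (algebraMap ℚ F) - B.map (algebraMap ℚ F) := by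
  ext i j; simp

theorem det_map_ne_zero {E F : Type*} [Field E] [Field F] (σ : E →+* F)
    {A : Matrix (Fin 3) (Fin 3) E} (hA : A.det ≠ 0) : (A.map σ).det ≠ 0 := by
  have := RingHom.map_det σ A
  rw [RingHom.mapMatrix_apply] at this
  rw [← this]
  simpa using hA

theorem detPoly_eq_of_roots {F : Type*} [Field F] {A B : Matrix (Fin 3) (Fin 3) F}
    (hA : A.det ≠ 0) {r : Fin 3 → F} (hr : Function.Injective r)
    (h : ∀ i, (detPoly A B).eval (r i) = 0) :
    detPoly A B = C A.det * ((X - C (r 0)) * (X - C (r 1)) * (X - C (r 2))) := by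
  have hm : ((X - C (r 0)) * (X - C (r 1)) * (X - C (r 2))).Monic :=
    ((monic_X_sub_C _).mul (monic_X_sub_C _)).mul (monic_X_sub_C _)
  have hdeg : ((X - C (r 0)) * (X - C (r 1)) * (X - C (r 2))).degree = 3 := by
    simp only [degree_mul, degree_X_sub_C]; norm_num
  have hAC : (C A.det).degree = 0 := degree_C hA
  rw [← sub_eq_zero]
  refine eq_zero_of_degree_lt_of_eval_index_eq_zero (s := Finset.univ) (v := r) hr.injOn
    ?_ fun i _ => ?_
  · have hd : (detPoly A B).degree = 3 := by
      rw [degree_eq_natDegree, natDegree_detPoly hA]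
      · rfl
      · intro h0
        have := natDegree_detPoly hA B
        rw [h0] at this
        simp at this
    have := degree_sub_lt_left (p := detPoly A B)
      (q := C A.det * ((X - C (r 0)) * (X - C (r 1)) * (X - C (r 2))))
      (by rw [degree_mul, hdeg, hAC, hd]; rfl) (by rintro h0; rw [h0] at hd; simp at hd)
      (by rw [leadingCoeff_detPoly hA, leadingCoeff_mul, hm.leadingCoeff, leadingCoeff_C, mul_one])
    rw [hd] at this
    simpa using this
  · rw [eval_sub, h, zero_sub, neg_eq_zero]
    fin_cases i <;> simp

/-- The rank one factor of a degenerate form `C` with `-adj C = w wᵀ`. -/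
theorem adjugate_add_cross_eq_zero {F : Type*} [Field F] {M : Matrix (Fin 3) (Fin 3) F}
    (hM : M.IsSymm) {w : Fin 3 → F} (hMw : M *ᵥ w = 0)
    (hw : ∀ j k, -M.adjugate j k = w j * w k) :
    (M + !![0, -w 2, w 1; w 2, 0, -w 0; -w 1, w 0, 0]).adjugate = 0 := by
  have h1 := hM.apply 0 1
  have h2 := hM.apply 0 2
  have h3 := hM.apply 1 2
  have c : ∀ i, M i 0 * w 0 + M i 1 * w 1 + M i 2 * w 2 = 0 := by
    intro i
    have := congrFun hMw i
    simpa [mulVec, dotProduct, Fin.sum_univ_three] using this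
  have c0 := c 0
  have c1 := c 1
  have c2 := c 2
  rw [h1] at c1
  rw [h2, h3] at c2
  ext j k
  have hjk := hw j k
  rw [adjugate_fin_three] at hjk ⊢
  fin_cases j <;> fin_cases k <;> simp [h1, h2, h3] at hjk ⊢ <;> grind

theorem exists_rational_zero_of_rank_one {K : Type*} [Field K] [NumberField K]
    (hdeg : Module.finrank ℚ K < 3) {M : Matrix (Fin 3) (Fin 3) K} (hM : M.IsSymm)
    {w : Fin 3 → K} (hMw : M *ᵥ w = 0)
    (hw : ∀ j k, -M.adjugate j k = w j * w k) :
    ∃ x : Fin 3 → ℚ, x ≠ 0 ∧ qv M (fun i => algebraMap ℚ K (x i)) = 0 := by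
  set R := M + !![0, -w 2, w 1; w 2, 0, -w 0; -w 1, w 0, 0] with hR
  have hadj : R.adjugate = 0 := adjugate_add_cross_eq_zero hM hMw hw
  have hq : ∀ x, qv M x = qv R x := by
    intro x
    rw [hR, qv_add]
    simp [qv, dotProduct, mulVec, Fin.sum_univ_three]
    ring
  obtain ⟨r, hr, hrow⟩ : ∃ r : Fin 3 → K, True ∧ ∀ x, r ⬝ᵥ x = 0 → R *ᵥ x = 0 := by
    by_cases h0 : R = 0
    · exact ⟨0, trivial, fun x _ => by simp [h0]⟩
    · obtain ⟨m, j, hmj⟩ : ∃ m j, R m j ≠ 0 := by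
        by_contra! h; exact h0 (by ext i j; exact h i j)
      refine ⟨R m, trivial, fun x hx => ?_⟩
      ext k
      apply mul_left_cancel₀ hmj
      have : R m j * (R *ᵥ x) k = R k j * (R m ⬝ᵥ x) := by
        rw [mulVec, dotProduct, dotProduct, Finset.mul_sum, Finset.mul_sum]
        refine Finset.sum_congr rfl fun l _ => ?_
        rw [← mul_assoc, mul_eq_mul_of_adjugate_eq_zero hadj m j k l]; ring
      rw [this, hx]; simp
  set f : (Fin 3 → ℚ) →ₗ[ℚ] K := Fintype.linearCombination ℚ r with hf
  have hker := LinearMap.ker_ne_bot_of_finrank_lt (f := f) (by simpa using hdeg)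
  obtain ⟨x, hx, hx0⟩ := (Submodule.ne_bot_iff _).1 hker
  refine ⟨x, hx0, ?_⟩
  rw [hq, qv, hrow, dotProduct_zero]
  rw [LinearMap.mem_ker, hf, Fintype.linearCombination_apply] at hx
  rw [← hx, dotProduct]
  exact Finset.sum_congr rfl fun i _ => by rw [Algebra.smul_def, mul_comm]

theorem exists_rational_common_zero_of_cubic {K : Type*} [Field K] [NumberField K]
    (hdeg : Module.finrank ℚ K = 3) {A B : Matrix (Fin 3) (Fin 3) ℚ} (hA : A.IsSymm)
    (hB : B.IsSymm) (hdA : A.det ≠ 0)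
    {t : K} (ht : ∀ σ τ : K →ₐ[ℚ] AlgebraicClosure ℚ, σ t = τ t → σ = τ)
    (hd : (t • A.map (algebraMap ℚ K) - B.map (algebraMap ℚ K)).det = 0)
    {w : Fin 3 → K} (hw : ∀ j k,
      -(t • A.map (algebraMap ℚ K) - B.map (algebraMap ℚ K)).adjugate j k = w j * w k) :
    ∃ x : Fin 3 → ℚ, x ≠ 0 ∧ qv A x = 0 ∧ qv B x = 0 := by
  set L := AlgebraicClosure ℚ
  set M := t • A.map (algebraMap ℚ K) - B.map (algebraMap ℚ K) with hM
  have hcard : Fintype.card (K →ₐ[ℚ] L) = 3 := by rw [AlgHom.card, hdeg]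
  have e : Fin 3 ≃ (K →ₐ[ℚ] L) := (Fintype.equivFinOfCardEq hcard).symm
  set r : Fin 3 → L := fun i => e i t with hr
  have hrinj : Function.Injective r := fun i j hij => e.injective (ht _ _ hij)
  have hmem : ∀ i, r i • A.map (algebraMap ℚ L) - B.map (algebraMap ℚ L)
      = M.map (e i : K →+* L) := fun i => (map_member (e i : K →+* L) A B t).symm
  have hroot : ∀ i, (detPoly (A.map (algebraMap ℚ L)) (B.map (algebraMap ℚ L))).eval (r i) = 0 := by
    intro i
    rw [detPoly_eval, hmem]
    have := RingHom.map_det (e i : K →+* L) M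
    rw [RingHom.mapMatrix_apply] at this
    rw [← this, hd, map_zero]
  set T : K := (M.adjugate * A.map (algebraMap ℚ K)).trace with hT
  have hTi : ∀ i, ((r i • A.map (algebraMap ℚ L) - B.map (algebraMap ℚ L)).adjugate *
      A.map (algebraMap ℚ L)).trace = e i T := by
    intro i
    rw [hmem, hT]
    simp only [trace_fin_three, mul_apply, Fin.sum_univ_three, map_adjugate_apply, map_add,
      map_mul]
    simp
  obtain ⟨h0, h1, h2⟩ := common_zero_of_rank_one (A := A.map (algebraMap ℚ L))
    (B := B.map (algebraMap ℚ L)) (hA.map _) (hB.map _) (det_map_ne_zero _ hdA) hrinj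
    (detPoly_eq_of_roots (det_map_ne_zero _ hdA) hrinj hroot)
    (w := fun i j => e i (w j)) (fun i j k => by
      rw [hmem, map_adjugate_apply, ← map_neg, hw]; simp) (x := fun j =>
        algebraMap ℚ L (Algebra.trace ℚ K (T⁻¹ * w j))) (by
      ext j
      rw [trace_eq_sum_embeddings L, ← Equiv.sum_comp e, Finset.sum_apply]
      refine Finset.sum_congr rfl fun i _ => ?_
      rw [hTi]; simp)
  rw [qv_map, map_eq_zero] at h1 h2
  refine ⟨_, fun h => h0 ?_, h1, h2⟩
  ext j
  have := congrFun h j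
  simp [this]

/-- An irreducible factor of degree at least two of one discriminant cubic divides the other. -/
theorem irreducible_factor_dvd {A₁ B₁ A₂ B₂ : Matrix (Fin 3) (Fin 3) ℚ}
    (hA₁ : A₁.IsSymm) (hB₁ : B₁.IsSymm) (hA₂ : A₂.IsSymm) (hB₂ : B₂.IsSymm)
    (hd₂ : A₂.det ≠ 0) (hs₂ : (detPoly A₂ B₂).Separable)
    (h₁₂ : ∀ x, x ≠ 0 → ∃ y, qv A₁ x = qv A₂ y ∧ qv B₁ x = qv B₂ y)
    (h₂₁ : ∀ x, x ≠ 0 → ∃ y, qv A₂ x = qv A₁ y ∧ qv B₂ x = qv B₁ y)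
    (han : ∀ x, qv A₂ x = 0 → qv B₂ x = 0 → x = 0)
    {P : ℚ[X]} (hP : Irreducible P) (hPd : P ∣ detPoly A₂ B₂) (hP2 : 2 ≤ P.natDegree) :
    P ∣ detPoly A₁ B₁ := by
  have : Fact (Irreducible P) := ⟨hP⟩
  have hfin : Module.finrank ℚ (AdjoinRoot P) = P.natDegree := by
    rw [(AdjoinRoot.powerBasis hP.ne_zero).finrank, AdjoinRoot.powerBasis_dim]
  have : FiniteDimensional ℚ (AdjoinRoot P) := (AdjoinRoot.powerBasis hP.ne_zero).finite
  have : CharZero (AdjoinRoot P) := algebraRat.charZero _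
  have : NumberField (AdjoinRoot P) := ⟨⟩
  set K := AdjoinRoot P
  set t : K := AdjoinRoot.root P with ht
  have hroot : ∀ Q : ℚ[X], aeval t Q = 0 ↔ P ∣ Q := fun Q => by
    rw [← AdjoinRoot.mk_eq_zero, ← AdjoinRoot.aeval_eq, ht, aeval_def, aeval_def,
      Subsingleton.elim (algebraMap ℚ K) (AdjoinRoot.of P)]
    rfl
  have hev : ∀ A B : Matrix (Fin 3) (Fin 3) ℚ, ∀ {E : Type} [Field E] [CharZero E] (s : E),
      (s • A.map (algebraMap ℚ E) - B.map (algebraMap ℚ E)).det = aeval s (detPoly A B) := by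
    intro A B E _ _ s
    rw [← detPoly_eval, ← detPoly_map, eval_map_algebraMap]
  set M := t • A₂.map (algebraMap ℚ K) - B₂.map (algebraMap ℚ K) with hM
  have hMs : M.IsSymm := ((hA₂.map _).smul t).sub (hB₂.map _)
  have hMd : M.det = 0 := by rw [hM, hev, hroot]; exact hPd
  have hsep : ∀ {E : Type} [Field E] [CharZero E], (detPoly (A₂.map (algebraMap ℚ E))
      (B₂.map (algebraMap ℚ E))).Separable := by
    intro E _ _
    rw [← detPoly_map]; exact hs₂.map
  have hadj : M.adjugate ≠ 0 := adjugate_ne_zero_of_separable hsep t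
  obtain ⟨i, hi⟩ := exists_adjugate_diag_ne_zero hMs hMd hadj
  by_cases hsq : IsSquare (-M.adjugate i i)
  · exfalso
    obtain ⟨w, hw⟩ := exists_rank_one_of_sq hMs hMd hi hsq
    have hle : P.natDegree ≤ 3 := by
      rw [← natDegree_detPoly hd₂ B₂]
      exact natDegree_le_of_dvd hPd hs₂.ne_zero
    rcases (show P.natDegree = 2 ∨ P.natDegree = 3 by omega) with h2 | h3
    · obtain ⟨x, hx0, hx⟩ := exists_rational_zero_of_rank_one (by rw [hfin, h2]; norm_num) hMs
        (mulVec_eq_zero_of_rank_one hMd hadj hw) hw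
      rw [hM, qv_sub, qv_smul, qv_map, qv_map] at hx
      have hxA : qv A₂ x = 0 := by
        by_contra hne
        have htq : t = algebraMap ℚ K (qv B₂ x / qv A₂ x) := by
          rw [map_div₀, eq_div_iff (by simpa using hne)]
          exact sub_eq_zero.1 hx
        have hPt := (hroot P).2 dvd_rfl
        rw [htq, aeval_algebraMap_apply, map_eq_zero] at hPt
        have h1 : P.natDegree = 1 := natDegree_eq_of_degree_eq_some
          (degree_eq_one_of_irreducible_of_root hP (x := qv B₂ x / qv A₂ x) hPt)
        omega
      have hxB : qv B₂ x = 0 := by simpa [hxA] using hx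
      exact hx0 (han x hxA hxB)
    · obtain ⟨x, hx0, hxA, hxB⟩ := exists_rational_common_zero_of_cubic (by rw [hfin, h3]) hA₂ hB₂
        hd₂ (t := t) (fun σ τ h => AdjoinRoot.algHom_ext h) hMd hw
      exact hx0 (han x hxA hxB)
  · obtain ⟨q, hq, σ, hσ⟩ := exists_padic_embedding_not_isSquare K hsq
    have hmem : M.map σ = σ t • A₂.map (algebraMap ℚ ℚ_[q]) - B₂.map (algebraMap ℚ ℚ_[q]) :=
      map_member σ A₂ B₂ t
    set N₁ := σ t • A₁.map (algebraMap ℚ ℚ_[q]) - B₁.map (algebraMap ℚ ℚ_[q]) with hN₁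
    set N₂ := σ t • A₂.map (algebraMap ℚ ℚ_[q]) - B₂.map (algebraMap ℚ ℚ_[q]) with hN₂
    have hN₁s : N₁.IsSymm := ((hA₁.map _).smul _).sub (hB₁.map _)
    have hN₂s : N₂.IsSymm := ((hA₂.map _).smul _).sub (hB₂.map _)
    have hN₂d : N₂.det = 0 := by
      have := RingHom.map_det σ M
      rw [RingHom.mapMatrix_apply, hmem] at this
      rw [← this, hMd, map_zero]
    have hval : ∀ e, e ≠ 0 → ((∃ x, qv N₂ x = e) ↔ ∃ x, qv N₁ x = e) := by
      intro e he
      have k₁ := exists_value_of_rational h₁₂ (σ t) 1 he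
      have k₂ := exists_value_of_rational h₂₁ (σ t) 1 he
      rw [one_smul, one_smul] at k₁ k₂
      exact ⟨k₂, k₁⟩
    have hN₁d : N₁.det = 0 := by
      by_contra hne
      obtain ⟨x, hx0, hx⟩ := exists_mulVec_eq_zero_iff.2 hN₂d
      obtain ⟨y, hy0, hy⟩ := isotropic_of_same_values hN₂s hN₁s
        (adjugate_ne_zero_of_separable hsep (σ t)) hval ⟨x, hx0, by simp [qv, hx]⟩
      have hu : ∀ e, e ≠ 0 → ∃ x, qv N₂ x = e := fun e he => (hval e he).2
        (universal_of_zero hN₁s hy (fun h => hne (exists_mulVec_eq_zero_iff.1 ⟨y, hy0, h⟩)) e)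
      have hadjσ : N₂.adjugate i i = σ (M.adjugate i i) := by
        rw [← hmem, map_adjugate_apply]
      apply hσ
      rw [map_neg, ← hadjσ]
      refine isSquare_of_universal hN₂s hN₂d ?_ hu
      rw [hadjσ]; simpa using hi
    rw [hN₁, hev] at hN₁d
    rw [← hroot]
    have : σ (aeval t (detPoly A₁ B₁)) = aeval (σ t) (detPoly A₁ B₁) := by
      rw [aeval_def, hom_eval₂, aeval_def]
      congr 1
      exact Subsingleton.elim _ _
    rw [hN₁d] at this
    simpa using this

theorem splits_of_irreducible_factors {F E : Type*} [Field F] [Field E] (f : F →+* E) {D : F[X]}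
    (h : ∀ P, Irreducible P → P ∣ D → (P.map f).Splits) : (D.map f).Splits := by
  by_cases h0 : D = 0
  · simp [h0]
  induction D using WfDvdMonoid.induction_on_irreducible with
  | zero => exact absurd rfl h0
  | unit u hu => exact Splits.of_natDegree_le_one (by
      rw [natDegree_map, natDegree_eq_zero_of_isUnit hu]; norm_num)
  | mul a i ha hi ih =>
    rw [Polynomial.map_mul]
    exact (h i hi (dvd_mul_right _ _)).mul (ih (fun P hP hPa => h P hP (hPa.mul_left _)) ha)

theorem splits_transfer {p : ℕ} [Fact p.Prime] {A₁ B₁ A₂ B₂ : Matrix (Fin 3) (Fin 3) ℚ}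
    (hA₁ : A₁.IsSymm) (hB₁ : B₁.IsSymm) (hA₂ : A₂.IsSymm) (hB₂ : B₂.IsSymm)
    (hd₁ : A₁.det ≠ 0) (hd₂ : A₂.det ≠ 0) (hs₂ : (detPoly A₂ B₂).Separable)
    (h₁₂ : ∀ x, x ≠ 0 → ∃ y, qv A₁ x = qv A₂ y ∧ qv B₁ x = qv B₂ y)
    (h₂₁ : ∀ x, x ≠ 0 → ∃ y, qv A₂ x = qv A₁ y ∧ qv B₂ x = qv B₁ y)
    (han : ∀ x, qv A₂ x = 0 → qv B₂ x = 0 → x = 0)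
    (hsp : ((detPoly A₁ B₁).map (algebraMap ℚ ℚ_[p])).Splits) :
    ((detPoly A₂ B₂).map (algebraMap ℚ ℚ_[p])).Splits := by
  refine splits_of_irreducible_factors _ fun P hP hPd => ?_
  by_cases hP1 : P.natDegree ≤ 1
  · exact Splits.of_natDegree_le_one (by rwa [natDegree_map])
  · have := irreducible_factor_dvd hA₁ hB₁ hA₂ hB₂ hd₂ hs₂ h₁₂ h₂₁ han hP hPd (by omega)
    refine hsp.of_dvd ?_ (Polynomial.map_dvd _ this)
    rw [Polynomial.map_ne_zero_iff (algebraMap ℚ ℚ_[p]).injective]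
    intro h0
    have := natDegree_detPoly hd₁ B₁
    rw [h0] at this
    simp at this

/-- A common zero over `ℚ_p` transfers between pencils with the same rational representations. -/
theorem common_zero_transfer {p : ℕ} [Fact p.Prime] {A₁ B₁ A₂ B₂ : Matrix (Fin 3) (Fin 3) ℚ}
    (hA₁ : A₁.IsSymm) (hB₁ : B₁.IsSymm) (hA₂ : A₂.IsSymm) (hB₂ : B₂.IsSymm)
    (hd₂ : A₂.det ≠ 0) (hs₁ : (detPoly A₁ B₁).Separable) (hs₂ : (detPoly A₂ B₂).Separable)
    (h₁₂ : ∀ x, x ≠ 0 → ∃ y, qv A₁ x = qv A₂ y ∧ qv B₁ x = qv B₂ y)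
    (hsp : ((detPoly A₂ B₂).map (algebraMap ℚ ℚ_[p])).Splits)
    (hz : ∃ x, x ≠ 0 ∧ qv (A₁.map (algebraMap ℚ ℚ_[p])) x = 0 ∧
      qv (B₁.map (algebraMap ℚ ℚ_[p])) x = 0) :
    ∃ x, x ≠ 0 ∧ qv (A₂.map (algebraMap ℚ ℚ_[p])) x = 0 ∧
      qv (B₂.map (algebraMap ℚ ℚ_[p])) x = 0 := by
  classical
  obtain ⟨x₀, hx0, hxA, hxB⟩ := hz
  have hs₁' := hs₁.map (f := algebraMap ℚ ℚ_[p])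
  have hs₂' := hs₂.map (f := algebraMap ℚ ℚ_[p])
  rw [detPoly_map] at hs₁' hs₂' hsp
  set A := A₂.map (algebraMap ℚ ℚ_[p]) with hA
  set B := B₂.map (algebraMap ℚ ℚ_[p]) with hB
  have hdA : A.det ≠ 0 := det_map_ne_zero _ hd₂
  have hcard : Fintype.card (detPoly A B).roots.toFinset = 3 := by
    rw [Fintype.card_coe, Multiset.toFinset_card_of_nodup (nodup_roots hs₂'),
      ← hsp.natDegree_eq_card_roots, natDegree_detPoly hdA]
  have e : Fin 3 ≃ (detPoly A B).roots.toFinset := (Fintype.equivFinOfCardEq hcard).symm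
  set r : Fin 3 → ℚ_[p] := fun i => e i with hr
  have hrinj : Function.Injective r := fun i j h => e.injective (Subtype.ext h)
  have hroot : ∀ i, (detPoly A B).eval (r i) = 0 := fun i =>
    isRoot_of_mem_roots (Multiset.mem_toFinset.1 (e i).2)
  have hw : ∀ i, ∃ w : Fin 3 → ℚ_[p], ∀ j k, -(r i • A - B).adjugate j k = w j * w k := by
    intro i
    have hM : (r i • A - B).IsSymm := ((hA₂.map _).smul _).sub (hB₂.map _)
    have hMd : (r i • A - B).det = 0 := by rw [← detPoly_eval, hroot]
    obtain ⟨m, hm⟩ := exists_adjugate_diag_ne_zero hM hMd (adjugate_ne_zero_of_separable hs₂' (r i))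
    refine exists_rank_one_of_sq hM hMd hm (isSquare_of_universal hM hMd hm fun e he => ?_)
    have k := exists_value_of_rational h₁₂ (r i) 1 he
    rw [one_smul, one_smul] at k
    exact k (member_universal (hA₁.map _) (hB₁.map _) hs₁' hx0 hxA hxB (r i) e)
  choose w hw using hw
  exact ⟨_, common_zero_of_rank_one (hA₂.map _) (hB₂.map _) hdA hrinj
    (detPoly_eq_of_roots hdA hrinj hroot) hw rfl⟩

end Global

section Assembly

open Polynomial

theorem exists_rat_shift {L : Type*} [Field L] [CharZero L] {ι : Type*} [Finite ι]
    (l : ι → L × L) (hl : ∀ i, (l i).1 ≠ 0 ∨ (l i).2 ≠ 0) :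
    ∃ k : ℚ, ∀ i, (l i).1 + (k : L) * (l i).2 ≠ 0 := by
  have hfin : (⋃ i, {k : ℚ | (l i).1 + (k : L) * (l i).2 = 0}).Finite := by
    refine Set.finite_iUnion fun i => Set.Subsingleton.finite fun k hk k' hk' => ?_
    simp only [Set.mem_ofPred_eq] at hk hk'
    have h2 : (l i).2 ≠ 0 := by
      intro h
      rw [h, mul_zero, add_zero] at hk
      exact (hl i).elim (fun h1 => h1 hk) fun h2 => h2 h
    have : (k : L) * (l i).2 = k' * (l i).2 := by
      rw [← add_right_inj (l i).1, hk, hk']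
    exact_mod_cast mul_right_cancel₀ h2 this
  obtain ⟨k, hk⟩ := hfin.exists_notMem
  refine ⟨k, fun i hi => hk (Set.mem_iUnion.2 ⟨i, hi⟩)⟩

theorem detPoly_shift {F : Type*} [Field F] [Infinite F] {A B : Matrix (Fin 3) (Fin 3) F}
    {l : Fin 3 → F × F}
    (h : ∀ x y : F, (x • A - y • B).det = ∏ i, ((l i).1 * x - (l i).2 * y)) (k : F) :
    detPoly (A + k • B) B = ∏ i, (C ((l i).1 + k * (l i).2) * X - C (l i).2) := by
  refine Polynomial.funext fun t => ?_
  rw [detPoly_eval, eval_prod]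
  have : t • (A + k • B) - B = t • A - (1 - k * t) • B := by
    rw [smul_add, sub_smul, one_smul, smul_smul, mul_comm t k]; abel
  rw [this, h]
  refine Finset.prod_congr rfl fun i _ => ?_
  simp
  ring

theorem separable_prod_linear {F : Type*} [Field F] {ι : Type*} [Fintype ι] {a b : ι → F}
    (ha : ∀ i, a i ≠ 0) (hab : ∀ i j, i ≠ j → a i * b j - a j * b i ≠ 0) :
    (∏ i, (C (a i) * X - C (b i))).Separable := by
  refine separable_prod (fun i j hij => ?_) fun i => ?_
  · refine ⟨C (-(a j) / (a i * b j - a j * b i)) * -1, C (-(a i) / (a i * b j - a j * b i)), ?_⟩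
    have h := hab i j hij
    have h1 : C (-(a j) / (a i * b j - a j * b i)) * -1 * (C (a i) * X - C (b i)) +
        C (-(a i) / (a i * b j - a j * b i)) * (C (a j) * X - C (b j))
        = C ((a i * b j - a j * b i) / (a i * b j - a j * b i)) := by
      simp only [div_eq_mul_inv, C_mul, C_neg, C_sub]
      ring
    rw [h1, div_self h, C_1]
  · refine ⟨0, C (a i)⁻¹, ?_⟩
    have : derivative (C (a i) * X - C (b i)) = C (a i) := by simp
    rw [this, zero_mul, zero_add, ← C_mul, inv_mul_cancel₀ (ha i), C_1]

theorem det_ne_zero_and_separable_of_shift {A B : Matrix (Fin 3) (Fin 3) ℚ} {L : Type*} [Field L]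
    [CharZero L] {l : Fin 3 → L × L}
    (h : ∀ x y : L, (x • A.map (algebraMap ℚ L) - y • B.map (algebraMap ℚ L)).det
      = ∏ i, ((l i).1 * x - (l i).2 * y))
    (hl : ∀ i j, i ≠ j → (l i).1 * (l j).2 ≠ (l i).2 * (l j).1) {k : ℚ}
    (hk : ∀ i, (l i).1 + (k : L) * (l i).2 ≠ 0) :
    (A + k • B).det ≠ 0 ∧ (detPoly (A + k • B) B).Separable := by
  have hmap : (A + k • B).map (algebraMap ℚ L)
      = A.map (algebraMap ℚ L) + (k : L) • B.map (algebraMap ℚ L) := by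
    ext i j; simp
  constructor
  · intro h0
    have h1 := RingHom.map_det (algebraMap ℚ L) (A + k • B)
    rw [RingHom.mapMatrix_apply, hmap, h0, map_zero] at h1
    have h2 := h 1 (-k)
    rw [one_smul, neg_smul, sub_neg_eq_add, ← h1] at h2
    refine Finset.prod_ne_zero_iff.2 (fun i _ => ?_) h2.symm
    convert hk i using 1
    ring
  · rw [← separable_map (algebraMap ℚ L), detPoly_map, hmap, detPoly_shift h]
    refine separable_prod_linear hk fun i j hij => ?_
    convert sub_ne_zero.2 (hl i j hij) using 1
    ring

theorem exists_same_values_of_simRepQ {A₁ B₁ A₂ B₂ : Matrix (Fin 3) (Fin 3) ℚ}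
    (hrep : simRepQ A₁ B₁ = simRepQ A₂ B₂) (k : ℚ) (x : Fin 3 → ℚ) (hx : x ≠ 0) :
    ∃ y, qv (A₁ + k • B₁) x = qv (A₂ + k • B₂) y ∧ qv B₁ x = qv B₂ y := by
  have : (qv A₁ x, qv B₁ x) ∈ simRepQ A₂ B₂ := hrep ▸ ⟨x, hx, rfl, rfl⟩
  obtain ⟨y, -, hA, hB⟩ := this
  refine ⟨y, ?_, hB.symm⟩
  rw [qv_add, qv_add, qv_smul, qv_smul]
  change qv A₂ y = qv A₁ x at hA
  change qv B₂ y = qv B₁ x at hB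
  rw [hA, hB]

theorem qv_add_smul_eq_zero_iff {F : Type*} [Field F] (A B : Matrix (Fin 3) (Fin 3) F) (k : F)
    (x : Fin 3 → F) : (qv (A + k • B) x = 0 ∧ qv B x = 0) ↔ (qv A x = 0 ∧ qv B x = 0) := by
  rw [qv_add, qv_smul]
  constructor <;> rintro ⟨h1, h2⟩ <;> simp_all

theorem adjugate_member_ne_zero {F : Type*} [Field F] {A B : Matrix (Fin 3) (Fin 3) F}
    (hA : A.det ≠ 0) (hs : (detPoly A B).Separable) {a b : F} (hab : a ≠ 0 ∨ b ≠ 0) :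
    (a • A - b • B).adjugate ≠ 0 := by
  by_cases hb : b = 0
  · have ha : a ≠ 0 := hab.resolve_right (not_not.2 hb)
    intro h
    have := mul_adjugate (a • A - b • B)
    rw [h, mul_zero, hb, zero_smul, sub_zero, det_smul] at this
    have h00 := congrFun (congrFun this 0) 0
    simp [ha, hA] at h00
  · have : a • A - b • B = b • ((a / b) • A - B) := by
      rw [smul_sub, smul_smul, mul_div_cancel₀ _ hb]
    rw [this, adjugate_smul]
    exact smul_ne_zero (pow_ne_zero _ hb) (adjugate_ne_zero_of_separable hs _)

/-- Over `ℚ_p`, a member of the first pencil takes only values taken by the same member of the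
second one. -/
theorem exists_ne_zero_value {p : ℕ} [Fact p.Prime] {A₁ B₁ A₂ B₂ : Matrix (Fin 3) (Fin 3) ℚ}
    (hA₁ : A₁.IsSymm) (hB₁ : B₁.IsSymm) (hA₂ : A₂.IsSymm) (hB₂ : B₂.IsSymm)
    (hd₁ : A₁.det ≠ 0) (hs₁ : (detPoly A₁ B₁).Separable)
    (h₁₂ : ∀ x, x ≠ 0 → ∃ y, qv A₁ x = qv A₂ y ∧ qv B₁ x = qv B₂ y)
    (h₂₁ : ∀ x, x ≠ 0 → ∃ y, qv A₂ x = qv A₁ y ∧ qv B₂ x = qv B₁ y)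
    {a b : ℚ_[p]} (hab : a ≠ 0 ∨ b ≠ 0) (e : ℚ_[p])
    (h : ∃ x, x ≠ 0 ∧
      qv (a • A₁.map (algebraMap ℚ ℚ_[p]) - b • B₁.map (algebraMap ℚ ℚ_[p])) x = e) :
    ∃ x, x ≠ 0 ∧
      qv (a • A₂.map (algebraMap ℚ ℚ_[p]) - b • B₂.map (algebraMap ℚ ℚ_[p])) x = e := by
  by_cases he : e = 0
  · subst he
    refine isotropic_of_same_values (((hA₁.map _).smul _).sub ((hB₁.map _).smul _))
      (((hA₂.map _).smul _).sub ((hB₂.map _).smul _)) ?_ (fun e he => ?_) h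
    · refine adjugate_member_ne_zero (det_map_ne_zero _ hd₁) ?_ hab
      rw [← detPoly_map]; exact hs₁.map
    · exact ⟨exists_value_of_rational h₁₂ a b he, exists_value_of_rational h₂₁ a b he⟩
  · obtain ⟨x, -, hx⟩ := h
    obtain ⟨y, hy⟩ := exists_value_of_rational h₁₂ a b he ⟨x, hx⟩
    refine ⟨y, ?_, hy⟩
    rintro rfl
    exact he (hy.symm.trans (qv_zero_vec _))

end Assembly

theorem stmt_4 (p : ℕ) [Fact p.Prime]
    (A₁ B₁ A₂ B₂ : Matrix (Fin 3) (Fin 3) ℚ)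
    (hsA₁ : A₁.IsSymm) (hsB₁ : B₁.IsSymm) (hsA₂ : A₂.IsSymm) (hsB₂ : B₂.IsSymm)
    -- linear independence over ℚ
    (hli₁ : ∀ a b : ℚ, a • A₁ + b • B₁ = 0 → a = 0 ∧ b = 0)
    (hli₂ : ∀ a b : ℚ, a • A₂ + b • B₂ = 0 → a = 0 ∧ b = 0)
    -- non-singular and anisotropic over ℚ
    (hns₁ : (((MvPolynomial.X 0 : MvPolynomial (Fin 2) ℚ) • A₁.map MvPolynomial.C
        - (MvPolynomial.X 1 : MvPolynomial (Fin 2) ℚ) • B₁.map MvPolynomial.C :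
          Matrix (Fin 3) (Fin 3) (MvPolynomial (Fin 2) ℚ))).det ≠ 0)
    (hns₂ : (((MvPolynomial.X 0 : MvPolynomial (Fin 2) ℚ) • A₂.map MvPolynomial.C
        - (MvPolynomial.X 1 : MvPolynomial (Fin 2) ℚ) • B₂.map MvPolynomial.C :
          Matrix (Fin 3) (Fin 3) (MvPolynomial (Fin 2) ℚ))).det ≠ 0)
    (han₁ : ∀ x : Fin 3 → ℚ, x ⬝ᵥ (A₁ *ᵥ x) = 0 → x ⬝ᵥ (B₁ *ᵥ x) = 0 → x = 0)
    (han₂ : ∀ x : Fin 3 → ℚ, x ⬝ᵥ (A₂ *ᵥ x) = 0 → x ⬝ᵥ (B₂ *ᵥ x) = 0 → x = 0)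
    -- no repeated linear factor over an algebraic closure of ℚ
    (hsq₁ : SplitsDistinctly (A₁.map (algebraMap ℚ (AlgebraicClosure ℚ)))
        (B₁.map (algebraMap ℚ (AlgebraicClosure ℚ))))
    (hsq₂ : SplitsDistinctly (A₂.map (algebraMap ℚ (AlgebraicClosure ℚ)))
        (B₂.map (algebraMap ℚ (AlgebraicClosure ℚ))))
    -- equal simultaneous rational representations
    (hrep : simRepQ A₁ B₁ = simRepQ A₂ B₂)
    -- `det (A₁·X − B₁·Y)` splits completely into linear factors over ℚ_p
    (hsplit : SplitsCompletely (A₁.map (algebraMap ℚ ℚ_[p]))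
        (B₁.map (algebraMap ℚ ℚ_[p]))) :
    (∀ π : ℚ_[p],
      {q : ℚ_[p] | ∃ x : Fin 3 → ℚ_[p], x ≠ 0 ∧
          x ⬝ᵥ ((π • A₁.map (algebraMap ℚ ℚ_[p]) - B₁.map (algebraMap ℚ ℚ_[p])) *ᵥ x) = q}
      = {q : ℚ_[p] | ∃ x : Fin 3 → ℚ_[p], x ≠ 0 ∧
          x ⬝ᵥ ((π • A₂.map (algebraMap ℚ ℚ_[p]) - B₂.map (algebraMap ℚ ℚ_[p])) *ᵥ x) = q}) ∧
    ((∃ x : Fin 3 → ℚ_[p], x ≠ 0 ∧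
        x ⬝ᵥ ((A₁.map (algebraMap ℚ ℚ_[p])) *ᵥ x) = 0 ∧
        x ⬝ᵥ ((B₁.map (algebraMap ℚ ℚ_[p])) *ᵥ x) = 0) ↔
      (∃ x : Fin 3 → ℚ_[p], x ≠ 0 ∧
        x ⬝ᵥ ((A₂.map (algebraMap ℚ ℚ_[p])) *ᵥ x) = 0 ∧
        x ⬝ᵥ ((B₂.map (algebraMap ℚ ℚ_[p])) *ᵥ x) = 0)) := by
  obtain ⟨l₁, hl₁, hne₁⟩ := hsq₁
  obtain ⟨l₂, hl₂, hne₂⟩ := hsq₂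
  have hnz : ∀ l : Fin 3 → AlgebraicClosure ℚ × AlgebraicClosure ℚ,
      (∀ i j, i ≠ j → (l i).1 * (l j).2 ≠ (l i).2 * (l j).1) →
      ∀ i, (l i).1 ≠ 0 ∨ (l i).2 ≠ 0 := by
    intro l hl i
    obtain ⟨j, hj⟩ := exists_ne i
    by_contra! h
    exact hl i j hj.symm (by rw [h.1, h.2, zero_mul, zero_mul])
  obtain ⟨k, hk⟩ := exists_rat_shift (Sum.elim l₁ l₂)
    (by rintro (i | i); exacts [hnz l₁ hne₁ i, hnz l₂ hne₂ i])
  obtain ⟨hd₁, hs₁⟩ := det_ne_zero_and_separable_of_shift hl₁ hne₁ fun i => hk (Sum.inl i)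
  obtain ⟨hd₂, hs₂⟩ := det_ne_zero_and_separable_of_shift hl₂ hne₂ fun i => hk (Sum.inr i)
  have h₁₂ := exists_same_values_of_simRepQ hrep k
  have h₂₁ := exists_same_values_of_simRepQ hrep.symm k
  have hA₁ : (A₁ + k • B₁).IsSymm := hsA₁.add (hsB₁.smul k)
  have hA₂ : (A₂ + k • B₂).IsSymm := hsA₂.add (hsB₂.smul k)
  have hmap : ∀ A B : Matrix (Fin 3) (Fin 3) ℚ, (A + k • B).map (algebraMap ℚ ℚ_[p])
      = A.map (algebraMap ℚ ℚ_[p]) + (k : ℚ_[p]) • B.map (algebraMap ℚ ℚ_[p]) := by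
    intro A B; ext i j; simp
  have hsp₁ : ((detPoly (A₁ + k • B₁) B₁).map (algebraMap ℚ ℚ_[p])).Splits := by
    obtain ⟨l, hl⟩ := hsplit
    rw [detPoly_map, hmap, detPoly_shift hl]
    exact Polynomial.Splits.prod fun i _ =>
      Polynomial.Splits.of_natDegree_le_one (by compute_degree)
  have han₂' : ∀ x, qv (A₂ + k • B₂) x = 0 → qv B₂ x = 0 → x = 0 := fun x h1 h2 =>
    have h := (qv_add_smul_eq_zero_iff A₂ B₂ k x).1 ⟨h1, h2⟩
    han₂ x h.1 h.2
  have hsp₂ := splits_transfer hA₁ hsB₁ hA₂ hsB₂ hd₁ hd₂ hs₂ h₁₂ h₂₁ han₂' hsp₁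
  refine ⟨fun π => ?_, ?_⟩
  · have hπ : ∀ A B : Matrix (Fin 3) (Fin 3) ℚ,
        π • A.map (algebraMap ℚ ℚ_[p]) - B.map (algebraMap ℚ ℚ_[p])
          = π • (A + k • B).map (algebraMap ℚ ℚ_[p])
            - (1 + k * π) • B.map (algebraMap ℚ ℚ_[p]) := by
      intro A B
      rw [hmap, smul_add, add_smul, one_smul, smul_smul, mul_comm π]
      abel
    have hab : π ≠ 0 ∨ 1 + (k : ℚ_[p]) * π ≠ 0 := by
      by_contra! h
      simp [h.1] at h
    rw [hπ A₁ B₁, hπ A₂ B₂]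
    ext e
    exact ⟨exists_ne_zero_value hA₁ hsB₁ hA₂ hsB₂ hd₁ hs₁ h₁₂ h₂₁ hab e,
      exists_ne_zero_value hA₂ hsB₂ hA₁ hsB₁ hd₂ hs₂ h₂₁ h₁₂ hab e⟩
  · have t₁₂ := common_zero_transfer hA₁ hsB₁ hA₂ hsB₂ hd₂ hs₁ hs₂ h₁₂ hsp₂
    have t₂₁ := common_zero_transfer hA₂ hsB₂ hA₁ hsB₁ hd₁ hs₂ hs₁ h₂₁ hsp₁
    simp only [hmap, qv_add_smul_eq_zero_iff] at t₁₂ t₂₁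
    exact ⟨t₁₂, t₂₁⟩
end

section
/- Let k be a field of characteristic ≠ 2, 3, and let A, B be symmetric 3×3 matrices over k such that the pair (A,B) is non-singular and anisotropic over k. Then there exists a vector h ∈ k³ with det( (hᵀBh)·A − (hᵀAh)·B ) ≠ 0 if and only if A and B are linearly independent over k. -/
open Matrix

section PencilOfTernaryForms

variable {k : Type*} [Field k]

theorem two_mul_det_smul_sub_smul {R : Type*} [CommRing R] (A B : Matrix (Fin 3) (Fin 3) R)
    (x y : R) :
    2 * (x • A - y • B).det = 2 * x ^ 3 * A.det - 2 * y ^ 3 * B.det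
      + x ^ 2 * y * ((A - B).det - (A + B).det + 2 * B.det)
      + x * y ^ 2 * ((A - B).det + (A + B).det - 2 * A.det) := by
  simp only [det_fin_three, Matrix.sub_apply, Matrix.add_apply, Matrix.smul_apply, smul_eq_mul]
  ring

theorem exists_det_smul_sub_smul_ne_zero (h2 : (2 : k) ≠ 0) {A B : Matrix (Fin 3) (Fin 3) k}
    (hns : (((MvPolynomial.X 0 : MvPolynomial (Fin 2) k) • A.map MvPolynomial.C
        - (MvPolynomial.X 1 : MvPolynomial (Fin 2) k) • B.map MvPolynomial.C :
          Matrix (Fin 3) (Fin 3) (MvPolynomial (Fin 2) k))).det ≠ 0) :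
    ∃ x y : k, (x • A - y • B).det ≠ 0 := by
  by_contra! H
  have hA : A.det = 0 := by simpa using H 1 0
  have hB : B.det = 0 := by simpa [det_neg] using H 0 1
  have hsub : (A - B).det = 0 := by simpa using H 1 1
  have hadd : (A + B).det = 0 := by simpa using H 1 (-1)
  have map_det (N : Matrix (Fin 3) (Fin 3) k) :
      (N.map (MvPolynomial.C : k →+* MvPolynomial (Fin 2) k)).det = MvPolynomial.C N.det :=
    (RingHom.map_det _ N).symm
  have key := two_mul_det_smul_sub_smul
    (A.map (MvPolynomial.C : k →+* MvPolynomial (Fin 2) k)) (B.map MvPolynomial.C)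
    (MvPolynomial.X 0) (MvPolynomial.X 1)
  rw [← Matrix.map_sub _ (map_sub _), ← Matrix.map_add _ (map_add _), map_det, map_det, map_det,
    map_det, hA, hB, hsub, hadd] at key
  simp only [map_zero, mul_zero, sub_zero, add_zero] at key
  refine hns ((mul_eq_zero.mp key).resolve_left fun h => h2 ?_)
  exact MvPolynomial.C_injective (Fin 2) k (by rw [map_ofNat, map_zero, h])

/-- A quadratic polynomial has at most two roots among the four elements `0, 1, -1, 2`. -/
theorem exists_ne_and_quadratic_ne_zero (h2 : (2 : k) ≠ 0) (h3 : (3 : k) ≠ 0) {a : k}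
    (ha : a ≠ 0) (b c : k) :
    ∃ s t : k, s ≠ t ∧ a * s ^ 2 + b * s + c ≠ 0 ∧ a * t ^ 2 + b * t + c ≠ 0 := by
  have key (x y z : k) (hxy : x ≠ y) (hyz : y ≠ z) (hxz : x ≠ z)
      (hx : a * x ^ 2 + b * x + c = 0) (hy : a * y ^ 2 + b * y + c = 0) :
      a * z ^ 2 + b * z + c ≠ 0 := by
    intro hz
    have : a * ((x - y) * (y - z) * (x - z)) = 0 := by
      linear_combination (y - z) * hx - (x - z) * hy + (x - y) * hz
    simp [ha, sub_eq_zero, hxy, hyz, hxz] at this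
  have h01 : (0 : k) ≠ 1 := zero_ne_one
  have h0n : (0 : k) ≠ -1 := by simp
  have h02 : (0 : k) ≠ 2 := h2.symm
  have h1n : (1 : k) ≠ -1 := fun h => h2 (by linear_combination h)
  have h12 : (1 : k) ≠ 2 := fun h => h01 (by linear_combination h)
  have hn2 : (-1 : k) ≠ 2 := fun h => h3 (by linear_combination -h)
  by_cases e0 : a * 0 ^ 2 + b * 0 + c = 0
  · by_cases e1 : a * 1 ^ 2 + b * 1 + c = 0
    · exact ⟨-1, 2, hn2, key 0 1 _ h01 h1n h0n e0 e1, key 0 1 _ h01 h12 h02 e0 e1⟩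
    · by_cases en : a * (-1) ^ 2 + b * (-1) + c = 0
      · exact ⟨1, 2, h12, e1, key 0 (-1) _ h0n hn2 h02 e0 en⟩
      · exact ⟨1, -1, h1n, e1, en⟩
  · by_cases e1 : a * 1 ^ 2 + b * 1 + c = 0
    · by_cases en : a * (-1) ^ 2 + b * (-1) + c = 0
      · exact ⟨0, 2, h02, e0, key 1 (-1) _ h1n hn2 h12 e1 en⟩
      · exact ⟨0, -1, h0n, e0, en⟩
    · exact ⟨0, 1, h01, e0, e1⟩

theorem Matrix.IsSymm.dotProduct_mulVec_comm {n R : Type*} [Fintype n] [CommRing R]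
    {C : Matrix n n R} (hC : C.IsSymm) (x y : n → R) : x ⬝ᵥ C *ᵥ y = y ⬝ᵥ C *ᵥ x := by
  rw [dotProduct_mulVec, ← mulVec_transpose, hC.eq, dotProduct_comm]

theorem Matrix.IsSymm.dotProduct_mulVec_smul_add_smul {n R : Type*} [Fintype n] [CommRing R]
    {C : Matrix n n R} (hC : C.IsSymm) (x y : n → R) (s t : R) :
    (s • x + t • y) ⬝ᵥ C *ᵥ (s • x + t • y) =
      s ^ 2 * (x ⬝ᵥ C *ᵥ x) + 2 * s * t * (x ⬝ᵥ C *ᵥ y) + t ^ 2 * (y ⬝ᵥ C *ᵥ y) := by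
  simp only [mulVec_add, mulVec_smul, dotProduct_add, add_dotProduct, smul_dotProduct,
    dotProduct_smul, smul_eq_mul, hC.dotProduct_mulVec_comm y x]
  ring

/-- Two singular ternary quadratic forms with zeros `x`, `y` that are not in their kernels have a
common nontrivial zero, since each of them vanishes on a plane. -/
theorem exists_ne_zero_common_zero_of_det_eq_zero {C D : Matrix (Fin 3) (Fin 3) k}
    (hC : C.IsSymm) (hD : D.IsSymm) (hC0 : C.det = 0) (hD0 : D.det = 0) {x y : Fin 3 → k}
    (hx : x ⬝ᵥ C *ᵥ x = 0) (hy : y ⬝ᵥ D *ᵥ y = 0) (hCx : C *ᵥ x ≠ 0) (hDy : D *ᵥ y ≠ 0) :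
    ∃ z : Fin 3 → k, z ≠ 0 ∧ z ⬝ᵥ C *ᵥ z = 0 ∧ z ⬝ᵥ D *ᵥ z = 0 := by
  obtain ⟨v, hv, hCv⟩ := exists_mulVec_eq_zero_iff.mpr hC0
  obtain ⟨w, hw, hDw⟩ := exists_mulVec_eq_zero_iff.mpr hD0
  have hdep : ¬ LinearIndependent k ![x, v, y, w] := fun h => by
    simpa using h.fintype_card_le_finrank
  obtain ⟨g, hg, hg0⟩ := Fintype.not_linearIndependent_iff.mp hdep
  replace hg : g 0 • x + g 1 • v + g 2 • y + g 3 • w = 0 := by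
    simpa [Fin.sum_univ_four] using hg
  have hg' : g 0 • x + g 1 • v = (-g 2) • y + (-g 3) • w := by
    linear_combination (norm := module) hg
  refine ⟨g 0 • x + g 1 • v, fun h0 => ?_, ?_, ?_⟩
  · have e0 : g 0 = 0 := by
      simpa [mulVec_add, mulVec_smul, hCv, hCx] using congrArg (C *ᵥ ·) h0
    have e2 : g 2 = 0 := by
      simpa [mulVec_add, mulVec_smul, mulVec_neg, hDw, hDy] using
        congrArg (D *ᵥ ·) (hg'.symm.trans h0)
    have e1 : g 1 = 0 := by simpa [e0, hv] using h0
    have e3 : g 3 = 0 := by simpa [e2, hw] using hg'.symm.trans h0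
    obtain ⟨i, hi⟩ := hg0
    fin_cases i <;> contradiction
  · simp [hC.dotProduct_mulVec_smul_add_smul, hx, hCv]
  · rw [hg', hD.dotProduct_mulVec_smul_add_smul]
    simp [hy, hDw]

theorem Matrix.IsSymm.exists_dotProduct_mulVec_ne_zero (h2 : (2 : k) ≠ 0) {n : Type*} [Fintype n]
    {C : Matrix n n k} (hC : C.IsSymm) {x : n → k} (hx : C *ᵥ x ≠ 0) :
    ∃ u : n → k, u ⬝ᵥ C *ᵥ u ≠ 0 := by
  by_contra! H
  refine hx (dotProduct_eq_zero _ fun w => ?_)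
  have := hC.dotProduct_mulVec_smul_add_smul w x 1 1
  rw [H, H, H] at this
  rw [dotProduct_comm]
  simpa [h2] using this

/-- If every vector off the zero locus of a nonzero quadratic form is an eigenvector of `T`, then
so is every vector. -/
theorem exists_mulVec_eq_smul_of_quadratic_ne_zero (h2 : (2 : k) ≠ 0) (h3 : (3 : k) ≠ 0)
    {n : Type*} [Fintype n] {C T : Matrix n n k} (hC : C.IsSymm) {u : n → k}
    (hu : u ⬝ᵥ C *ᵥ u ≠ 0)
    (hT : ∀ x : n → k, x ⬝ᵥ C *ᵥ x ≠ 0 → ∃ c : k, T *ᵥ x = c • x) (w : n → k) :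
    ∃ c : k, T *ᵥ w = c • w := by
  obtain ⟨c, hc⟩ := hT u hu
  obtain ⟨s, t, hst, hs, ht⟩ := exists_ne_and_quadratic_ne_zero h2 h3 hu
    (2 * (w ⬝ᵥ C *ᵥ u)) (w ⬝ᵥ C *ᵥ w)
  have hQ (r : k) : ((1 : k) • w + r • u) ⬝ᵥ C *ᵥ ((1 : k) • w + r • u) =
      (u ⬝ᵥ C *ᵥ u) * r ^ 2 + 2 * (w ⬝ᵥ C *ᵥ u) * r + w ⬝ᵥ C *ᵥ w := by
    rw [hC.dotProduct_mulVec_smul_add_smul]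
    ring
  obtain ⟨a, ha⟩ := hT _ (hQ s ▸ hs)
  obtain ⟨b, hb⟩ := hT _ (hQ t ▸ ht)
  simp only [one_smul, mulVec_add, mulVec_smul, hc] at ha hb
  by_cases hab : a = b
  · subst hab
    have : (s - t) • (c • u) = (s - t) • (a • u) := by
      linear_combination (norm := module) ha - hb
    have hcu := smul_right_injective _ (sub_ne_zero.mpr hst) this
    refine ⟨a, ?_⟩
    linear_combination (norm := module) ha - s • hcu
  · have hw : (a - b) • w = ((s - t) * c - a * s + b * t) • u := by
      linear_combination (norm := module) hb - ha
    have hw' : w = ((a - b)⁻¹ * ((s - t) * c - a * s + b * t)) • u := by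
      rw [mul_smul, ← hw, inv_smul_smul₀ (sub_ne_zero.mpr hab)]
    refine ⟨c, ?_⟩
    rw [hw', mulVec_smul, hc, smul_comm]

theorem exists_eq_smul_of_forall_mulVec_eq_smul {M N : Matrix (Fin 3) (Fin 3) k}
    (hM : M.det ≠ 0) (h : ∀ w, ∃ c : k, (M⁻¹ * N) *ᵥ w = c • w) : ∃ c : k, N = c • M := by
  obtain ⟨c, hc⟩ := (toLin' (M⁻¹ * N)).exists_eq_smul_id_of_forall_notLinearIndependent fun v => by
    obtain ⟨c, hc⟩ := h v
    intro hli
    have := LinearIndependent.pair_iff.mp hli c (-1) (by rw [toLin'_apply, hc]; module)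
    simp at this
  refine ⟨c, ?_⟩
  have hscalar : M⁻¹ * N = c • 1 := toLin'.injective (by rw [hc, map_smul, toLin'_one]; rfl)
  rw [← mul_nonsing_inv_cancel_left M N hM.isUnit, hscalar, Matrix.mul_smul, Matrix.mul_one]

end PencilOfTernaryForms

theorem stmt_5 {k : Type*} [Field k] (h2 : (2 : k) ≠ 0) (h3 : (3 : k) ≠ 0)
    (A B : Matrix (Fin 3) (Fin 3) k)
    (hsA : A.IsSymm) (hsB : B.IsSymm)
    -- (A, B) non-singular
    (hns : (((MvPolynomial.X 0 : MvPolynomial (Fin 2) k) • A.map MvPolynomial.C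
        - (MvPolynomial.X 1 : MvPolynomial (Fin 2) k) • B.map MvPolynomial.C :
          Matrix (Fin 3) (Fin 3) (MvPolynomial (Fin 2) k))).det ≠ 0)
    -- (A, B) anisotropic over k
    (han : ∀ x : Fin 3 → k, x ⬝ᵥ (A *ᵥ x) = 0 → x ⬝ᵥ (B *ᵥ x) = 0 → x = 0) :
    (∃ h : Fin 3 → k,
        ((h ⬝ᵥ (B *ᵥ h)) • A - (h ⬝ᵥ (A *ᵥ h)) • B).det ≠ 0)
    ↔ (∀ a b : k, a • A + b • B = 0 → a = 0 ∧ b = 0) := by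
  constructor
  · rintro ⟨h, hh⟩ a b hab
    set p := h ⬝ᵥ B *ᵥ h
    set q := h ⬝ᵥ A *ᵥ h
    have hC : p • A - q • B ≠ 0 := fun h0 => hh (by simp [h0])
    have hpq : a * q + b * p = 0 := by
      simpa [add_mulVec, smul_mulVec] using congrArg (fun N => h ⬝ᵥ N *ᵥ h) hab
    have ha : a • (p • A - q • B) = 0 := by
      linear_combination (norm := module) p • hab - hpq • B
    have hb : b • (p • A - q • B) = 0 := by
      linear_combination (norm := module) hpq • A - q • hab
    exact ⟨(smul_eq_zero.mp ha).resolve_right hC, (smul_eq_zero.mp hb).resolve_right hC⟩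
  · intro hind
    by_contra! hdet
    obtain ⟨x, y, hM⟩ := exists_det_smul_sub_smul_ne_zero h2 hns
    set M := x • A - y • B with hMdef
    let C (h : Fin 3 → k) := (h ⬝ᵥ B *ᵥ h) • A - (h ⬝ᵥ A *ᵥ h) • B
    have hCsymm (h) : (C h).IsSymm := (hsA.smul _).sub (hsB.smul _)
    have hCquad (h z) : z ⬝ᵥ C h *ᵥ z =
        (h ⬝ᵥ B *ᵥ h) * (z ⬝ᵥ A *ᵥ z) - (h ⬝ᵥ A *ᵥ h) * (z ⬝ᵥ B *ᵥ z) := by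
      simp [C, sub_mulVec, smul_mulVec]
    have hCself (h) : h ⬝ᵥ C h *ᵥ h = 0 := by rw [hCquad]; ring
    have heig (h) (hh : C h *ᵥ h = 0) :
        (∃ c : k, (M⁻¹ * A) *ᵥ h = c • h) ∧ ∃ c : k, (M⁻¹ * B) *ᵥ h = c • h := by
      by_cases h0 : h = 0
      · exact ⟨⟨0, by simp [h0]⟩, ⟨0, by simp [h0]⟩⟩
      set p := h ⬝ᵥ B *ᵥ h
      set q := h ⬝ᵥ A *ᵥ h
      have hAB : p • A *ᵥ h - q • B *ᵥ h = 0 := by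
        simpa [C, sub_mulVec, smul_mulVec] using hh
      have hMh : M *ᵥ h = x • A *ᵥ h - y • B *ᵥ h := by
        simp [hMdef, sub_mulVec, smul_mulVec]
      have hqM : q • M *ᵥ h = (x * q - y * p) • A *ᵥ h := by
        rw [hMh]
        linear_combination (norm := module) y • hAB
      have hpM : p • M *ᵥ h = (x * q - y * p) • B *ᵥ h := by
        rw [hMh]
        linear_combination (norm := module) x • hAB
      have hMh0 : M *ᵥ h ≠ 0 := fun e => hM (exists_mulVec_eq_zero_iff.mp ⟨h, h0, e⟩)
      have hr : x * q - y * p ≠ 0 := by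
        intro hr
        rw [hr, zero_smul] at hqM hpM
        exact h0 (han h ((smul_eq_zero.mp hqM).resolve_right hMh0)
          ((smul_eq_zero.mp hpM).resolve_right hMh0))
      have hinv (N : Matrix (Fin 3) (Fin 3) k) (c : k)
          (hN : c • M *ᵥ h = (x * q - y * p) • N *ᵥ h) : ∃ c : k, (M⁻¹ * N) *ᵥ h = c • h := by
        refine ⟨(x * q - y * p)⁻¹ * c, ?_⟩
        rw [← mulVec_mulVec, ← inv_smul_smul₀ hr (N *ᵥ h), ← hN, smul_smul, mulVec_smul,
          mulVec_mulVec, nonsing_inv_mul M hM.isUnit, one_mulVec]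
      exact ⟨hinv A q hqM, hinv B p hpM⟩
    have hzero (h h') (hh : C h *ᵥ h ≠ 0) (hh' : C h' *ᵥ h' ≠ 0) : h' ⬝ᵥ C h *ᵥ h' = 0 := by
      obtain ⟨z, hz, hz1, hz2⟩ := exists_ne_zero_common_zero_of_det_eq_zero (hCsymm h) (hCsymm h')
        (hdet h) (hdet h') (hCself h) (hCself h') hh hh'
      rw [hCquad] at hz1 hz2 ⊢
      by_contra hne
      refine hz (han z ((mul_eq_zero.mp ?_).resolve_left hne)
        ((mul_eq_zero.mp ?_).resolve_left hne))
      · linear_combination (h' ⬝ᵥ A *ᵥ h') * hz1 - (h ⬝ᵥ A *ᵥ h) * hz2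
      · linear_combination (h' ⬝ᵥ B *ᵥ h') * hz1 - (h ⬝ᵥ B *ᵥ h) * hz2
    have hall (h) :
        (∃ c : k, (M⁻¹ * A) *ᵥ h = c • h) ∧ ∃ c : k, (M⁻¹ * B) *ᵥ h = c • h := by
      by_cases hK : ∀ h, C h *ᵥ h = 0
      · exact heig h (hK h)
      push Not at hK
      obtain ⟨h₀, hh₀⟩ := hK
      obtain ⟨u, hu⟩ := (hCsymm h₀).exists_dotProduct_mulVec_ne_zero h2 hh₀
      have hoff (z) (hz : z ⬝ᵥ C h₀ *ᵥ z ≠ 0) : C z *ᵥ z = 0 := by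
        by_contra hne
        exact hz (hzero h₀ z hh₀ hne)
      exact ⟨exists_mulVec_eq_smul_of_quadratic_ne_zero h2 h3 (hCsymm h₀) hu
          (fun z hz => (heig z (hoff z hz)).1) h,
        exists_mulVec_eq_smul_of_quadratic_ne_zero h2 h3 (hCsymm h₀) hu
          (fun z hz => (heig z (hoff z hz)).2) h⟩
    obtain ⟨c, hc⟩ := exists_eq_smul_of_forall_mulVec_eq_smul hM fun w => (hall w).1
    obtain ⟨d, hd⟩ := exists_eq_smul_of_forall_mulVec_eq_smul hM fun w => (hall w).2
    obtain ⟨hd0, hc0⟩ := hind d (-c) (by rw [hc, hd]; module)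
    rw [neg_eq_zero] at hc0
    have hA0 : A = 0 := by rw [hc, hc0, zero_smul]
    exact one_ne_zero (hind 1 0 (by simp [hA0])).1
end

section
/- Let k be a field of characteristic ≠ 2, 3, let a₀, a₁, a₂, a₃ ∈ k, and set f(x) = x⁴ + a₃x³ + a₂x² + a₁x + a₀. Define the ternary quadratic forms Ã(x₁,x₂,x₃) = x₁x₃ − x₂² and B̃(x₁,x₂,x₃) = −( x₁² + a₃x₁x₂ + (a₂/3)x₁x₃ + (2a₂/3)x₂² + a₁x₂x₃ + a₀x₃² ). Then for every field extension K of k, there exists a nonzero vector (x₁,x₂,x₃) ∈ K³ with Ã(x₁,x₂,x₃) = B̃(x₁,x₂,x₃) = 0 if and only if the polynomial f has a root in K. -/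
universe u v

theorem stmt_6 {k : Type u} [Field k] (h2 : (2 : k) ≠ 0) (h3 : (3 : k) ≠ 0)
    (a₀ a₁ a₂ a₃ : k) :
    ∀ (K : Type v) [Field K] [Algebra k K],
      (∃ x : Fin 3 → K, x ≠ 0 ∧
          x 0 * x 2 - x 1 ^ 2 = 0 ∧
          -(x 0 ^ 2 + algebraMap k K a₃ * (x 0 * x 1)
            + algebraMap k K (a₂ / 3) * (x 0 * x 2)
            + algebraMap k K (2 * a₂ / 3) * x 1 ^ 2
            + algebraMap k K a₁ * (x 1 * x 2)
            + algebraMap k K a₀ * x 2 ^ 2) = 0)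
      ↔ (∃ r : K, r ^ 4 + algebraMap k K a₃ * r ^ 3 + algebraMap k K a₂ * r ^ 2
            + algebraMap k K a₁ * r + algebraMap k K a₀ = 0) := by
  intro K _ _
  obtain ⟨c, rfl⟩ : ∃ c : k, a₂ = 3 * c := ⟨a₂ / 3, by field_simp⟩
  have hc : 3 * c / 3 = c := by field_simp
  have hc' : 2 * (3 * c) / 3 = 2 * c := by field_simp
  rw [hc, hc']
  simp only [map_mul, map_ofNat]
  constructor
  · rintro ⟨x, hx, hA, hB⟩
    have hx2 : x 2 ≠ 0 := by
      intro h
      have hx1 : x 1 = 0 := by simpa [h] using hA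
      have hx0 : x 0 = 0 := by simpa [h, hx1] using hB
      exact hx (funext fun i => by fin_cases i <;> assumption)
    obtain ⟨r, hr⟩ : ∃ r, x 1 = r * x 2 := ⟨x 1 / x 2, by field_simp⟩
    have hx0 : x 0 = r ^ 2 * x 2 := by
      apply mul_right_cancel₀ hx2
      rw [hr] at hA
      linear_combination hA
    rw [hr, hx0] at hB
    refine ⟨r, mul_right_cancel₀ (pow_ne_zero 2 hx2) ?_⟩
    linear_combination -hB
  · rintro ⟨r, hr⟩
    refine ⟨![r ^ 2, r, 1], fun h => one_ne_zero (congrFun h 2), ?_, ?_⟩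
    · simp
    · simp only [Matrix.cons_val]
      linear_combination -hr
end

section
/- Let k be a field of characteristic ≠ 2, 3 and let f(x,y) = ax³ + bx²y + cxy² + dy³ ∈ k[x,y] be a nonzero binary cubic form having no multiple roots, i.e., the three linear factors of f over an algebraic closure of k are pairwise non-proportional. Suppose V ∈ GL₂(k) and u ∈ k satisfy (det V)⁻¹ · f((x,y)·V) = u · f(x,y) as polynomials in x, y. Then Vⁿ = uⁿ·I for some n ∈ {1, 2, 3}. -/
open Matrix

section BinaryCubic

/-- A binary cubic form that vanishes as a function has zero coefficients if `2 ≠ 0`. -/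
theorem binaryCubic_coeffs_eq_zero {K : Type*} [Field K] (h2 : (2 : K) ≠ 0) {a b c d : K}
    (h : ∀ x y : K, a * x ^ 3 + b * x ^ 2 * y + c * x * y ^ 2 + d * y ^ 3 = 0) :
    a = 0 ∧ b = 0 ∧ c = 0 ∧ d = 0 := by
  have ha : a = 0 := by simpa using h 1 0
  have hd : d = 0 := by simpa using h 0 1
  have hp := h 1 1
  have hm := h 1 (-1)
  subst ha hd
  have hc : c = 0 := (mul_eq_zero.mp (by linear_combination hp + hm : 2 * c = 0)).resolve_left h2
  exact ⟨rfl, by linear_combination hp - hc, hc, rfl⟩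

/-- The discriminant of the binary cubic form with coefficients `a, b, c, d`. -/
def binaryCubicDiscr {R : Type*} [CommRing R] (a b c d : R) : R :=
  b ^ 2 * c ^ 2 - 4 * a * c ^ 3 - 4 * b ^ 3 * d - 27 * a ^ 2 * d ^ 2 + 18 * a * b * c * d

theorem map_binaryCubicDiscr {R S : Type*} [CommRing R] [CommRing S] (φ : R →+* S) (a b c d : R) :
    φ (binaryCubicDiscr a b c d) = binaryCubicDiscr (φ a) (φ b) (φ c) (φ d) := by
  simp [binaryCubicDiscr, map_ofNat φ]

/-- A product of three pairwise non-proportional linear forms has nonzero discriminant. -/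
theorem binaryCubicDiscr_ne_zero_of_eq_prod {K : Type*} [Field K] (h2 : (2 : K) ≠ 0)
    {a b c d : K} {l : Fin 3 → K × K}
    (h : ∀ x y : K, a * x ^ 3 + b * x ^ 2 * y + c * x * y ^ 2 + d * y ^ 3
      = ∏ i, ((l i).1 * x + (l i).2 * y))
    (hl : ∀ i j, i ≠ j → (l i).1 * (l j).2 ≠ (l i).2 * (l j).1) :
    binaryCubicDiscr a b c d ≠ 0 := by
  have h01 := sub_ne_zero.mpr (hl 0 1 (by decide))
  have h02 := sub_ne_zero.mpr (hl 0 2 (by decide))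
  have h12 := sub_ne_zero.mpr (hl 1 2 (by decide))
  simp only [Fin.prod_univ_three] at h
  generalize l 0 = l₀ at *
  generalize l 1 = l₁ at *
  generalize l 2 = l₂ at *
  obtain ⟨p, p'⟩ := l₀
  obtain ⟨q, q'⟩ := l₁
  obtain ⟨r, r'⟩ := l₂
  dsimp only at *
  obtain ⟨ha, hb, hc, hd⟩ := binaryCubic_coeffs_eq_zero (a := a - p * q * r)
    (b := b - (p * q * r' + p * q' * r + p' * q * r))
    (c := c - (p * q' * r' + p' * q * r' + p' * q' * r)) (d := d - p' * q' * r') h2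
    (fun x y => by linear_combination h x y)
  rw [sub_eq_zero] at ha hb hc hd
  have key : binaryCubicDiscr a b c d
      = ((p * q' - p' * q) * (p * r' - p' * r) * (q * r' - q' * r)) ^ 2 := by
    rw [ha, hb, hc, hd, binaryCubicDiscr]; ring
  rw [key]
  exact pow_ne_zero _ (mul_ne_zero (mul_ne_zero h01 h02) h12)

variable {k : Type*} [Field k] {a b c d p q r s u : k}

/-- If `!![p, q; r, s]` scales a nonzero binary cubic form by `m`, then `m` is a root of the
characteristic polynomial of its third symmetric power. -/
theorem symCube_charpoly_eq_zero {m : k} (hf : ¬(a = 0 ∧ b = 0 ∧ c = 0 ∧ d = 0))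
    (ha : a * p ^ 3 + b * p ^ 2 * q + c * p * q ^ 2 + d * q ^ 3 = m * a)
    (hb : 3 * a * p ^ 2 * r + b * (p ^ 2 * s + 2 * p * q * r) + c * (q ^ 2 * r + 2 * p * q * s)
      + 3 * d * q ^ 2 * s = m * b)
    (hc : 3 * a * p * r ^ 2 + b * (2 * p * r * s + q * r ^ 2) + c * (2 * q * r * s + p * s ^ 2)
      + 3 * d * q * s ^ 2 = m * c)
    (hd : a * r ^ 3 + b * r ^ 2 * s + c * r * s ^ 2 + d * s ^ 3 = m * d) :
    (m ^ 2 - (p * s - q * r) * (p + s) * m + (p * s - q * r) ^ 3) *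
      (m ^ 2 - ((p + s) ^ 3 - 3 * (p + s) * (p * s - q * r)) * m + (p * s - q * r) ^ 3) = 0 := by
  let M : Matrix (Fin 4) (Fin 4) k :=
    !![p ^ 3 - m, p ^ 2 * q, p * q ^ 2, q ^ 3;
      3 * p ^ 2 * r, p ^ 2 * s + 2 * p * q * r - m, q ^ 2 * r + 2 * p * q * s, 3 * q ^ 2 * s;
      3 * p * r ^ 2, 2 * p * r * s + q * r ^ 2, 2 * q * r * s + p * s ^ 2 - m, 3 * q * s ^ 2;
      r ^ 3, r ^ 2 * s, r * s ^ 2, s ^ 3 - m]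
  have hM : M.det = 0 := by
    refine Matrix.exists_mulVec_eq_zero_iff.mp ⟨![a, b, c, d], fun h => hf ?_, ?_⟩
    · exact ⟨congrFun h 0, congrFun h 1, congrFun h 2, congrFun h 3⟩
    · ext i
      fin_cases i <;> simp [M, Matrix.mulVec, dotProduct, Fin.sum_univ_four]
      · linear_combination ha
      · linear_combination hb
      · linear_combination hc
      · linear_combination hd
  rw [← hM]
  simp [M, Matrix.det_succ_row_zero, Fin.sum_univ_succ, Fin.succAbove]
  ring

/-- A matrix that is a similitude of factor `u ^ 2 = -det` of a nonzero binary quadratic form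
has trace zero. -/
theorem trace_eq_zero_of_quadratic_similitude {A B C : k} (h2 : (2 : k) ≠ 0) (hu : u ≠ 0)
    (hD : p * s - q * r = -u ^ 2) (hdisc : B ^ 2 - 4 * A * C ≠ 0)
    (hA : A * p ^ 2 + B * p * q + C * q ^ 2 = u ^ 2 * A)
    (hB : 2 * A * p * r + B * (p * s + q * r) + 2 * C * q * s = u ^ 2 * B)
    (hC : A * r ^ 2 + B * r * s + C * s ^ 2 = u ^ 2 * C) : p + s = 0 := by
  have hu2 : 2 * u ^ 2 ≠ 0 := mul_ne_zero h2 (pow_ne_zero _ hu)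
  by_contra ht
  have cancel : ∀ z : k, 2 * u ^ 2 * (p + s) * z = 0 → z = 0 := fun z hz =>
    (mul_eq_zero.mp hz).resolve_left (mul_ne_zero hu2 ht)
  have hA0 : A = 0 := cancel _ (by
    linear_combination -2 * s * hA + q * hB + (2 * A * p + B * q) * hD)
  have hC0 : C = 0 := cancel _ (by
    linear_combination -2 * p * hC + r * hB + (2 * C * s + B * r) * hD)
  subst hA0 hC0
  have hB0 : B = 0 := cancel _ (by
    linear_combination 2 * r * hA - p * hB - s * hB + 2 * q * hC + B * (p + s) * hD)
  exact hdisc (by rw [hB0]; ring)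

/-- A proper similitude of a nondegenerate binary quadratic form that has a double eigenvalue
is scalar. -/
theorem eq_scalar_of_quadratic_similitude {A B C : k} (h2 : (2 : k) ≠ 0) (hu : u ≠ 0)
    (hD : p * s - q * r = u ^ 2) (ht : p + s = 2 * u) (hdisc : B ^ 2 - 4 * A * C ≠ 0)
    (hA : A * p ^ 2 + B * p * q + C * q ^ 2 = u ^ 2 * A)
    (hB : 2 * A * p * r + B * (p * s + q * r) + 2 * C * q * s = u ^ 2 * B)
    (hC : A * r ^ 2 + B * r * s + C * s ^ 2 = u ^ 2 * C) :
    p = u ∧ q = 0 ∧ r = 0 ∧ s = u := by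
  have hu2 : 2 * u ^ 2 ≠ 0 := mul_ne_zero h2 (pow_ne_zero _ hu)
  have h₁ : A * (p - s) + B * q = 0 := (mul_eq_zero.mp (by
    linear_combination 2 * s * hA - q * hB - (2 * A * p + B * q) * hD :
    2 * u ^ 2 * (A * (p - s) + B * q) = 0)).resolve_left hu2
  have h₂ : C * (s - p) + B * r = 0 := (mul_eq_zero.mp (by
    linear_combination 2 * p * hC - r * hB - (2 * C * s + B * r) * hD :
    2 * u ^ 2 * (C * (s - p) + B * r) = 0)).resolve_left hu2
  have h₃ : C * q + A * r = 0 := (mul_eq_zero.mp (by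
    linear_combination -2 * r * hA + p * hB - (B * p + 2 * C * q) * hD :
    2 * u ^ 2 * (C * q + A * r) = 0)).resolve_left hu2
  have h₀ : (p - s) ^ 2 + 4 * q * r = 0 := by linear_combination (p + s + 2 * u) * ht - 4 * hD
  have hq : q = 0 := pow_eq_zero_iff two_ne_zero |>.mp ((mul_eq_zero.mp (by
    linear_combination A ^ 2 * h₀ + (B * q - A * (p - s)) * h₁ - 4 * A * q * h₃ :
    (B ^ 2 - 4 * A * C) * q ^ 2 = 0)).resolve_left hdisc)
  have hr : r = 0 := pow_eq_zero_iff two_ne_zero |>.mp ((mul_eq_zero.mp (by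
    linear_combination C ^ 2 * h₀ + (B * r - C * (s - p)) * h₂ - 4 * C * r * h₃ :
    (B ^ 2 - 4 * A * C) * r ^ 2 = 0)).resolve_left hdisc)
  have hps : p - s = 0 := pow_eq_zero_iff two_ne_zero |>.mp (by
    linear_combination h₀ - 4 * q * hr)
  have hp : p = u := mul_left_cancel₀ h2 (by linear_combination ht + hps)
  exact ⟨hp, hq, hr, by linear_combination hp - hps⟩

/-- A matrix that scales a binary cubic form of nonzero discriminant by `u * det` is the scalar `u`,
or has characteristic polynomial `X ^ 2 - u ^ 2` or `X ^ 2 + u * X + u ^ 2`. -/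
theorem trace_det_of_binaryCubic_similitude (h2 : (2 : k) ≠ 0) (h3 : (3 : k) ≠ 0)
    (hdisc : binaryCubicDiscr a b c d ≠ 0) (hD : p * s - q * r ≠ 0)
    (ha : a * p ^ 3 + b * p ^ 2 * q + c * p * q ^ 2 + d * q ^ 3 = u * (p * s - q * r) * a)
    (hb : 3 * a * p ^ 2 * r + b * (p ^ 2 * s + 2 * p * q * r) + c * (q ^ 2 * r + 2 * p * q * s)
      + 3 * d * q ^ 2 * s = u * (p * s - q * r) * b)
    (hc : 3 * a * p * r ^ 2 + b * (2 * p * r * s + q * r ^ 2) + c * (2 * q * r * s + p * s ^ 2)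
      + 3 * d * q * s ^ 2 = u * (p * s - q * r) * c)
    (hd : a * r ^ 3 + b * r ^ 2 * s + c * r * s ^ 2 + d * s ^ 3 = u * (p * s - q * r) * d) :
    (p = u ∧ q = 0 ∧ r = 0 ∧ s = u) ∨ (p + s = 0 ∧ p * s - q * r = -u ^ 2) ∨
      (p + s = -u ∧ p * s - q * r = u ^ 2) := by
  have hf : ¬(a = 0 ∧ b = 0 ∧ c = 0 ∧ d = 0) := by
    rintro ⟨rfl, rfl, rfl, rfl⟩
    exact hdisc (by simp [binaryCubicDiscr])
  have hchar := symCube_charpoly_eq_zero hf ha hb hc hd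
  have hD2 := pow_ne_zero 2 hD
  have hA : (b ^ 2 - 3 * a * c) * p ^ 2 + (b * c - 9 * a * d) * p * q
      + (c ^ 2 - 3 * b * d) * q ^ 2 = u ^ 2 * (b ^ 2 - 3 * a * c) := by
    apply mul_left_cancel₀ hD2
    trans (u * (p * s - q * r) * b) ^ 2 - 3 * (u * (p * s - q * r) * a) * (u * (p * s - q * r) * c)
    · rw [← ha, ← hb, ← hc]; ring
    · ring
  have hB : 2 * (b ^ 2 - 3 * a * c) * p * r + (b * c - 9 * a * d) * (p * s + q * r)
      + 2 * (c ^ 2 - 3 * b * d) * q * s = u ^ 2 * (b * c - 9 * a * d) := by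
    apply mul_left_cancel₀ hD2
    trans (u * (p * s - q * r) * b) * (u * (p * s - q * r) * c)
      - 9 * (u * (p * s - q * r) * a) * (u * (p * s - q * r) * d)
    · rw [← ha, ← hb, ← hc, ← hd]; ring
    · ring
  have hC : (b ^ 2 - 3 * a * c) * r ^ 2 + (b * c - 9 * a * d) * r * s
      + (c ^ 2 - 3 * b * d) * s ^ 2 = u ^ 2 * (c ^ 2 - 3 * b * d) := by
    apply mul_left_cancel₀ hD2
    trans (u * (p * s - q * r) * c) ^ 2 - 3 * (u * (p * s - q * r) * b) * (u * (p * s - q * r) * d)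
    · rw [← hb, ← hc, ← hd]; ring
    · ring
  have hH : (b * c - 9 * a * d) ^ 2 - 4 * (b ^ 2 - 3 * a * c) * (c ^ 2 - 3 * b * d) ≠ 0 := by
    have : (b * c - 9 * a * d) ^ 2 - 4 * (b ^ 2 - 3 * a * c) * (c ^ 2 - 3 * b * d)
        = -3 * binaryCubicDiscr a b c d := by rw [binaryCubicDiscr]; ring
    rw [this]
    exact mul_ne_zero (neg_ne_zero.mpr h3) hdisc
  generalize b ^ 2 - 3 * a * c = A at *
  generalize b * c - 9 * a * d = B at *
  generalize c ^ 2 - 3 * b * d = C at *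
  have hDu : (p * s - q * r) ^ 2 = (u ^ 2) ^ 2 := by
    apply mul_left_cancel₀ hH
    trans (u ^ 2 * B) ^ 2 - 4 * (u ^ 2 * A) * (u ^ 2 * C)
    · rw [← hA, ← hB, ← hC]; ring
    · ring
  have hu : u ≠ 0 := by
    rintro rfl
    exact hD2 (by simpa using hDu)
  rcases sq_eq_sq_iff_eq_or_eq_neg.mp hDu with h | h
  · rw [h] at hchar
    have hprod : u ^ 8 * ((2 * u - (p + s)) ^ 2 * (u + (p + s)) ^ 2) = 0 := by
      linear_combination hchar
    rcases mul_eq_zero.mp ((mul_eq_zero.mp hprod).resolve_left (pow_ne_zero _ hu)) with h' | h'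
    · have ht : p + s = 2 * u := (sub_eq_zero.mp (pow_eq_zero_iff two_ne_zero |>.mp h')).symm
      exact Or.inl (eq_scalar_of_quadratic_similitude h2 hu h ht hH hA hB hC)
    · exact Or.inr (Or.inr
        ⟨by linear_combination pow_eq_zero_iff two_ne_zero |>.mp h', h⟩)
  · exact Or.inr (Or.inl ⟨trace_eq_zero_of_quadratic_similitude h2 hu h hH hA hB hC, h⟩)

end BinaryCubic

theorem stmt_7 {k : Type*} [Field k] (h2 : (2 : k) ≠ 0) (h3 : (3 : k) ≠ 0)
    (a b c d : k)
    (f : k → k → k)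
    (hf : f = fun x y => a * x ^ 3 + b * x ^ 2 * y + c * x * y ^ 2 + d * y ^ 3)
    -- f is nonzero and has no multiple roots: over an algebraic closure it is a product of
    -- three nonzero, pairwise non-proportional linear factors
    (hfac : ∃ l : Fin 3 → AlgebraicClosure k × AlgebraicClosure k,
      (∀ i, l i ≠ 0) ∧
      (∀ x y : AlgebraicClosure k,
        algebraMap k (AlgebraicClosure k) a * x ^ 3
          + algebraMap k (AlgebraicClosure k) b * x ^ 2 * y
          + algebraMap k (AlgebraicClosure k) c * x * y ^ 2
          + algebraMap k (AlgebraicClosure k) d * y ^ 3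
        = ∏ i, ((l i).1 * x + (l i).2 * y)) ∧
      (∀ i j, i ≠ j → (l i).1 * (l j).2 ≠ (l i).2 * (l j).1))
    (V : Matrix (Fin 2) (Fin 2) k) (hV : IsUnit V.det) (u : k)
    -- (det V)⁻¹ · f((x,y)·V) = u · f(x,y)
    (heq : ∀ x y : k,
      (V.det)⁻¹ * f ((![x, y] ᵥ* V) 0) ((![x, y] ᵥ* V) 1) = u * f x y) :
    ∃ n ∈ ({1, 2, 3} : Set ℕ), V ^ n = u ^ n • (1 : Matrix (Fin 2) (Fin 2) k) := by
  obtain ⟨l, -, hl, hl'⟩ := hfac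
  have h2' : (2 : AlgebraicClosure k) ≠ 0 := by
    rw [← map_ofNat (algebraMap k (AlgebraicClosure k)) 2]
    exact (map_ne_zero _).mpr h2
  have hdisc : binaryCubicDiscr a b c d ≠ 0 := by
    intro h
    refine binaryCubicDiscr_ne_zero_of_eq_prod h2' hl hl' ?_
    rw [← map_binaryCubicDiscr, h, map_zero]
  obtain ⟨p, q, r, s, rfl⟩ : ∃ p q r s, V = !![p, q; r, s] := ⟨_, _, _, _, V.eta_fin_two⟩
  have hD := hV.ne_zero
  rw [Matrix.det_fin_two_of] at hD heq
  subst hf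
  have heq' : ∀ x y : k,
      a * (x * p + y * r) ^ 3 + b * (x * p + y * r) ^ 2 * (x * q + y * s)
        + c * (x * p + y * r) * (x * q + y * s) ^ 2 + d * (x * q + y * s) ^ 3
      = u * (p * s - q * r) * (a * x ^ 3 + b * x ^ 2 * y + c * x * y ^ 2 + d * y ^ 3) := by
    intro x y
    have h := heq x y
    simp only [Matrix.vecMul, dotProduct, Fin.sum_univ_two] at h
    rw [inv_mul_eq_iff_eq_mul₀ hD] at h
    simp at h
    linear_combination h
  obtain ⟨ha, hb, hc, hd⟩ := binaryCubic_coeffs_eq_zero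
    (a := a * p ^ 3 + b * p ^ 2 * q + c * p * q ^ 2 + d * q ^ 3 - u * (p * s - q * r) * a)
    (b := 3 * a * p ^ 2 * r + b * (p ^ 2 * s + 2 * p * q * r) + c * (q ^ 2 * r + 2 * p * q * s)
      + 3 * d * q ^ 2 * s - u * (p * s - q * r) * b)
    (c := 3 * a * p * r ^ 2 + b * (2 * p * r * s + q * r ^ 2) + c * (2 * q * r * s + p * s ^ 2)
      + 3 * d * q * s ^ 2 - u * (p * s - q * r) * c)
    (d := a * r ^ 3 + b * r ^ 2 * s + c * r * s ^ 2 + d * s ^ 3 - u * (p * s - q * r) * d)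
    h2 (fun x y => by linear_combination heq' x y)
  rw [sub_eq_zero] at ha hb hc hd
  rcases trace_det_of_binaryCubic_similitude h2 h3 hdisc hD ha hb hc hd with
    ⟨rfl, rfl, rfl, rfl⟩ | ⟨ht, hdet⟩ | ⟨ht, hdet⟩
  · refine ⟨1, by simp, ?_⟩
    ext i j
    fin_cases i <;> fin_cases j <;> simp
  · refine ⟨2, by simp, ?_⟩
    ext i j
    fin_cases i <;> fin_cases j <;> simp [pow_succ, Matrix.mul_apply, Fin.sum_univ_two]
    · linear_combination p * ht - hdet
    · linear_combination q * ht
    · linear_combination r * ht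
    · linear_combination s * ht - hdet
  · refine ⟨3, by simp, ?_⟩
    obtain rfl : u = -(p + s) := by linear_combination ht
    ext i j
    fin_cases i <;> fin_cases j <;> simp [pow_succ, Matrix.mul_apply, Fin.sum_univ_two]
    · linear_combination -(2 * p + s) * hdet
    · linear_combination -q * hdet
    · linear_combination -r * hdet
    · linear_combination -(p + 2 * s) * hdet
end
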